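/- arXiv:math/0402248 — 4 statements merged into one kernel-verified Lean document; each statement's English description precedes it below -/
import Mathlib

section
/- Let A be a unital associative algebra over ℝ with multiplication μ ∈ C^1(A), ∂Φ := [μ,Φ]_G the Hochschild coboundary and b := R_μ the Hochschild boundary. Then for every Φ ∈ C^k(A): R_{∂Φ} = b∘R_Φ − (−1)^k R_Φ∘b as operators on Hochschild chains. In particular, (C_•(A), b) is a differential graded module over the differential graded Lie algebra (C^•(A), ∂, [·,·]_G). -/
open scoped BigOperators

/-- Evaluation of a Hochschild cochain with `m` arguments on the first `m` entries
of a sequence. -/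
def evalC {A : Type} [AddCommGroup A] [Module ℝ A] {m : ℕ}
    (Φ : MultilinearMap ℝ (fun _ : Fin m => A) A) (a : ℕ → A) : A :=
  Φ fun j => a j

/-- The Gerstenhaber "composition" of raw cochains (`mᵢ` = number of arguments of `Φᵢ`). -/
noncomputable def gcompM {A : Type} [AddCommGroup A] [Module ℝ A] (m₁ m₂ : ℕ)
    (Φ₁ Φ₂ : (ℕ → A) → A) : (ℕ → A) → A := fun a =>
  ∑ i ∈ Finset.range m₁,
    ((-1 : ℝ) ^ ((i : ℤ) * ((m₂ : ℤ) - 1))) •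
      Φ₁ fun j =>
        if j < i then a j else if j = i then Φ₂ (fun t => a (i + t)) else a (j + m₂ - 1)

/-- The Gerstenhaber bracket of raw cochains (`mᵢ = kᵢ + 1` arguments, degree `kᵢ`). -/
noncomputable def gbrM {A : Type} [AddCommGroup A] [Module ℝ A] (m₁ m₂ : ℕ)
    (Φ₁ Φ₂ : (ℕ → A) → A) : (ℕ → A) → A := fun a =>
  gcompM m₁ m₂ Φ₁ Φ₂ a -
    ((-1 : ℝ) ^ (((m₁ : ℤ) - 1) * ((m₂ : ℤ) - 1))) • gcompM m₂ m₁ Φ₂ Φ₁ a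

/-- The sequence of entries of the "first type" term of `R_Φ` applied to an elementary
Hochschild chain: the cochain `Φ` of degree `k` (with `k+1` arguments) is applied to the
`k+1` consecutive entries starting at position `i`. -/
def rIns {A : Type} (k : ℕ) (Φ : (ℕ → A) → A) (a : ℕ → A) (i : ℕ) : ℕ → A := fun p =>
  if p < i then a p else if p = i then Φ (fun t => a (i + t)) else a (p + k)

/-- The sequence of entries of the "second type" (cyclic) term of `R_Φ` applied to an
elementary Hochschild chain with entries `a 0, …, a N`: in position `0` the cochain `Φ`
is applied to `a_{j+1}, …, a_N, a_0, …, a_{k+j-N}`, and the remaining positions carry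
`a_{k+j-N+1}, …, a_j`. -/
def rCyc {A : Type} (k N : ℕ) (Φ : (ℕ → A) → A) (a : ℕ → A) (j : ℕ) : ℕ → A := fun p =>
  if p = 0 then
    Φ (fun t => if j + 1 + t ≤ N then a (j + 1 + t) else a (j + 1 + t - (N + 1)))
  else a (k + j - N + p)

/-- The operator `R_Φ` (for `Φ` a raw cochain of degree `k`, i.e. with `k+1` arguments)
applied to the elementary Hochschild chain `a 0 ⊗ a 1 ⊗ ⋯ ⊗ a (n+k)` of degree `-(n+k)`;
the result is a Hochschild chain of degree `-n`, an element of `A^{⊗(n+1)}`: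
`R_Φ(a₀ ⊗ ⋯ ⊗ a_N) = ∑_{i=0}^{N-k} (-1)^{k i} a₀ ⊗ ⋯ ⊗ Φ(a_i, …, a_{i+k}) ⊗ ⋯ ⊗ a_N
 + ∑_{j=N-k}^{N-1} (-1)^{N (j+1)} Φ(a_{j+1}, …, a_N, a₀, …, a_{k+j-N}) ⊗ a_{k+j+1-N} ⊗ ⋯ ⊗ a_j`
with `N = n + k`. -/
noncomputable def rApply {A : Type} [Ring A] [Algebra ℝ A] (k n : ℕ)
    (Φ : (ℕ → A) → A) (a : ℕ → A) : PiTensorProduct ℝ (fun _ : Fin (n + 1) => A) :=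
  (∑ i ∈ Finset.range (n + 1),
      ((-1 : ℝ) ^ (k * i)) •
        PiTensorProduct.tprod ℝ (fun p : Fin (n + 1) => rIns k Φ a i p)) +
    ∑ j ∈ Finset.Ico n (n + k),
      ((-1 : ℝ) ^ ((n + k) * (j + 1))) •
        PiTensorProduct.tprod ℝ (fun p : Fin (n + 1) => rCyc k (n + k) Φ a j p)

/-- The composition `R_{Φ₁} ∘ R_{Φ₂}` applied to the elementary Hochschild chain
`a 0 ⊗ ⋯ ⊗ a (n + k₁ + k₂)`, expanded by linearity of `R_{Φ₁}`. -/
noncomputable def rComp {A : Type} [Ring A] [Algebra ℝ A] (k₁ k₂ n : ℕ)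
    (Φ₁ Φ₂ : (ℕ → A) → A) (a : ℕ → A) : PiTensorProduct ℝ (fun _ : Fin (n + 1) => A) :=
  (∑ i ∈ Finset.range (n + k₁ + 1),
      ((-1 : ℝ) ^ (k₂ * i)) • rApply k₁ n Φ₁ (rIns k₂ Φ₂ a i)) +
    ∑ j ∈ Finset.Ico (n + k₁) (n + k₁ + k₂),
      ((-1 : ℝ) ^ ((n + k₁ + k₂) * (j + 1))) •
        rApply k₁ n Φ₁ (rCyc k₂ (n + k₁ + k₂) Φ₂ a j)


/-- The multiplication of `A` viewed as a raw Hochschild cochain in `C^1(A)`. -/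
def mulC (A : Type) [Mul A] : (ℕ → A) → A := fun a => a 0 * a 1

section DoubleSums

variable {M : Type} [AddCommGroup M]

theorem sum_range_add_two_range_add_one (n : ℕ) (f : ℕ → ℕ → M) :
    ∑ i ∈ Finset.range (n + 2), ∑ l ∈ Finset.range (n + 1), f i l =
      (∑ m ∈ Finset.range (n + 1), f m m) + (∑ m ∈ Finset.range (n + 1), f (m + 1) m) +
      (∑ m ∈ Finset.range (n + 1), ∑ l ∈ Finset.range m, f (m + 1) l) +
      ∑ m ∈ Finset.range (n + 1), ∑ l ∈ Finset.range m, f l m := by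
  induction n with
  | zero => simp [Finset.sum_range_succ]
  | succ n ih =>
    have h : ∑ i ∈ Finset.range (n + 1 + 2), ∑ l ∈ Finset.range (n + 1 + 1), f i l =
        (∑ i ∈ Finset.range (n + 2), ∑ l ∈ Finset.range (n + 1), f i l) +
        ((∑ l ∈ Finset.range (n + 1), f l (n + 1)) + f (n + 1) (n + 1)) +
        ((∑ l ∈ Finset.range (n + 1), f (n + 2) l) + f (n + 2) (n + 1)) := by
      rw [Finset.sum_range_succ, Finset.sum_range_succ _ (n + 1)]
      simp only [Finset.sum_range_succ _ (n + 1), Finset.sum_add_distrib]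
      abel
    rw [h, ih]
    simp only [Finset.sum_range_succ _ (n + 1)]
    abel

theorem sum_range_add_range_add_one (n k : ℕ) (g : ℕ → ℕ → M) :
    ∑ i ∈ Finset.range (n + k + 1), ∑ m ∈ Finset.range (n + 1), g i m =
      (∑ m ∈ Finset.range (n + 1), ∑ r ∈ Finset.range (k + 1), g (m + r) m) +
      (∑ m ∈ Finset.range (n + 1), ∑ l ∈ Finset.range m, g l m) +
      ∑ m ∈ Finset.range (n + 1), ∑ l ∈ Finset.range m, g (m + k) l := by
  induction n with
  | zero => simp
  | succ n ih =>
    have h : ∑ i ∈ Finset.range (n + 1 + k + 1), ∑ m ∈ Finset.range (n + 1 + 1), g i m =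
        (∑ i ∈ Finset.range (n + k + 1), ∑ m ∈ Finset.range (n + 1), g i m) +
        (∑ l ∈ Finset.range (n + 1), g (n + 1 + k) l) +
        ((∑ l ∈ Finset.range (n + 1), g l (n + 1)) +
          ∑ r ∈ Finset.range (k + 1), g (n + 1 + r) (n + 1)) := by
      rw [← Finset.sum_range_add (fun i => g i (n + 1)), show n + k + 1 = n + 1 + k by omega,
        ← Finset.sum_range_succ (fun i => ∑ l ∈ Finset.range (n + 1), g i l),
        show n + 1 + (k + 1) = n + 1 + k + 1 by omega, ← Finset.sum_add_distrib]
      simp only [Finset.sum_range_succ _ (n + 1)]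
    rw [h, ih]
    simp only [Finset.sum_range_succ _ (n + 1)]
    abel

theorem sum_range_window (n k s : ℕ) (hs : s < k) (g : ℕ → M) :
    ∑ i ∈ Finset.range (n + k + 1), g i =
      (∑ l ∈ Finset.range (s + 1), g l) + (∑ q ∈ Finset.range n, g (s + 1 + q)) +
      ∑ r ∈ Finset.range (k - s), g (n + s + 1 + r) := by
  rw [show n + k + 1 = s + 1 + n + (k - s) by omega, Finset.sum_range_add, Finset.sum_range_add]
  simp only [show s + 1 + n = n + s + 1 by omega]

theorem sum_range_antidiagonal_split (k : ℕ) (h : ℕ → ℕ → M) :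
    ∑ s ∈ Finset.range (k + 1), ∑ r ∈ Finset.range (k + 1), h s r =
      (∑ s ∈ Finset.range k, ∑ r ∈ Finset.range (k - s), h s r) +
      (∑ s ∈ Finset.range (k + 1), h s (k - s)) +
      ∑ s ∈ Finset.range k, ∑ l ∈ Finset.range (s + 1), h (s + 1) (k - s + l) := by
  have key : ∀ s ∈ Finset.range (k + 1), ∑ r ∈ Finset.range (k + 1), h s r =
      (∑ r ∈ Finset.range (k - s), h s r) + h s (k - s) +
        ∑ l ∈ Finset.range s, h s (k - s + 1 + l) := by
    intro s hs
    rw [Finset.mem_range] at hs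
    conv_lhs => rw [show k + 1 = k - s + 1 + s by omega]
    rw [Finset.sum_range_add, Finset.sum_range_succ]
  rw [Finset.sum_congr rfl key, Finset.sum_add_distrib, Finset.sum_add_distrib,
    Finset.sum_range_succ (fun s => ∑ r ∈ Finset.range (k - s), h s r),
    Finset.sum_range_succ' (fun s => ∑ l ∈ Finset.range s, h s (k - s + 1 + l))]
  simp only [Nat.sub_self, Finset.range_zero, Finset.sum_empty, add_zero]
  congr 1
  refine Finset.sum_congr rfl fun s hs => Finset.sum_congr rfl fun l _ => ?_
  rw [Finset.mem_range] at hs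
  rw [show k - (s + 1) + 1 = k - s by omega]

end DoubleSums

section Chains

/-- The sequence `a` with the block of entries `a i, …, a (i + k)` replaced by `x`. -/
def insSeq {A : Type} (k : ℕ) (a : ℕ → A) (i : ℕ) (x : A) : ℕ → A := fun p =>
  if p < i then a p else if p = i then x else a (p + k)

/-- The sequence `x, a (m + 1), a (m + 2), …`. -/
def headSeq {A : Type} (m : ℕ) (a : ℕ → A) (x : A) : ℕ → A := fun p =>
  if p = 0 then x else a (m + p)

/-- The cyclic reading of `a 0, …, a N` starting at `a (j + 1)`. -/
def cycArg {A : Type} (N : ℕ) (a : ℕ → A) (j : ℕ) : ℕ → A := fun t =>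
  if j + 1 + t ≤ N then a (j + 1 + t) else a (j + 1 + t - (N + 1))

theorem rCyc_eq_headSeq {A : Type} (k n s : ℕ) (F : (ℕ → A) → A) (a : ℕ → A) :
    rCyc k (n + k) F a (n + s) = headSeq s a (F (cycArg (n + k) a (n + s))) := by
  funext p
  simp only [rCyc, headSeq]
  rw [show k + (n + s) - (n + k) = s by omega]
  rfl

variable {A : Type} [Ring A] [Algebra ℝ A]

/-- The elementary chain `s 0 ⊗ ⋯ ⊗ s n`. -/
noncomputable def chain (n : ℕ) (s : ℕ → A) : PiTensorProduct ℝ (fun _ : Fin (n + 1) => A) :=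
  PiTensorProduct.tprod ℝ (fun p : Fin (n + 1) => s p)

theorem chain_congr {n : ℕ} {s s' : ℕ → A} (h : ∀ p ≤ n, s p = s' p) :
    chain n s = chain n s' := by
  unfold chain
  congr 1
  funext p
  exact h p (Nat.lt_succ_iff.mp p.2)

theorem exists_linear_slot (n i : ℕ) (hi : i ≤ n) (S : A → ℕ → A) (hS : ∀ x, S x i = x)
    (hS' : ∀ x y p, p ≠ i → S x p = S y p) :
    ∃ L : A →ₗ[ℝ] PiTensorProduct ℝ (fun _ : Fin (n + 1) => A), ∀ x, L x = chain n (S x) := by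
  refine ⟨(PiTensorProduct.tprod ℝ).toLinearMap (fun p : Fin (n + 1) => S 0 p)
    ⟨i, Nat.lt_succ_of_le hi⟩, fun x => ?_⟩
  rw [MultilinearMap.toLinearMap_apply]
  unfold chain
  congr 1
  funext p
  by_cases hp : p = ⟨i, Nat.lt_succ_of_le hi⟩
  · subst hp
    simp [hS]
  · rw [Function.update_of_ne hp]
    exact hS' _ _ _ fun h => hp (Fin.ext h)

theorem exists_linear_insSeq (n k i : ℕ) (hi : i ≤ n) (a : ℕ → A) :
    ∃ L : A →ₗ[ℝ] PiTensorProduct ℝ (fun _ : Fin (n + 1) => A),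
      ∀ x, L x = chain n (insSeq k a i x) :=
  exists_linear_slot n i hi _ (by simp [insSeq]) (by
    intro x y p hp
    simp [insSeq, hp])

theorem exists_linear_headSeq (n m : ℕ) (a : ℕ → A) :
    ∃ L : A →ₗ[ℝ] PiTensorProduct ℝ (fun _ : Fin (n + 1) => A),
      ∀ x, L x = chain n (headSeq m a x) :=
  exists_linear_slot n 0 (Nat.zero_le n) _ (by simp [headSeq]) (by
    intro x y p hp
    simp [headSeq, hp])

theorem rApply_eq_sum_chain (k n : ℕ) (F : (ℕ → A) → A) (a : ℕ → A) :
    rApply k n F a =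
      (∑ i ∈ Finset.range (n + 1), ((-1 : ℝ) ^ (k * i)) • chain n (rIns k F a i)) +
      ∑ s ∈ Finset.range k,
        ((-1 : ℝ) ^ ((n + k) * (n + s + 1))) • chain n (rCyc k (n + k) F a (n + s)) := by
  rw [rApply, Finset.sum_Ico_eq_sum_range, Nat.add_sub_cancel_left]
  rfl

/-- `F` depends only on the first `k + 1` entries of its argument. -/
def IsLocal (k : ℕ) (F : (ℕ → A) → A) : Prop :=
  ∀ b b' : ℕ → A, (∀ t ≤ k, b t = b' t) → F b = F b'

theorem isLocal_evalC {k : ℕ} (Φ : MultilinearMap ℝ (fun _ : Fin (k + 1) => A) A) :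
    IsLocal k (evalC Φ) := by
  intro b b' h
  unfold evalC
  congr 1
  funext j
  exact h j (Nat.lt_succ_iff.mp j.2)

theorem gbrM_mulC {k : ℕ} {F : (ℕ → A) → A} (b : ℕ → A) :
    gbrM 2 (k + 1) (mulC A) F b =
      F b * b (k + 1) + ((-1 : ℝ) ^ k) • (b 0 * F fun t => b (1 + t)) +
      ∑ r ∈ Finset.range (k + 1), ((-1 : ℝ) ^ (k + 1 + r)) • F (rIns 1 (mulC A) b r) := by
  have h1 : ∀ i : ℕ, (-1 : ℝ) ^ ((i : ℤ) * (((k + 1 : ℕ) : ℤ) - 1)) = (-1 : ℝ) ^ (i * k) := by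
    intro i
    rw [← zpow_natCast]
    congr 1
    push_cast
    ring
  have h2 : ∀ i : ℕ, (-1 : ℝ) ^ ((i : ℤ) * (((2 : ℕ) : ℤ) - 1)) = (-1 : ℝ) ^ i := by
    intro i
    rw [← zpow_natCast]
    congr 1
    push_cast
    ring
  have h3 : (-1 : ℝ) ^ ((((2 : ℕ) : ℤ) - 1) * (((k + 1 : ℕ) : ℤ) - 1)) = (-1 : ℝ) ^ k := by
    rw [← zpow_natCast]
    congr 1
    push_cast
    ring
  simp only [gbrM, gcompM, h1, h2, h3, Finset.sum_range_succ _ 1, Finset.sum_range_one]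
  rw [sub_eq_add_neg, ← neg_smul, Finset.smul_sum]
  congr 1
  · simp [mulC, add_comm]
  · refine Finset.sum_congr rfl fun r _ => ?_
    rw [smul_smul]
    congr 1
    rw [pow_add, pow_add]
    ring

theorem neg_one_pow_smul_congr {M : Type} [AddCommGroup M] [Module ℝ M] {e f : ℕ} {x y : M}
    (he : Even (e + f)) (h : x = y) : ((-1 : ℝ) ^ e) • x = ((-1 : ℝ) ^ f) • y := by
  rw [h]
  congr 1
  rw [Nat.even_add] at he
  exact neg_one_pow_congr he

theorem neg_one_pow_smul_congr_neg {M : Type} [AddCommGroup M] [Module ℝ M] {k e f : ℕ}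
    {x y : M} (he : Even (e + (k + 1 + f))) (h : x = y) :
    ((-1 : ℝ) ^ e) • x = -(((-1 : ℝ) ^ k) • ((-1 : ℝ) ^ f) • y) := by
  rw [neg_one_pow_smul_congr he h, smul_smul, ← neg_smul]
  congr 1
  ring

theorem linear_gbrM_mulC {M : Type} [AddCommGroup M] [Module ℝ M] (L : A →ₗ[ℝ] M)
    {k : ℕ} {F : (ℕ → A) → A} (b : ℕ → A) (e : ℕ) :
    ((-1 : ℝ) ^ e) • L (gbrM 2 (k + 1) (mulC A) F b) =
      ((-1 : ℝ) ^ e) • L (F b * b (k + 1)) +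
      ((-1 : ℝ) ^ (e + k)) • L (b 0 * F fun t => b (1 + t)) +
      ∑ r ∈ Finset.range (k + 1),
        ((-1 : ℝ) ^ (e + (k + 1 + r))) • L (F (rIns 1 (mulC A) b r)) := by
  rw [gbrM_mulC]
  simp only [map_add, map_sum, map_smul, smul_add, Finset.smul_sum, smul_smul, ← pow_add]

theorem rApply_gbrM_mulC (k n : ℕ) (F : (ℕ → A) → A) (a : ℕ → A) :
    rApply (k + 1) n (gbrM 2 (k + 1) (mulC A) F) a =
      (∑ i ∈ Finset.range (n + 1), ((-1 : ℝ) ^ ((k + 1) * i)) •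
        chain n (insSeq (k + 1) a i ((F fun t => a (i + t)) * a (i + (k + 1))))) +
      (∑ i ∈ Finset.range (n + 1), ((-1 : ℝ) ^ ((k + 1) * i + k)) •
        chain n (insSeq (k + 1) a i (a (i + 0) * F fun t => a (i + (1 + t))))) +
      (∑ i ∈ Finset.range (n + 1), ∑ r ∈ Finset.range (k + 1),
        ((-1 : ℝ) ^ ((k + 1) * i + (k + 1 + r))) •
          chain n (insSeq (k + 1) a i (F (rIns 1 (mulC A) (fun t => a (i + t)) r)))) +
      ((∑ s ∈ Finset.range (k + 1), ((-1 : ℝ) ^ ((n + (k + 1)) * (n + s + 1))) •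
        chain n (headSeq s a (F (cycArg (n + (k + 1)) a (n + s)) *
          cycArg (n + (k + 1)) a (n + s) (k + 1)))) +
      (∑ s ∈ Finset.range (k + 1), ((-1 : ℝ) ^ ((n + (k + 1)) * (n + s + 1) + k)) •
        chain n (headSeq s a (cycArg (n + (k + 1)) a (n + s) 0 *
          F fun t => cycArg (n + (k + 1)) a (n + s) (1 + t)))) +
      ∑ s ∈ Finset.range (k + 1), ∑ r ∈ Finset.range (k + 1),
        ((-1 : ℝ) ^ ((n + (k + 1)) * (n + s + 1) + (k + 1 + r))) •
          chain n (headSeq s a (F (rIns 1 (mulC A) (cycArg (n + (k + 1)) a (n + s)) r)))) := by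
  rw [rApply_eq_sum_chain]
  simp only [← Finset.sum_add_distrib]
  congr 1
  · refine Finset.sum_congr rfl fun i hi => ?_
    obtain ⟨L, hL⟩ := exists_linear_insSeq n (k + 1) i
      (Nat.lt_succ_iff.mp (Finset.mem_range.mp hi)) a
    have h := linear_gbrM_mulC L (k := k) (F := F) (fun t => a (i + t)) ((k + 1) * i)
    simp only [hL] at h
    exact h
  · refine Finset.sum_congr rfl fun s _ => ?_
    obtain ⟨L, hL⟩ := exists_linear_headSeq n s a
    have h := linear_gbrM_mulC L (k := k) (F := F) (cycArg (n + (k + 1)) a (n + s))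
      ((n + (k + 1)) * (n + s + 1))
    simp only [hL] at h
    rw [rCyc_eq_headSeq]
    exact h

theorem rComp_eq_sum_chain (k₁ k₂ n : ℕ) (F G : (ℕ → A) → A) (a : ℕ → A) :
    rComp k₁ k₂ n F G a =
      (∑ i ∈ Finset.range (n + k₁ + 1), ∑ l ∈ Finset.range (n + 1),
        ((-1 : ℝ) ^ (k₂ * i + k₁ * l)) • chain n (rIns k₁ F (rIns k₂ G a i) l)) +
      (∑ i ∈ Finset.range (n + k₁ + 1), ∑ s ∈ Finset.range k₁,
        ((-1 : ℝ) ^ (k₂ * i + (n + k₁) * (n + s + 1))) •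
          chain n (headSeq s (rIns k₂ G a i) (F (cycArg (n + k₁) (rIns k₂ G a i) (n + s))))) +
      ((∑ u ∈ Finset.range k₂, ∑ l ∈ Finset.range (n + 1),
        ((-1 : ℝ) ^ ((n + k₁ + k₂) * (n + k₁ + u + 1) + k₁ * l)) •
          chain n (rIns k₁ F
            (headSeq u a (G (cycArg (n + k₁ + k₂) a (n + k₁ + u)))) l)) +
      ∑ u ∈ Finset.range k₂, ∑ s ∈ Finset.range k₁,
        ((-1 : ℝ) ^ ((n + k₁ + k₂) * (n + k₁ + u + 1) + (n + k₁) * (n + s + 1))) •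
          chain n (headSeq s (headSeq u a (G (cycArg (n + k₁ + k₂) a (n + k₁ + u))))
            (F (cycArg (n + k₁) (headSeq u a (G (cycArg (n + k₁ + k₂) a (n + k₁ + u))))
              (n + s))))) := by
  rw [rComp, Finset.sum_Ico_eq_sum_range, Nat.add_sub_cancel_left]
  simp only [rApply_eq_sum_chain, smul_add, Finset.smul_sum, smul_smul, ← pow_add,
    Finset.sum_add_distrib, rCyc_eq_headSeq]

end Chains

section Matching

variable {A : Type} [Ring A] [Algebra ℝ A] {k n : ℕ} {F : (ℕ → A) → A} (a : ℕ → A)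

theorem chain_ins_mul_right (i : ℕ) :
    chain n (insSeq (k + 1) a i ((F fun t => a (i + t)) * a (i + (k + 1)))) =
      chain n (rIns 1 (mulC A) (rIns k F a i) i) := by
  refine chain_congr fun p hp => ?_
  grind [rIns, insSeq, mulC]

theorem chain_ins_mul_left (i : ℕ) :
    chain n (insSeq (k + 1) a i (a (i + 0) * F fun t => a (i + (1 + t)))) =
      chain n (rIns 1 (mulC A) (rIns k F a (i + 1)) i) := by
  refine chain_congr fun p hp => ?_
  simp only [← Nat.add_assoc]
  grind [rIns, insSeq, mulC]

theorem chain_ins_inner (hF : IsLocal k F) (i r : ℕ) (hr : r ≤ k) :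
    chain n (insSeq (k + 1) a i (F (rIns 1 (mulC A) (fun t => a (i + t)) r))) =
      chain n (rIns k F (rIns 1 (mulC A) a (i + r)) i) := by
  have h : F (rIns 1 (mulC A) (fun t => a (i + t)) r) =
      F fun t => rIns 1 (mulC A) a (i + r) (i + t) :=
    hF _ _ fun t ht => by grind [rIns, mulC]
  refine chain_congr fun p hp => ?_
  grind [rIns, insSeq, mulC]

theorem chain_head_mul_right_zero (hF : IsLocal k F) :
    chain n (headSeq 0 a (F (cycArg (n + (k + 1)) a (n + 0)) *
        cycArg (n + (k + 1)) a (n + 0) (k + 1))) =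
      chain n (headSeq 0 (rIns k F a (n + 1))
        (mulC A (cycArg (n + 1) (rIns k F a (n + 1)) (n + 0)))) := by
  have h : F (cycArg (n + (k + 1)) a (n + 0)) = F fun t => a (n + 1 + t) :=
    hF _ _ fun t ht => by grind [cycArg]
  refine chain_congr fun p hp => ?_
  grind [rIns, headSeq, cycArg, mulC]

theorem chain_head_mul_right_succ (s : ℕ) :
    chain n (headSeq (s + 1) a (F (cycArg (n + (k + 1)) a (n + (s + 1))) *
        cycArg (n + (k + 1)) a (n + (s + 1)) (k + 1))) =
      chain n (rIns 1 (mulC A) (headSeq s a (F (cycArg (n + 1 + k) a (n + 1 + s)))) 0) := by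
  have h : cycArg (n + (k + 1)) a (n + (s + 1)) = cycArg (n + 1 + k) a (n + 1 + s) := by
    congr 1 <;> omega
  refine chain_congr fun p hp => ?_
  rw [h]
  grind [rIns, headSeq, cycArg, mulC]

theorem chain_head_mul_left_last (hF : IsLocal k F) :
    chain n (headSeq k a (cycArg (n + (k + 1)) a (n + k) 0 *
        F fun t => cycArg (n + (k + 1)) a (n + k) (1 + t))) =
      chain n (headSeq 0 (rIns k F a 0)
        (mulC A (cycArg (n + 1) (rIns k F a 0) (n + 0)))) := by
  have h : (F fun t => cycArg (n + (k + 1)) a (n + k) (1 + t)) = F fun t => a (0 + t) :=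
    hF _ _ fun t ht => by grind [cycArg]
  refine chain_congr fun p hp => ?_
  grind [rIns, headSeq, cycArg, mulC]

theorem chain_head_mul_left (hF : IsLocal k F) (s : ℕ) (hs : s < k) :
    chain n (headSeq s a (cycArg (n + (k + 1)) a (n + s) 0 *
        F fun t => cycArg (n + (k + 1)) a (n + s) (1 + t))) =
      chain n (headSeq 0 (headSeq s a (F (cycArg (n + 1 + k) a (n + 1 + s))))
        (mulC A (cycArg (n + 1) (headSeq s a (F (cycArg (n + 1 + k) a (n + 1 + s))))
          (n + 0)))) := by
  have h : (F fun t => cycArg (n + (k + 1)) a (n + s) (1 + t)) =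
      F (cycArg (n + 1 + k) a (n + 1 + s)) :=
    hF _ _ fun t ht => by grind [cycArg]
  refine chain_congr fun p hp => ?_
  rw [h]
  grind [headSeq, cycArg, mulC]

theorem chain_head_inner_before (hF : IsLocal k F) (s r : ℕ) (hr : r < k - s) :
    chain n (headSeq s a (F (rIns 1 (mulC A) (cycArg (n + (k + 1)) a (n + s)) r))) =
      chain n (headSeq s (rIns 1 (mulC A) a (n + s + 1 + r))
        (F (cycArg (n + k) (rIns 1 (mulC A) a (n + s + 1 + r)) (n + s)))) := by
  have h : F (rIns 1 (mulC A) (cycArg (n + (k + 1)) a (n + s)) r) =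
      F (cycArg (n + k) (rIns 1 (mulC A) a (n + s + 1 + r)) (n + s)) :=
    hF _ _ fun t ht => by grind [rIns, cycArg, mulC]
  refine chain_congr fun p hp => ?_
  rw [h]
  grind [rIns, headSeq]

theorem chain_head_inner_wrap (hF : IsLocal k F) (s : ℕ) (hs : s < k) :
    chain n (headSeq s a (F (rIns 1 (mulC A) (cycArg (n + (k + 1)) a (n + s)) (k - s)))) =
      chain n (headSeq s (headSeq 0 a (mulC A (cycArg (n + k + 1) a (n + k + 0))))
        (F (cycArg (n + k) (headSeq 0 a (mulC A (cycArg (n + k + 1) a (n + k + 0))))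
          (n + s)))) := by
  have h : F (rIns 1 (mulC A) (cycArg (n + (k + 1)) a (n + s)) (k - s)) =
      F (cycArg (n + k) (headSeq 0 a (mulC A (cycArg (n + k + 1) a (n + k + 0)))) (n + s)) :=
    hF _ _ fun t ht => by grind [rIns, cycArg, headSeq, mulC]
  refine chain_congr fun p hp => ?_
  rw [h]
  grind [headSeq]

theorem chain_head_inner_wrap_last (hF : IsLocal k F) :
    chain n (headSeq k a (F (rIns 1 (mulC A) (cycArg (n + (k + 1)) a (n + k)) (k - k)))) =
      chain n (rIns k F (headSeq 0 a (mulC A (cycArg (n + k + 1) a (n + k + 0)))) 0) := by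
  have h : F (rIns 1 (mulC A) (cycArg (n + (k + 1)) a (n + k)) (k - k)) =
      F fun t => headSeq 0 a (mulC A (cycArg (n + k + 1) a (n + k + 0))) (0 + t) :=
    hF _ _ fun t ht => by grind [rIns, cycArg, headSeq, mulC]
  refine chain_congr fun p hp => ?_
  rw [h]
  grind [rIns, headSeq]

theorem chain_head_inner_after (hF : IsLocal k F) (s l : ℕ) (hs : s < k) (hl : l ≤ s) :
    chain n (headSeq (s + 1) a
        (F (rIns 1 (mulC A) (cycArg (n + (k + 1)) a (n + (s + 1))) (k - s + l)))) =
      chain n (headSeq s (rIns 1 (mulC A) a l)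
        (F (cycArg (n + k) (rIns 1 (mulC A) a l) (n + s)))) := by
  have h : F (rIns 1 (mulC A) (cycArg (n + (k + 1)) a (n + (s + 1))) (k - s + l)) =
      F (cycArg (n + k) (rIns 1 (mulC A) a l) (n + s)) :=
    hF _ _ fun t ht => by grind [rIns, cycArg, mulC]
  refine chain_congr fun p hp => ?_
  rw [h]
  grind [rIns, headSeq]

theorem chain_ins_ins_left (hF : IsLocal k F) (m l : ℕ) (hl : l < m) :
    chain n (rIns 1 (mulC A) (rIns k F a (m + 1)) l) =
      chain n (rIns k F (rIns 1 (mulC A) a l) m) := by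
  have h : (F fun t => a (m + 1 + t)) = F fun t => rIns 1 (mulC A) a l (m + t) :=
    hF _ _ fun t ht => by grind [rIns]
  refine chain_congr fun p hp => ?_
  grind [rIns, mulC]

theorem chain_ins_ins_right (hF : IsLocal k F) (m l : ℕ) (hl : l < m) :
    chain n (rIns 1 (mulC A) (rIns k F a l) m) =
      chain n (rIns k F (rIns 1 (mulC A) a (m + k)) l) := by
  have h : (F fun t => a (l + t)) = F fun t => rIns 1 (mulC A) a (m + k) (l + t) :=
    hF _ _ fun t ht => by grind [rIns]
  refine chain_congr fun p hp => ?_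
  grind [rIns, mulC]

theorem chain_wrap_ins (hF : IsLocal k F) (m : ℕ) (hm : m < n) :
    chain n (headSeq 0 (rIns k F a (m + 1))
        (mulC A (cycArg (n + 1) (rIns k F a (m + 1)) (n + 0)))) =
      chain n (rIns k F (headSeq 0 a (mulC A (cycArg (n + k + 1) a (n + k + 0)))) (m + 1)) := by
  have h : (F fun t => a (m + 1 + t)) =
      F fun t => headSeq 0 a (mulC A (cycArg (n + k + 1) a (n + k + 0))) (m + 1 + t) :=
    hF _ _ fun t ht => by grind [headSeq]
  refine chain_congr fun p hp => ?_
  grind [rIns, headSeq, cycArg, mulC]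

theorem chain_head_ins (hF : IsLocal k F) (s m : ℕ) (hm : m < n) :
    chain n (rIns 1 (mulC A) (headSeq s a (F (cycArg (n + 1 + k) a (n + 1 + s)))) (m + 1)) =
      chain n (headSeq s (rIns 1 (mulC A) a (s + 1 + m))
        (F (cycArg (n + k) (rIns 1 (mulC A) a (s + 1 + m)) (n + s)))) := by
  have h : F (cycArg (n + 1 + k) a (n + 1 + s)) =
      F (cycArg (n + k) (rIns 1 (mulC A) a (s + 1 + m)) (n + s)) :=
    hF _ _ fun t ht => by grind [rIns, cycArg]
  refine chain_congr fun p hp => ?_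
  rw [h]
  grind [rIns, headSeq, mulC]

end Matching

section Assembly

variable {A : Type} [Ring A] [Algebra ℝ A]

theorem eq_sub_smul_of_matching {M : Type} [AddCommGroup M] [Module ℝ M] (c : ℝ)
    {L₁ L₂ L₃ X₁ X₀ Y₁ Y₀ Z₁ Z₂ Z₀ Z₃ B₁ B₂ D₁ D₂ P P' P₁ P₀ P₂ Q Q₁ Q₀ R
      C₁ E₁ E₂ C₂ E₃ C₃ S S₁ S₀ T : M}
    (hP : P = P' + P₂) (hP' : P' = P₁ + P₀) (hQ : Q = Q₁ + Q₀) (hS : S = S₁ + S₀)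
    (hL₁ : L₁ = B₁) (hL₂ : L₂ = B₂) (hX₁ : X₁ = Q₀) (hX₀ : X₀ = P₂)
    (hY₁ : Y₁ = R) (hY₀ : Y₀ = P₀)
    (hL₃ : L₃ = -(c • C₁)) (hZ₁ : Z₁ = -(c • C₃)) (hZ₂ : Z₂ = -(c • T))
    (hZ₀ : Z₀ = -(c • S₀)) (hZ₃ : Z₃ = -(c • C₂))
    (hD₁ : D₁ = c • E₁) (hD₂ : D₂ = c • E₂) (hP₁ : P₁ = c • S₁) (hQ₁ : Q₁ = c • E₃) :
    L₁ + L₂ + L₃ + (X₁ + X₀ + (Y₁ + Y₀) + (Z₁ + (Z₂ + Z₀) + Z₃)) =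
      B₁ + B₂ + D₁ + D₂ + P + (Q + R) -
        c • (C₁ + E₁ + E₂ + (C₂ + E₃ + C₃) + (S + T)) := by
  subst hP hP' hQ hS hL₁ hL₂ hX₁ hX₀ hY₁ hY₀ hL₃ hZ₁ hZ₂ hZ₀ hZ₃ hD₁ hD₂ hP₁ hQ₁
  module

theorem rApply_gbrM_mulC_eq (k n : ℕ) {F : (ℕ → A) → A} (hF : IsLocal k F) (a : ℕ → A) :
    rApply (k + 1) n (gbrM 2 (k + 1) (mulC A) F) a =
      rComp 1 k n (mulC A) F a - ((-1 : ℝ) ^ k) • rComp k 1 n F (mulC A) a := by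
  rw [rApply_gbrM_mulC, rComp_eq_sum_chain, rComp_eq_sum_chain]
  simp only [Finset.sum_range_one]
  rw [sum_range_add_two_range_add_one, sum_range_add_range_add_one,
    Finset.sum_comm (s := Finset.range (n + k + 1)) (t := Finset.range k),
    Finset.sum_congr rfl fun s hs => sum_range_window n k s (Finset.mem_range.mp hs) _,
    sum_range_antidiagonal_split, Finset.sum_range_succ' _ k, Finset.sum_range_succ _ k,
    Finset.sum_range_succ _ k]
  simp only [Finset.sum_add_distrib]
  refine eq_sub_smul_of_matching ((-1 : ℝ) ^ k) (Finset.sum_range_succ _ _)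
    (Finset.sum_range_succ' _ _)
    ((Finset.sum_congr rfl fun _ _ => Finset.sum_range_succ' _ _).trans Finset.sum_add_distrib)
    (Finset.sum_range_succ' _ _) ?_ ?_ ?_ ?_ ?_ ?_ ?_ ?_ ?_ ?_ ?_ ?_ ?_ ?_ ?_ <;>
    try simp only [Finset.smul_sum, ← Finset.sum_neg_distrib]
  · refine Finset.sum_congr rfl fun i _ =>
      neg_one_pow_smul_congr ?_ (chain_ins_mul_right a i)
    grind [Nat.not_even_one]
  · refine Finset.sum_congr rfl fun i _ =>
      neg_one_pow_smul_congr ?_ (chain_ins_mul_left a i)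
    grind [Nat.not_even_one]
  · refine Finset.sum_congr rfl fun s _ =>
      neg_one_pow_smul_congr ?_ (chain_head_mul_right_succ a s)
    grind [Nat.not_even_one]
  · refine neg_one_pow_smul_congr ?_ (chain_head_mul_right_zero a hF)
    grind [Nat.not_even_one]
  · refine Finset.sum_congr rfl fun s hs =>
      neg_one_pow_smul_congr ?_ (chain_head_mul_left a hF s (Finset.mem_range.mp hs))
    grind [Nat.not_even_one]
  · refine neg_one_pow_smul_congr ?_ (chain_head_mul_left_last a hF)
    grind [Nat.not_even_one]
  · refine Finset.sum_congr rfl fun i _ => Finset.sum_congr rfl fun r hr =>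
      neg_one_pow_smul_congr_neg ?_
        (chain_ins_inner a hF i r (Nat.lt_succ_iff.mp (Finset.mem_range.mp hr)))
    grind [Nat.not_even_one]
  · refine Finset.sum_congr rfl fun s _ => Finset.sum_congr rfl fun r hr =>
      neg_one_pow_smul_congr_neg ?_
        (chain_head_inner_before a hF s r (Finset.mem_range.mp hr))
    grind [Nat.not_even_one]
  · refine Finset.sum_congr rfl fun s hs => neg_one_pow_smul_congr_neg ?_
        (chain_head_inner_wrap a hF s (Finset.mem_range.mp hs))
    obtain ⟨d, rfl⟩ := Nat.exists_eq_add_of_le (Finset.mem_range.mp hs).le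
    rw [Nat.add_sub_cancel_left]
    grind [Nat.not_even_one]
  · refine neg_one_pow_smul_congr_neg ?_ (chain_head_inner_wrap_last a hF)
    rw [Nat.sub_self]
    grind [Nat.not_even_one]
  · refine Finset.sum_congr rfl fun s hs => Finset.sum_congr rfl fun l hl =>
      neg_one_pow_smul_congr_neg ?_
        (chain_head_inner_after a hF s l (Finset.mem_range.mp hs)
          (Nat.lt_succ_iff.mp (Finset.mem_range.mp hl)))
    obtain ⟨d, rfl⟩ := Nat.exists_eq_add_of_le (Finset.mem_range.mp hs).le
    rw [Nat.add_sub_cancel_left]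
    grind [Nat.not_even_one]
  · refine Finset.sum_congr rfl fun m _ => Finset.sum_congr rfl fun l hl => ?_
    rw [smul_smul, ← pow_add]
    refine neg_one_pow_smul_congr ?_ (chain_ins_ins_left a hF m l (Finset.mem_range.mp hl))
    grind [Nat.not_even_one]
  · refine Finset.sum_congr rfl fun m _ => Finset.sum_congr rfl fun l hl => ?_
    rw [smul_smul, ← pow_add]
    refine neg_one_pow_smul_congr ?_ (chain_ins_ins_right a hF m l (Finset.mem_range.mp hl))
    grind [Nat.not_even_one]
  · refine Finset.sum_congr rfl fun m hm => ?_
    rw [smul_smul, ← pow_add]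
    refine neg_one_pow_smul_congr ?_ (chain_wrap_ins a hF m (Finset.mem_range.mp hm))
    grind [Nat.not_even_one]
  · refine Finset.sum_congr rfl fun s _ => Finset.sum_congr rfl fun m hm => ?_
    rw [smul_smul, ← pow_add]
    refine neg_one_pow_smul_congr ?_ (chain_head_ins a hF s m (Finset.mem_range.mp hm))
    grind [Nat.not_even_one]

end Assembly

/-- Let `A` be a unital associative algebra over `ℝ` with multiplication
`μ ∈ C^1(A)`, let `∂Φ := [μ, Φ]_G` be the Hochschild coboundary and `b := R_μ` the
Hochschild boundary.  Then for every `Φ ∈ C^k(A)`: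
`R_{∂Φ} = b ∘ R_Φ - (-1)^k R_Φ ∘ b` as operators on Hochschild chains.
In particular, `(C_•(A), b)` is a differential graded module over the differential graded
Lie algebra `(C^•(A), ∂, [·,·]_G)`.  (The operator identity is stated on every elementary
chain `a 0 ⊗ ⋯ ⊗ a (n + k + 1)`, with the compositions expanded by linearity; elementary
chains span the chain spaces.) -/
theorem r_of_coboundary_eq_graded_commutator_with_b
    (A : Type) [Ring A] [Algebra ℝ A] (k n : ℕ)
    (Φ : MultilinearMap ℝ (fun _ : Fin (k + 1) => A) A) (a : ℕ → A) :
    rApply (k + 1) n (gbrM 2 (k + 1) (mulC A) (evalC Φ)) a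
      = rComp 1 k n (mulC A) (evalC Φ) a
        - ((-1 : ℝ) ^ k) • rComp k 1 n (evalC Φ) (mulC A) a := by
  exact rApply_gbrM_mulC_eq k n (isLocal_evalC Φ) a
end

section
/- (Hochschild–Kostant–Rosenberg/Teleman, algebraic case.) Let A = ℝ[x₁,…,x_d] be the real polynomial algebra in d variables. For every k ≥ 0, the Connes map 𝔠_k induces an isomorphism of ℝ-vector spaces from the k-th Hochschild homology H_k(C_•, b) onto the module Ω^k of Kähler differential k-forms of A. -/
open scoped BigOperators

set_option synthInstance.maxHeartbeats 1000000
set_option maxHeartbeats 1000000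

/-! We model the Hochschild chain module `C_n = A^{⊗(n+1)}` of the polynomial algebra
`A = ℝ[x₁,…,x_d]` by the polynomial ring `ℝ[x_{j,v} : 0 ≤ j ≤ n, 1 ≤ v ≤ d]`, via the
canonical isomorphism `A^{⊗(n+1)} ≅ MvPolynomial (Fin (n+1) × Fin d) ℝ` sending
`a₀ ⊗ ⋯ ⊗ a_n` to `∏_j a_j(x_{j,·})`.  Under this isomorphism each term of the
Hochschild boundary is induced by a substitution of variables. -/

/-- The chain module `C_n(ℝ[x₁,…,x_d]) = A^{⊗(n+1)}`. -/
abbrev HChain (d n : ℕ) := MvPolynomial (Fin (n + 1) × Fin d) ℝ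

/-- The index map collapsing the tensor slots `i` and `i+1` (used for the term
`a₀ ⊗ ⋯ ⊗ a_i a_{i+1} ⊗ ⋯ ⊗ a_{n+1}` of the Hochschild boundary). -/
def mergeIdx {n : ℕ} (i : Fin (n + 1)) (j : Fin (n + 2)) : Fin (n + 1) :=
  if h : (j : ℕ) ≤ (i : ℕ) then ⟨(j : ℕ), by omega⟩ else ⟨(j : ℕ) - 1, by omega⟩

/-- The index map collapsing the last tensor slot onto the slot `0` (used for the cyclic
term `a_{n+1} a₀ ⊗ a₁ ⊗ ⋯ ⊗ a_n` of the Hochschild boundary). -/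
def cycIdx {n : ℕ} (j : Fin (n + 2)) : Fin (n + 1) :=
  if h : (j : ℕ) = n + 1 then ⟨0, by omega⟩ else ⟨(j : ℕ), by omega⟩

/-- The Hochschild boundary `b : C_{n+1} → C_n`,
`b(a₀ ⊗ ⋯ ⊗ a_{n+1}) = ∑_{i=0}^{n} (-1)^i a₀ ⊗ ⋯ ⊗ a_i a_{i+1} ⊗ ⋯ ⊗ a_{n+1}
 + (-1)^{n+1} a_{n+1} a₀ ⊗ a₁ ⊗ ⋯ ⊗ a_n`, written in the polynomial model via
variable substitutions. -/
noncomputable def hBoundary (d n : ℕ) : HChain d (n + 1) →ₗ[ℝ] HChain d n :=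
  (∑ i : Fin (n + 1),
      ((-1 : ℝ) ^ (i : ℕ)) •
        (MvPolynomial.rename
            (fun p : Fin (n + 2) × Fin d => (mergeIdx i p.1, p.2))).toLinearMap) +
    ((-1 : ℝ) ^ (n + 1)) •
      (MvPolynomial.rename
          (fun p : Fin (n + 2) × Fin d => (cycIdx p.1, p.2))).toLinearMap

/-- The Hochschild boundary out of `C_k` (the zero map for `k = 0`). -/
noncomputable def hBoundaryDown (d : ℕ) : (k : ℕ) → HChain d k →ₗ[ℝ] HChain d (k - 1)
  | 0 => 0
  | (n + 1) => hBoundary d n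

/-- The `j`-th tensor factor of the elementary chain corresponding to the monomial `α`. -/
noncomputable def chainSlot (d k : ℕ) (j : Fin (k + 1)) (α : Fin (k + 1) × Fin d →₀ ℕ) :
    MvPolynomial (Fin d) ℝ :=
  MvPolynomial.monomial
    (Finsupp.comapDomain (fun v : Fin d => (j, v)) α
      (Function.Injective.injOn (fun _ _ h => congrArg Prod.snd h))) 1

/-- A decomposable element of the `m`-th exterior power `Λ^m_R M ⊆ Λ M`. -/
def wedgeDec (R M : Type) [CommRing R] [AddCommGroup M] [Module R M] (m : ℕ)
    (u : Fin m → M) : (⋀[R]^m M : Submodule R (ExteriorAlgebra R M)) :=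
  ⟨ExteriorAlgebra.ιMulti R m u,
    ExteriorAlgebra.ιMulti_range R m (Set.mem_range_self u)⟩

/-- The Connes map `𝔠_k : C_k → Ω^k`, `𝔠_k(a₀ ⊗ ⋯ ⊗ a_k) = a₀ da₁ ∧ ⋯ ∧ da_k`, written in
the polynomial model (defined monomial by monomial; it is `ℝ`-linear by construction). -/
noncomputable def connesPoly (d k : ℕ) (p : HChain d k) :
    (⋀[MvPolynomial (Fin d) ℝ]^k (KaehlerDifferential ℝ (MvPolynomial (Fin d) ℝ)) :
      Submodule (MvPolynomial (Fin d) ℝ) _) :=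
  ∑ α ∈ p.support,
    (MvPolynomial.C (MvPolynomial.coeff α p) * chainSlot d k 0 α) •
      wedgeDec (MvPolynomial (Fin d) ℝ) (KaehlerDifferential ℝ (MvPolynomial (Fin d) ℝ)) k
          (fun t : Fin k =>
            KaehlerDifferential.D ℝ (MvPolynomial (Fin d) ℝ) (chainSlot d k t.succ α))

open MvPolynomial

namespace HochschildPoly

/-- The algebra map between chain modules induced by a map of tensor slots. -/
noncomputable def slotMap (d : ℕ) {m n : ℕ} (φ : Fin (m + 1) → Fin (n + 1)) :
    HChain d m →ₐ[ℝ] HChain d n :=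
  rename fun p : Fin (m + 1) × Fin d => (φ p.1, p.2)

lemma slotMap_X (d : ℕ) {m n : ℕ} (φ : Fin (m + 1) → Fin (n + 1)) (i : Fin (m + 1))
    (v : Fin d) : slotMap d φ (X (i, v)) = X (φ i, v) :=
  rename_X _ _

lemma slotMap_slotMap (d : ℕ) {l m n : ℕ} (φ : Fin (m + 1) → Fin (n + 1))
    (ψ : Fin (l + 1) → Fin (m + 1)) (f : HChain d l) :
    slotMap d φ (slotMap d ψ f) = slotMap d (φ ∘ ψ) f :=
  rename_rename _ _ f

lemma slotMap_eq_self (d : ℕ) {n : ℕ} {φ : Fin (n + 1) → Fin (n + 1)} (hφ : ∀ j, φ j = j)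
    (f : HChain d n) : slotMap d φ f = f := by
  obtain rfl : φ = id := funext hφ
  exact rename_id_apply f

lemma val_mergeIdx {n : ℕ} (i : Fin (n + 1)) (j : Fin (n + 2)) :
    (mergeIdx i j : ℕ) = if (j : ℕ) ≤ i then (j : ℕ) else j - 1 := by
  unfold mergeIdx
  split_ifs <;> rfl

lemma val_cycIdx {n : ℕ} (j : Fin (n + 2)) :
    (cycIdx j : ℕ) = if (j : ℕ) = n + 1 then 0 else (j : ℕ) := by
  unfold cycIdx
  split_ifs <;> rfl

lemma val_succAbove {n : ℕ} (i : Fin (n + 1)) (j : Fin n) :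
    (i.succAbove j : ℕ) = if (j : ℕ) < i then (j : ℕ) else j + 1 := by
  simp only [Fin.succAbove, Fin.lt_def, Fin.val_castSucc]
  split_ifs <;> simp

lemma val_predAbove {n : ℕ} (j : Fin n) (i : Fin (n + 1)) :
    (j.predAbove i : ℕ) = if (j : ℕ) < i then (i : ℕ) - 1 else i := by
  simp only [Fin.predAbove, Fin.lt_def, Fin.val_castSucc]
  split_ifs <;> simp

/-- The boundary of the (augmented) bar complex. -/
noncomputable def barBoundary (d m : ℕ) : HChain d (m + 1) →ₗ[ℝ] HChain d m :=
  ∑ i : Fin (m + 1), ((-1 : ℝ) ^ (i : ℕ)) • (slotMap d (mergeIdx i)).toLinearMap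

lemma barBoundary_apply (d m : ℕ) (f : HChain d (m + 1)) :
    barBoundary d m f = ∑ i : Fin (m + 1), ((-1 : ℝ) ^ (i : ℕ)) • slotMap d (mergeIdx i) f := by
  simp [barBoundary]

lemma hBoundary_apply (d n : ℕ) (f : HChain d (n + 1)) :
    hBoundary d n f = barBoundary d n f + ((-1 : ℝ) ^ (n + 1)) • slotMap d cycIdx f :=
  rfl

/-- Insertion of the variable `v` as a new interior tensor factor, with alternating signs. -/
noncomputable def insertVar {d : ℕ} (v : Fin d) (m : ℕ) : HChain d m →ₗ[ℝ] HChain d (m + 1) :=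
  ∑ i : Fin m, ((-1 : ℝ) ^ (i : ℕ)) •
    (LinearMap.mulLeft ℝ (X (i.succ.castSucc, v))).comp
      (slotMap d i.succ.castSucc.succAbove).toLinearMap

lemma insertVar_apply {d : ℕ} (v : Fin d) (m : ℕ) (f : HChain d m) :
    insertVar v m f = ∑ i : Fin m, ((-1 : ℝ) ^ (i : ℕ)) •
      (X (i.succ.castSucc, v) * slotMap d i.succ.castSucc.succAbove f) := by
  simp [insertVar]

/-- The equivalence on pairs `(i, j)` that exchanges the order of two holes. -/
def swapHoles (n : ℕ) : Fin (n + 1) × Fin n ≃ Fin (n + 1) × Fin n where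
  toFun p := (p.1.succAbove p.2, p.2.predAbove p.1)
  invFun p := (p.1.succAbove p.2, p.2.predAbove p.1)
  left_inv _ := Prod.ext (Fin.succAbove_succAbove_predAbove _ _)
    (Fin.predAbove_predAbove_succAbove _ _)
  right_inv _ := Prod.ext (Fin.succAbove_succAbove_predAbove _ _)
    (Fin.predAbove_predAbove_succAbove _ _)

lemma mergeIdx_comp_mergeIdx {n : ℕ} (i : Fin (n + 2)) (j : Fin (n + 1)) :
    mergeIdx (j.predAbove i) ∘ mergeIdx (i.succAbove j) = mergeIdx j ∘ mergeIdx i := by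
  funext k
  ext
  simp only [Function.comp_apply, val_mergeIdx, val_succAbove, val_predAbove]
  have := k.isLt
  have := i.isLt
  have := j.isLt
  split_ifs <;> omega

lemma barBoundary_barBoundary (d m : ℕ) (f : HChain d (m + 2)) :
    barBoundary d m (barBoundary d (m + 1) f) = 0 := by
  have key : barBoundary d m (barBoundary d (m + 1) f) =
      ∑ p : Fin (m + 2) × Fin (m + 1), ((-1 : ℝ) ^ ((p.1 : ℕ) + (p.2 : ℕ))) •
        slotMap d (mergeIdx p.2 ∘ mergeIdx p.1) f := by
    rw [barBoundary_apply d (m + 1), map_sum, Fintype.sum_prod_type]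
    refine Finset.sum_congr rfl fun i _ => ?_
    rw [map_smul, barBoundary_apply, Finset.smul_sum]
    refine Finset.sum_congr rfl fun j _ => ?_
    rw [smul_smul, ← pow_add, slotMap_slotMap]
  have hneg : barBoundary d m (barBoundary d (m + 1) f) =
      -barBoundary d m (barBoundary d (m + 1) f) := by
    conv_lhs => rw [key, ← (swapHoles (m + 1)).sum_comp]
    rw [key, ← Finset.sum_neg_distrib]
    refine Finset.sum_congr rfl fun p _ => ?_
    simp only [swapHoles, Equiv.coe_fn_mk]
    rw [Fin.neg_one_pow_succAbove_add_predAbove, mergeIdx_comp_mergeIdx, neg_smul]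
  exact self_eq_neg.mp hneg

/-- Multiplication by a variable of the first slot minus the same variable of the last slot is
null-homotopic on the bar complex. -/
lemma barBoundary_insertVar {d : ℕ} (v : Fin d) (m : ℕ) (f : HChain d (m + 1)) :
    barBoundary d (m + 1) (insertVar v (m + 1) f) + insertVar v m (barBoundary d m f) =
      (X (0, v) - X (Fin.last (m + 1), v)) * f := by
  have hL : barBoundary d (m + 1) (insertVar v (m + 1) f) =
      ∑ i : Fin (m + 1), ((X (i.castSucc, v) - X (i.succ, v)) * f +
        ∑ k : Fin m, -((-1 : ℝ) ^ (((i.succAbove k : Fin (m + 1)) : ℕ) +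
          ((k.predAbove i : Fin m) : ℕ))) •
          (X ((k.predAbove i).succ.castSucc, v) *
            slotMap d ((k.predAbove i).succ.castSucc.succAbove ∘ mergeIdx (i.succAbove k)) f)) := by
    rw [insertVar_apply, map_sum]
    refine Finset.sum_congr rfl fun i _ => ?_
    rw [map_smul, barBoundary_apply, Fin.sum_univ_succAbove _ i.castSucc,
      Fin.sum_univ_succAbove _ i, ← add_assoc, smul_add, sub_mul]
    congr 1
    · rw [smul_add, smul_smul, smul_smul, ← pow_add, ← pow_add, Fin.succAbove_castSucc_self]
      simp only [map_mul, slotMap_X, slotMap_slotMap]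
      rw [slotMap_eq_self, slotMap_eq_self]
      · have h1 : (mergeIdx i.castSucc i.succ.castSucc : Fin (m + 2)) = i.castSucc := by
          ext; simp [val_mergeIdx]
        have h2 : (mergeIdx i.succ i.succ.castSucc : Fin (m + 2)) = i.succ := by
          ext; simp [val_mergeIdx]
        rw [h1, h2, Fin.val_castSucc, Fin.val_succ, ← two_mul, ← add_assoc, ← two_mul,
          pow_succ, pow_mul]
        simp [sub_eq_add_neg]
      · intro k
        ext
        simp only [Function.comp_apply, val_mergeIdx, val_succAbove, Fin.val_castSucc,
          Fin.val_succ]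
        split_ifs <;> omega
      · intro k
        ext
        simp only [Function.comp_apply, val_mergeIdx, val_succAbove, Fin.val_castSucc,
          Fin.val_succ]
        split_ifs <;> omega
    · rw [Finset.smul_sum]
      refine Finset.sum_congr rfl fun k _ => ?_
      rw [smul_smul, Fin.neg_one_pow_succAbove_add_predAbove, neg_neg, map_mul, slotMap_X,
        slotMap_slotMap]
      have hi := i.isLt
      have hk := k.isLt
      congr 1
      · rw [pow_add]
        congr 1
        simp only [val_succAbove, Fin.val_castSucc]
        split_ifs <;> first | rfl | omega | (rw [pow_add, pow_add]; norm_num)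
      · congr 3
        · ext
          simp only [val_mergeIdx, val_succAbove, val_predAbove, Fin.val_castSucc, Fin.val_succ]
          split_ifs <;> omega
        · funext l
          ext
          simp only [Function.comp_apply, val_mergeIdx, val_succAbove, val_predAbove,
            Fin.val_castSucc, Fin.val_succ]
          split_ifs <;> omega
  have hR : insertVar v m (barBoundary d m f) =
      ∑ i : Fin (m + 1), ∑ k : Fin m, ((-1 : ℝ) ^ (((i.succAbove k : Fin (m + 1)) : ℕ) +
          ((k.predAbove i : Fin m) : ℕ))) •
          (X ((k.predAbove i).succ.castSucc, v) *
            slotMap d ((k.predAbove i).succ.castSucc.succAbove ∘ mergeIdx (i.succAbove k)) f) := by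
    rw [← Fintype.sum_prod_type (f := fun p : Fin (m + 1) × Fin m =>
      ((-1 : ℝ) ^ (((p.1.succAbove p.2 : Fin (m + 1)) : ℕ) + ((p.2.predAbove p.1 : Fin m) : ℕ))) •
          (X ((p.2.predAbove p.1).succ.castSucc, v) *
            slotMap d ((p.2.predAbove p.1).succ.castSucc.succAbove ∘
              mergeIdx (p.1.succAbove p.2)) f))]
    refine Eq.trans ?_ ((swapHoles m).sum_comp (fun p : Fin (m + 1) × Fin m =>
      ((-1 : ℝ) ^ ((p.1 : ℕ) + (p.2 : ℕ))) • (X (p.2.succ.castSucc, v) *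
            slotMap d (p.2.succ.castSucc.succAbove ∘ mergeIdx p.1) f))).symm
    rw [Fintype.sum_prod_type, barBoundary_apply, map_sum]
    refine Finset.sum_congr rfl fun i _ => ?_
    rw [map_smul, insertVar_apply, Finset.smul_sum]
    refine Finset.sum_congr rfl fun k _ => ?_
    rw [smul_smul, ← pow_add, slotMap_slotMap]
  have htel : ∀ (n : ℕ) (g : Fin (n + 1) → HChain d (m + 1)),
      ∑ i : Fin n, (g i.castSucc - g i.succ) = g 0 - g (Fin.last n) := by
    intro n
    induction n with
    | zero => intro g; simp
    | succ n ih =>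
      intro g
      rw [Fin.sum_univ_succ]
      have := ih (fun i => g i.succ)
      simp only [← Fin.succ_castSucc, this]
      simp
  rw [hL, hR, Finset.sum_add_distrib, add_assoc, ← Finset.sum_add_distrib]
  simp only [neg_smul, ← Finset.sum_add_distrib, neg_add_cancel, Finset.sum_const_zero, add_zero]
  rw [← Finset.sum_mul, htel (m + 1) (fun i => X (i, v))]

/-- The bar complex is contractible. -/
lemma exists_barBoundary_eq (d m : ℕ) (f : HChain d (m + 1)) (hf : barBoundary d m f = 0) :
    ∃ w, barBoundary d (m + 1) w = f := by
  refine ⟨slotMap d Fin.succ f, ?_⟩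
  rw [barBoundary_apply, Fin.sum_univ_succ]
  have h0 : ∀ j : Fin (m + 2), (mergeIdx 0 ∘ Fin.succ) j = j := by
    intro j
    ext
    simp [val_mergeIdx]
  have h1 : ∀ i : Fin (m + 1), mergeIdx i.succ ∘ Fin.succ = Fin.succ ∘ mergeIdx i := by
    intro i
    funext j
    ext
    simp only [Function.comp_apply, val_mergeIdx, Fin.val_succ]
    split_ifs <;> omega
  have h2 : ∑ i : Fin (m + 1), ((-1 : ℝ) ^ (i.succ : ℕ)) •
      slotMap d (mergeIdx i.succ) (slotMap d Fin.succ f) =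
      -slotMap d Fin.succ (barBoundary d m f) := by
    rw [barBoundary_apply, map_sum, ← Finset.sum_neg_distrib]
    refine Finset.sum_congr rfl fun i _ => ?_
    rw [slotMap_slotMap, h1, map_smul, slotMap_slotMap, Fin.val_succ, pow_succ]
    simp
  rw [h2, hf, slotMap_slotMap, slotMap_eq_self d h0]
  simp

/-- The substitution of the variables of the last slot listed in `l` by the corresponding
variables of the first slot. -/
noncomputable def endSubst {d : ℕ} (l : List (Fin d)) (m : ℕ) : HChain d m →ₐ[ℝ] HChain d m :=
  rename fun p : Fin (m + 1) × Fin d => if p.1 = Fin.last m ∧ p.2 ∈ l then (0, p.2) else p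

lemma endSubst_X {d : ℕ} (l : List (Fin d)) (m : ℕ) (p : Fin (m + 1) × Fin d) :
    endSubst l m (X p) = X (if p.1 = Fin.last m ∧ p.2 ∈ l then (0, p.2) else p) :=
  rename_X _ _

lemma endSubst_nil {d : ℕ} (m : ℕ) (f : HChain d m) : endSubst [] m f = f := by
  have : endSubst ([] : List (Fin d)) m = AlgHom.id ℝ _ := by
    refine MvPolynomial.algHom_ext fun p => ?_
    simp [endSubst_X]
  rw [this, AlgHom.id_apply]

lemma endSubst_cons {d : ℕ} (v : Fin d) (l : List (Fin d)) (m : ℕ) (f : HChain d m) :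
    endSubst (v :: l) m f = endSubst [v] m (endSubst l m f) := by
  have : endSubst (v :: l) m = (endSubst [v] m).comp (endSubst l m) := by
    refine MvPolynomial.algHom_ext fun p => ?_
    obtain ⟨i, u⟩ := p
    simp only [AlgHom.comp_apply, endSubst_X, List.mem_cons]
    congr 1
    split_ifs <;> simp_all
  rw [this, AlgHom.comp_apply]

lemma endSubst_cons' {d : ℕ} (v : Fin d) (l : List (Fin d)) (m : ℕ) (f : HChain d m) :
    endSubst (v :: l) m f = endSubst l m (endSubst [v] m f) := by
  have : endSubst (v :: l) m = (endSubst l m).comp (endSubst [v] m) := by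
    refine MvPolynomial.algHom_ext fun p => ?_
    obtain ⟨i, u⟩ := p
    simp only [AlgHom.comp_apply, endSubst_X, List.mem_cons]
    congr 1
    split_ifs <;> simp_all
  rw [this, AlgHom.comp_apply]

lemma endSubst_cons_eq_zero {d : ℕ} (v : Fin d) {l : List (Fin d)} {m : ℕ} {f : HChain d m}
    (hf : endSubst l m f = 0) : endSubst (v :: l) m f = 0 := by
  rw [endSubst_cons, hf, map_zero]

lemma endSubst_slotMap {d : ℕ} (l : List (Fin d)) {m n : ℕ} {φ : Fin (m + 1) → Fin (n + 1)}
    (h0 : φ 0 = 0) (hlast : φ (Fin.last m) = Fin.last n) (f : HChain d m) :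
    endSubst l n (slotMap d φ f) = endSubst l n (slotMap d φ (endSubst l m f)) := by
  have : (endSubst l n).comp (slotMap d φ) =
      ((endSubst l n).comp (slotMap d φ)).comp (endSubst l m) := by
    refine MvPolynomial.algHom_ext fun p => ?_
    obtain ⟨i, u⟩ := p
    simp only [AlgHom.comp_apply, endSubst_X, slotMap_X]
    split_ifs <;> simp_all [slotMap_X, endSubst_X]
  exact DFunLike.congr_fun this f

lemma mergeIdx_zero {m : ℕ} (i : Fin (m + 1)) : mergeIdx i 0 = 0 := by
  ext
  simp [val_mergeIdx]

lemma mergeIdx_last {m : ℕ} (i : Fin (m + 1)) :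
    mergeIdx i (Fin.last (m + 1)) = Fin.last m := by
  ext
  simp only [val_mergeIdx, Fin.val_last]
  split_ifs <;> omega

lemma endSubst_barBoundary_eq_zero {d : ℕ} {l : List (Fin d)} {m : ℕ} {f : HChain d (m + 1)}
    (hf : endSubst l (m + 1) f = 0) : endSubst l m (barBoundary d m f) = 0 := by
  rw [barBoundary_apply, map_sum]
  refine Finset.sum_eq_zero fun i _ => ?_
  rw [map_smul, endSubst_slotMap l (mergeIdx_zero i) (mergeIdx_last i), hf]
  simp

lemma endSubst_insertVar_eq_zero {d : ℕ} (v : Fin d) {l : List (Fin d)} {m : ℕ} {f : HChain d m}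
    (hf : endSubst l m f = 0) : endSubst l (m + 1) (insertVar v m f) = 0 := by
  rw [insertVar_apply, map_sum]
  refine Finset.sum_eq_zero fun i _ => ?_
  rw [map_smul, map_mul, endSubst_slotMap l _ _, hf]
  · simp
  · ext
    simp
  · ext
    simp

/-- The difference of the variable `v` in the first and in the last slot. -/
noncomputable def endDiff {d : ℕ} (v : Fin d) (m : ℕ) : HChain d m :=
  X (0, v) - X (Fin.last m, v)

lemma barBoundary_endDiff_mul {d : ℕ} (v : Fin d) (m : ℕ) (f : HChain d (m + 1)) :
    barBoundary d m (endDiff v (m + 1) * f) = endDiff v m * barBoundary d m f := by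
  rw [barBoundary_apply, barBoundary_apply, Finset.mul_sum]
  refine Finset.sum_congr rfl fun i _ => ?_
  rw [map_mul, endDiff, map_sub, slotMap_X, slotMap_X, mergeIdx_zero, mergeIdx_last, endDiff,
    mul_smul_comm]

lemma endSubst_cons_endDiff {d : ℕ} (v : Fin d) (l : List (Fin d)) (m : ℕ) :
    endSubst (v :: l) m (endDiff v m) = 0 := by
  rw [endDiff, map_sub, endSubst_X, endSubst_X]
  simp

lemma endSubst_eq_zero_of_endDiff_mul {d : ℕ} {v : Fin d} {l : List (Fin d)} (hv : v ∉ l) {m : ℕ}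
    {f : HChain d (m + 1)} (hf : endSubst l (m + 1) (endDiff v (m + 1) * f) = 0) :
    endSubst l (m + 1) f = 0 := by
  rw [map_mul, mul_eq_zero] at hf
  refine hf.resolve_left fun h => ?_
  rw [endDiff, map_sub, endSubst_X, endSubst_X] at h
  have h2 := (X_injective (R := ℝ)) (sub_eq_zero.mp h)
  simp [hv] at h2

lemma exists_endSubst_sub_endDiff_mul {d : ℕ} {v : Fin d} {l : List (Fin d)} {m : ℕ}
    {f : HChain d m} (hf : endSubst (v :: l) m f = 0) :
    ∃ g, endSubst l m (f - endDiff v m * g) = 0 := by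
  have h1 : (Ideal.Quotient.mkₐ ℝ (Ideal.span {endDiff v m})).comp (endSubst [v] m) =
      Ideal.Quotient.mkₐ ℝ (Ideal.span {endDiff v m}) := by
    refine MvPolynomial.algHom_ext fun p => ?_
    obtain ⟨i, u⟩ := p
    simp only [AlgHom.comp_apply, endSubst_X, List.mem_singleton]
    split_ifs with h
    · obtain ⟨rfl, rfl⟩ := h
      simp only [Ideal.Quotient.mkₐ_eq_mk]
      exact Ideal.Quotient.eq.mpr (Ideal.subset_span rfl)
    · rfl
  have h2 : f - endSubst [v] m f ∈ Ideal.span {endDiff v m} :=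
    Ideal.Quotient.eq.mp (DFunLike.congr_fun h1 f).symm
  obtain ⟨g, hg⟩ := Ideal.mem_span_singleton.mp h2
  refine ⟨g, ?_⟩
  rw [← hg, sub_sub_cancel, ← endSubst_cons', hf]

/-- Representatives of the homology of the bar complex with coefficients restricted along the
variables in `l`: iterated insertions of the variables in `l` into degree-zero chains. -/
noncomputable def insertions {d : ℕ} : List (Fin d) → (n : ℕ) → Submodule ℝ (HChain d (n + 1))
  | _, 0 => ⊤
  | [], _ + 1 => ⊥
  | v :: l, n + 1 => insertions l (n + 1) ⊔ (insertions l n).map (insertVar v (n + 1))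

lemma mem_insertions_cons {d : ℕ} {v : Fin d} {l : List (Fin d)} {n : ℕ}
    {w : HChain d (n + 2)} :
    w ∈ insertions (v :: l) (n + 1) ↔
      ∃ w' ∈ insertions l (n + 1), ∃ u ∈ insertions l n, w' + insertVar v (n + 1) u = w := by
  rw [insertions, Submodule.mem_sup]
  simp

lemma insertVar_zero {d : ℕ} (v : Fin d) (f : HChain d 0) : insertVar v 0 f = 0 := by
  simp [insertVar_apply]

lemma endSubst_barBoundary_of_mem_insertions {d : ℕ} {l : List (Fin d)} {n : ℕ}
    {w : HChain d (n + 1)} (hw : w ∈ insertions l n) (hn : n ≠ 0) :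
    endSubst l n (barBoundary d n w) = 0 := by
  induction l generalizing n with
  | nil =>
    obtain ⟨n, rfl⟩ := Nat.exists_eq_succ_of_ne_zero hn
    rw [insertions, Submodule.mem_bot] at hw
    simp [hw]
  | cons v l ih =>
    obtain ⟨n, rfl⟩ := Nat.exists_eq_succ_of_ne_zero hn
    obtain ⟨w', hw', u, hu, rfl⟩ := mem_insertions_cons.mp hw
    rw [map_add, map_add, endSubst_cons_eq_zero v (ih hw' hn), zero_add,
      eq_sub_of_add_eq (barBoundary_insertVar v n u), map_sub, map_mul]
    rw [show (X (0, v) - X (Fin.last (n + 1), v) : HChain d (n + 1)) = endDiff v (n + 1) from rfl,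
      endSubst_cons_endDiff, zero_mul, zero_sub, neg_eq_zero]
    rcases Nat.eq_zero_or_pos n with rfl | h
    · rw [insertVar_zero, map_zero]
    · exact endSubst_cons_eq_zero v (endSubst_insertVar_eq_zero v (ih hu h.ne'))

lemma exists_mem_insertions {d : ℕ} {l : List (Fin d)} (hl : l.Nodup) {n : ℕ}
    (z : HChain d (n + 1)) (hz : n ≠ 0 → endSubst l n (barBoundary d n z) = 0) :
    ∃ w ∈ insertions l n, ∃ y, endSubst l (n + 1) (z - w - barBoundary d (n + 1) y) = 0 := by
  induction l generalizing n with
  | nil =>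
    rcases n with _ | n
    · exact ⟨z, by simp [insertions], 0, by simp⟩
    · obtain ⟨y, hy⟩ := exists_barBoundary_eq d (n + 1) z (by
        simpa [endSubst_nil] using hz n.succ_ne_zero)
      exact ⟨0, zero_mem _, y, by simp [hy]⟩
  | cons v l ih =>
    rcases n with _ | n
    · exact ⟨z, by simp [insertions], 0, by simp⟩
    obtain ⟨hv, hl'⟩ := List.nodup_cons.mp hl
    obtain ⟨g, hg⟩ := exists_endSubst_sub_endDiff_mul (hz n.succ_ne_zero)
    obtain ⟨u, hu, y, hy⟩ := ih hl' g (by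
      intro hn
      obtain ⟨n, rfl⟩ := Nat.exists_eq_succ_of_ne_zero hn
      have := endSubst_barBoundary_eq_zero hg
      rw [map_sub, barBoundary_barBoundary, barBoundary_endDiff_mul, zero_sub, map_neg,
        neg_eq_zero] at this
      exact endSubst_eq_zero_of_endDiff_mul hv this)
    have hhu : endSubst l (n + 1) (insertVar v n (barBoundary d n u)) = 0 := by
      rcases Nat.eq_zero_or_pos n with rfl | h
      · rw [insertVar_zero, map_zero]
      · exact endSubst_insertVar_eq_zero v (endSubst_barBoundary_of_mem_insertions hu h.ne')
    obtain ⟨w, hw, x, hx⟩ := ih hl' (z - insertVar v (n + 1) u - endDiff v (n + 2) * y) (by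
      intro _
      have h1 : barBoundary d (n + 1) (z - insertVar v (n + 1) u - endDiff v (n + 2) * y) =
          (barBoundary d (n + 1) z - endDiff v (n + 1) * g) +
          endDiff v (n + 1) * (g - u - barBoundary d (n + 1) y) +
          insertVar v n (barBoundary d n u) := by
        rw [map_sub, map_sub, barBoundary_endDiff_mul,
          eq_sub_of_add_eq (barBoundary_insertVar v n u), endDiff]
        ring
      rw [h1, map_add, map_add, hg, map_mul, hy, hhu]
      simp)
    refine ⟨w + insertVar v (n + 1) u, mem_insertions_cons.mpr ⟨w, hw, u, hu, rfl⟩, x, ?_⟩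
    have h2 : z - (w + insertVar v (n + 1) u) - barBoundary d (n + 1 + 1) x =
        (z - insertVar v (n + 1) u - endDiff v (n + 2) * y - w - barBoundary d (n + 1 + 1) x) +
        endDiff v (n + 2) * y := by
      ring
    rw [h2, map_add, endSubst_cons_eq_zero v hx, map_mul, endSubst_cons_endDiff]
    simp

/-- The exterior algebra of Kähler differentials of the polynomial algebra. -/
abbrev Forms (d : ℕ) :=
  ExteriorAlgebra (MvPolynomial (Fin d) ℝ) (KaehlerDifferential ℝ (MvPolynomial (Fin d) ℝ))

/-- The form `da₁ ∧ ⋯ ∧ daₙ`. -/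
noncomputable def wedgeD {d n : ℕ} (a : Fin n → MvPolynomial (Fin d) ℝ) : Forms d :=
  ExteriorAlgebra.ιMulti _ n fun t => KaehlerDifferential.D ℝ (MvPolynomial (Fin d) ℝ) (a t)

/-- The Connes map as a linear map into the exterior algebra. -/
noncomputable def connes (d k : ℕ) : HChain d k →ₗ[ℝ] Forms d :=
  (basisMonomials _ ℝ).constr ℝ fun α =>
    chainSlot d k 0 α • wedgeD fun t : Fin k => chainSlot d k t.succ α

lemma connes_monomial (d k : ℕ) (α : Fin (k + 1) × Fin d →₀ ℕ) :
    connes d k (monomial α 1) =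
      chainSlot d k 0 α • wedgeD fun t : Fin k => chainSlot d k t.succ α := by
  have h := (basisMonomials (Fin (k + 1) × Fin d) ℝ).constr_basis ℝ
    (fun α => chainSlot d k 0 α • wedgeD fun t : Fin k => chainSlot d k t.succ α) α
  rwa [coe_basisMonomials] at h

lemma coe_connesPoly (d k : ℕ) (p : HChain d k) :
    (connesPoly d k p : Forms d) = connes d k p := by
  conv_rhs => rw [p.as_sum]
  rw [connesPoly, AddSubmonoidClass.coe_finsetSum, map_sum]
  refine Finset.sum_congr rfl fun α _ => ?_
  rw [show monomial α (coeff α p) = coeff α p • monomial α (1 : ℝ) by simp [smul_monomial],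
    map_smul, connes_monomial, mul_smul, ← algebraMap_eq, algebraMap_smul]
  rfl

lemma hChain_hom_ext {d m : ℕ} {M : Type*} [AddCommGroup M] [Module ℝ M]
    {f g : HChain d m →ₗ[ℝ] M} (h : ∀ α, f (monomial α 1) = g (monomial α 1)) : f = g :=
  (basisMonomials _ ℝ).ext fun α => by simpa using h α

lemma chainSlot_add (d k : ℕ) (j : Fin (k + 1)) (α β : Fin (k + 1) × Fin d →₀ ℕ) :
    chainSlot d k j (α + β) = chainSlot d k j α * chainSlot d k j β := by
  simp only [chainSlot, monomial_mul, mul_one]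
  exact congrArg (fun e => monomial e (1 : ℝ)) (Finsupp.ext fun _ => rfl)

lemma chainSlot_zero (d k : ℕ) (j : Fin (k + 1)) : chainSlot d k j 0 = 1 := by
  have h : Finsupp.comapDomain (fun v : Fin d => (j, v)) (0 : Fin (k + 1) × Fin d →₀ ℕ)
      (Function.Injective.injOn (fun _ _ h => congrArg Prod.snd h)) = 0 := Finsupp.ext fun _ => rfl
  rw [chainSlot, h]
  rfl

lemma chainSlot_single (d k : ℕ) (j i : Fin (k + 1)) (v : Fin d) (e : ℕ) :
    chainSlot d k j (Finsupp.single (i, v) e) = if i = j then X v ^ e else 1 := by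
  split_ifs with h
  · subst h
    rw [chainSlot, X_pow_eq_monomial]
    refine congrArg (fun e => monomial e (1 : ℝ)) (Finsupp.ext fun u => ?_)
    simp [Finsupp.single_apply]
  · rw [← chainSlot_zero d k j]
    refine congrArg (fun e => monomial e (1 : ℝ)) (Finsupp.ext fun u => ?_)
    simp [h]

lemma chainSlot_mapDomain_collapse {d m : ℕ} {φ : Fin (m + 2) → Fin (m + 1)} {q : Fin (m + 2)}
    (hφ : ∀ l, φ (q.succAbove l) = l) (j : Fin (m + 1)) (α : Fin (m + 2) × Fin d →₀ ℕ) :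
    chainSlot d m j (α.mapDomain fun p => (φ p.1, p.2)) =
      chainSlot d (m + 1) (q.succAbove j) α *
        if j = φ q then chainSlot d (m + 1) q α else 1 := by
  induction α using Finsupp.induction_linear with
  | zero => simp [chainSlot_zero]
  | add α β hα hβ =>
    rw [Finsupp.mapDomain_add, chainSlot_add, hα, hβ, chainSlot_add, chainSlot_add]
    split_ifs <;> ring
  | single p e =>
    obtain ⟨i, v⟩ := p
    simp only [Finsupp.mapDomain_single, chainSlot_single]
    rcases Fin.eq_self_or_eq_succAbove q i with rfl | ⟨l, rfl⟩
    · simp [Fin.ne_succAbove, eq_comm]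
    · simp [hφ, Fin.succAbove_ne]

lemma chainSlot_mapDomain_succAbove {d m : ℕ} (q : Fin (m + 2)) (j : Fin (m + 1))
    (α : Fin (m + 1) × Fin d →₀ ℕ) :
    chainSlot d (m + 1) (q.succAbove j) (α.mapDomain fun p => (q.succAbove p.1, p.2)) =
      chainSlot d m j α := by
  induction α using Finsupp.induction_linear with
  | zero => simp [chainSlot_zero]
  | add α β hα hβ => rw [Finsupp.mapDomain_add, chainSlot_add, hα, hβ, chainSlot_add]
  | single p e =>
    obtain ⟨i, v⟩ := p
    simp [Finsupp.mapDomain_single, chainSlot_single]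

lemma chainSlot_mapDomain_succAbove_self {d m : ℕ} (q : Fin (m + 2))
    (α : Fin (m + 1) × Fin d →₀ ℕ) :
    chainSlot d (m + 1) q (α.mapDomain fun p => (q.succAbove p.1, p.2)) = 1 := by
  induction α using Finsupp.induction_linear with
  | zero => simp [chainSlot_zero]
  | add α β hα hβ => rw [Finsupp.mapDomain_add, chainSlot_add, hα, hβ, one_mul]
  | single p e => simp [Finsupp.mapDomain_single, chainSlot_single, Fin.succAbove_ne]

lemma slotMap_monomial {d m n : ℕ} (φ : Fin (m + 1) → Fin (n + 1))
    (α : Fin (m + 1) × Fin d →₀ ℕ) (r : ℝ) :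
    slotMap d φ (monomial α r) = monomial (α.mapDomain fun p => (φ p.1, p.2)) r :=
  rename_monomial _ _ _

lemma connes_slotMap_collapse_zero {d m : ℕ} {φ : Fin (m + 2) → Fin (m + 1)} {r : Fin (m + 1)}
    (hφ : ∀ l, φ (r.succ.succAbove l) = l) (h0 : φ r.succ = 0)
    (α : Fin (m + 2) × Fin d →₀ ℕ) :
    connes d m (slotMap d φ (monomial α 1)) =
      (chainSlot d (m + 1) 0 α * chainSlot d (m + 1) r.succ α) •
        wedgeD fun t => chainSlot d (m + 1) (r.succAbove t).succ α := by
  rw [slotMap_monomial, connes_monomial, chainSlot_mapDomain_collapse hφ]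
  simp only [chainSlot_mapDomain_collapse hφ, h0, if_true, Fin.succ_ne_zero, if_false, mul_one,
    Fin.succ_succAbove_succ, Fin.succ_succAbove_zero]

lemma wedgeD_mul {d m : ℕ} (u : Fin (m + 1) → MvPolynomial (Fin d) ℝ) (i : Fin m) :
    (wedgeD fun t => u (i.succ.succAbove t) * if t = i then u i.succ else 1) =
      u i.succ • wedgeD (fun t => u (i.succ.succAbove t)) +
        u i.castSucc • wedgeD (fun t => u (i.castSucc.succAbove t)) := by
  simp only [wedgeD]
  set D := KaehlerDifferential.D ℝ (MvPolynomial (Fin d) ℝ)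
  have h1 : (fun t => D (u (i.succ.succAbove t) * if t = i then u i.succ else 1)) =
      Function.update (fun t => D (u (i.succ.succAbove t))) i
        (u i.castSucc • D (u i.succ) + u i.succ • D (u i.castSucc)) := by
    funext t
    rcases eq_or_ne t i with rfl | h
    · simp
    · simp [h]
  have h2 : Function.update (fun t => D (u (i.succ.succAbove t))) i (D (u i.castSucc)) =
      fun t => D (u (i.succ.succAbove t)) := by
    rw [Function.update_eq_self_iff]
    simp
  have h3 : Function.update (fun t => D (u (i.succ.succAbove t))) i (D (u i.succ)) =
      fun t => D (u (i.castSucc.succAbove t)) := by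
    funext t
    rcases eq_or_ne t i with rfl | h
    · simp
    · rw [Function.update_of_ne h]
      congr 2
      ext
      have : (t : ℕ) ≠ i := fun h' => h (Fin.ext h')
      simp only [val_succAbove, Fin.val_succ, Fin.val_castSucc]
      split_ifs <;> omega
  rw [h1, AlternatingMap.map_update_add, AlternatingMap.map_update_smul,
    AlternatingMap.map_update_smul, h2, h3, add_comm]

lemma sum_neg_one_pow_smul_telescope {M : Type*} [AddCommGroup M] [Module ℝ M] (n : ℕ)
    (T : Fin (n + 1) → M) :
    ∑ i : Fin n, ((-1 : ℝ) ^ ((i : ℕ) + 1)) • (T i.succ + T i.castSucc) =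
      ((-1 : ℝ) ^ n) • T (Fin.last n) - T 0 := by
  induction n with
  | zero => simp
  | succ n ih =>
    rw [Fin.sum_univ_castSucc]
    have := ih fun i => T i.castSucc
    simp only [Fin.val_castSucc, Fin.succ_castSucc, this]
    simp only [Fin.castSucc_zero, Fin.val_last, Fin.succ_last, pow_succ, smul_add]
    module

lemma mergeIdx_succ {n : ℕ} (i : Fin (n + 1)) : mergeIdx i i.succ = i := by
  ext
  simp [val_mergeIdx]

lemma mergeIdx_succ_succAbove {n : ℕ} (i l : Fin (n + 1)) :
    mergeIdx i (i.succ.succAbove l) = l := by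
  ext
  simp only [val_mergeIdx, val_succAbove, Fin.val_succ]
  split_ifs <;> omega

lemma cycIdx_last {n : ℕ} : cycIdx (Fin.last (n + 1)) = 0 := by
  ext
  simp [val_cycIdx]

lemma cycIdx_castSucc {n : ℕ} (l : Fin (n + 1)) : cycIdx l.castSucc = l := by
  have := l.isLt
  ext
  simp only [val_cycIdx, Fin.val_castSucc]
  split_ifs <;> omega

lemma cycIdx_succAbove {n : ℕ} (l : Fin (n + 1)) :
    cycIdx ((Fin.last n).succ.succAbove l) = l := by
  rw [Fin.succ_last, Fin.succAbove_last, cycIdx_castSucc]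

lemma connes_slotMap_cycIdx {d n : ℕ} (α : Fin (n + 2) × Fin d →₀ ℕ) :
    connes d n (slotMap d cycIdx (monomial α 1)) =
      (chainSlot d (n + 1) 0 α * chainSlot d (n + 1) (Fin.last (n + 1)) α) •
        wedgeD fun t => chainSlot d (n + 1) t.succ.castSucc α := by
  rw [connes_slotMap_collapse_zero cycIdx_succAbove (r := Fin.last n) cycIdx_last]
  simp [Fin.succAbove_last]

lemma connes_hBoundary (d n : ℕ) (w : HChain d (n + 1)) :
    connes d n (hBoundary d n w) = 0 := by
  suffices h : (connes d n).comp (hBoundary d n) = 0 from DFunLike.congr_fun h w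
  refine hChain_hom_ext fun α => ?_
  let u : Fin (n + 1) → MvPolynomial (Fin d) ℝ := fun r => chainSlot d (n + 1) r.succ α
  let T : Fin (n + 1) → Forms d := fun r =>
    (chainSlot d (n + 1) 0 α * u r) • wedgeD fun t => u (r.succAbove t)
  have h0 : connes d n (slotMap d (mergeIdx 0) (monomial α 1)) = T 0 := by
    exact connes_slotMap_collapse_zero (mergeIdx_succ_succAbove 0) (mergeIdx_succ 0) α
  have hlast : connes d n (slotMap d cycIdx (monomial α 1)) = T (Fin.last n) := by
    exact connes_slotMap_collapse_zero cycIdx_succAbove cycIdx_last α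
  have hsucc : ∀ i : Fin n, connes d n (slotMap d (mergeIdx i.succ) (monomial α 1)) =
      T i.succ + T i.castSucc := by
    intro i
    have hφ := mergeIdx_succ_succAbove i.succ
    have hq := mergeIdx_succ i.succ
    rw [slotMap_monomial, connes_monomial, chainSlot_mapDomain_collapse hφ]
    simp only [chainSlot_mapDomain_collapse hφ, hq, (Fin.succ_ne_zero i).symm, if_false, mul_one,
      Fin.succ_inj, Fin.succ_succAbove_succ, Fin.succ_succAbove_zero]
    rw [show (wedgeD fun t : Fin n => chainSlot d (n + 1) (i.succ.succAbove t).succ α *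
      if t = i then chainSlot d (n + 1) i.succ.succ α else 1) = _ from wedgeD_mul u i]
    simp only [T, smul_add, mul_smul]
  rw [LinearMap.comp_apply, hBoundary_apply, barBoundary_apply, map_add, map_sum]
  simp only [map_smul, Fin.sum_univ_succ, h0, hlast, hsucc, Fin.val_succ]
  rw [sum_neg_one_pow_smul_telescope n T, pow_succ]
  simp

lemma cycIdx_zero {n : ℕ} : cycIdx (0 : Fin (n + 2)) = 0 := cycIdx_castSucc 0

lemma hBoundary_slotMap_cycIdx (d n : ℕ) (f : HChain d (n + 2)) :
    hBoundary d n (slotMap d cycIdx f) = slotMap d cycIdx (barBoundary d (n + 1) f) := by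
  have h1 : ∀ i : Fin (n + 1), (mergeIdx i ∘ cycIdx : Fin (n + 3) → Fin (n + 1)) =
      cycIdx ∘ mergeIdx i.castSucc := by
    intro i
    funext j
    have := i.isLt
    have := j.isLt
    ext
    simp only [Function.comp_apply, val_mergeIdx, val_cycIdx, Fin.val_castSucc]
    split_ifs <;> omega
  have h2 : (cycIdx ∘ cycIdx : Fin (n + 3) → Fin (n + 1)) =
      cycIdx ∘ mergeIdx (Fin.last (n + 1)) := by
    funext j
    have := j.isLt
    ext
    simp only [Function.comp_apply, val_mergeIdx, val_cycIdx, Fin.val_last]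
    split_ifs <;> omega
  rw [hBoundary_apply, barBoundary_apply, barBoundary_apply, map_sum,
    Fin.sum_univ_castSucc (n := n + 1)]
  simp only [map_smul, slotMap_slotMap, h1, h2, Fin.val_castSucc, Fin.val_last]

lemma endSubst_eq_zero_iff {d : ℕ} {l : List (Fin d)} (hl : ∀ v, v ∈ l) {m : ℕ}
    {f : HChain d (m + 1)} : endSubst l (m + 1) f = 0 ↔ slotMap d cycIdx f = 0 := by
  have h1 : endSubst l (m + 1) f = slotMap d Fin.castSucc (slotMap d cycIdx f) := by
    have : endSubst l (m + 1) = (slotMap d Fin.castSucc).comp (slotMap d cycIdx) := by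
      refine MvPolynomial.algHom_ext fun p => ?_
      obtain ⟨i, u⟩ := p
      rw [AlgHom.comp_apply, endSubst_X, slotMap_X, slotMap_X]
      induction i using Fin.lastCases with
      | last => simp [hl, cycIdx_last]
      | cast i => simp [cycIdx_castSucc, (Fin.castSucc_lt_last i).ne]
    rw [this, AlgHom.comp_apply]
  have h2 : slotMap d cycIdx (slotMap d Fin.castSucc (slotMap d cycIdx f)) =
      slotMap d cycIdx f := by
    rw [slotMap_slotMap, slotMap_eq_self]
    exact cycIdx_castSucc
  constructor
  · intro h
    rw [← h2, ← h1, h, map_zero]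
  · intro h
    rw [h1, h, map_zero]

lemma slotMap_cycIdx_insertVar_eq_zero {d : ℕ} (v : Fin d) {m : ℕ} {f : HChain d (m + 1)}
    (hf : slotMap d cycIdx f = 0) : slotMap d cycIdx (insertVar v (m + 1) f) = 0 := by
  have hl : ∀ u : Fin d, u ∈ List.finRange d := List.mem_finRange
  exact (endSubst_eq_zero_iff hl).mp
    (endSubst_insertVar_eq_zero v ((endSubst_eq_zero_iff hl).mpr hf))

lemma connes_insertVar {d : ℕ} (v : Fin d) (n : ℕ) (f : HChain d (n + 1)) :
    connes d (n + 1) (slotMap d cycIdx (insertVar v (n + 1) f)) =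
      ((n : ℝ) + 1) • (ExteriorAlgebra.ι (MvPolynomial (Fin d) ℝ)
        (KaehlerDifferential.D ℝ (MvPolynomial (Fin d) ℝ) (X v)) *
          connes d n (slotMap d cycIdx f)) := by
  suffices h : (connes d (n + 1)).comp ((slotMap d cycIdx).toLinearMap.comp
      (insertVar v (n + 1))) = ((n : ℝ) + 1) • (LinearMap.mulLeft ℝ
        (ExteriorAlgebra.ι (MvPolynomial (Fin d) ℝ)
          (KaehlerDifferential.D ℝ (MvPolynomial (Fin d) ℝ) (X v)) : Forms d)).comp
          ((connes d n).comp (slotMap d cycIdx).toLinearMap) from DFunLike.congr_fun h f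
  refine hChain_hom_ext fun α => ?_
  have key : ∀ i : Fin (n + 1), ((-1 : ℝ) ^ (i : ℕ)) • connes d (n + 1) (slotMap d cycIdx
      (X (i.succ.castSucc, v) * slotMap d i.succ.castSucc.succAbove (monomial α 1))) =
      ExteriorAlgebra.ι (MvPolynomial (Fin d) ℝ)
        (KaehlerDifferential.D ℝ (MvPolynomial (Fin d) ℝ) (X v)) *
          connes d n (slotMap d cycIdx (monomial α 1)) := by
    intro i
    set q : Fin (n + 3) := i.succ.castSucc with hq
    set β : Fin (n + 3) × Fin d →₀ ℕ :=
      Finsupp.single (q, v) 1 + α.mapDomain fun p => (q.succAbove p.1, p.2) with hβ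
    have hX : X (q, v) * slotMap d q.succAbove (monomial α 1) = monomial β (1 : ℝ) := by
      rw [slotMap_monomial, X, monomial_mul, one_mul]
    have hself : chainSlot d (n + 2) q β = X v := by
      rw [hβ, chainSlot_add, chainSlot_mapDomain_succAbove_self, chainSlot_single]
      simp
    have hother : ∀ j, chainSlot d (n + 2) (q.succAbove j) β = chainSlot d (n + 1) j α := by
      intro j
      rw [hβ, chainSlot_add, chainSlot_mapDomain_succAbove, chainSlot_single]
      simp [Fin.ne_succAbove]
    have h0 : chainSlot d (n + 2) 0 β = chainSlot d (n + 1) 0 α := by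
      rw [← hother 0]
      congr 1
    have hlast : chainSlot d (n + 2) (Fin.last (n + 2)) β =
        chainSlot d (n + 1) (Fin.last (n + 1)) α := by
      rw [← hother]
      congr 1
      ext
      simp [q]
    have hw : (fun t : Fin (n + 1) => KaehlerDifferential.D ℝ (MvPolynomial (Fin d) ℝ)
        (chainSlot d (n + 2) t.succ.castSucc β)) =
        i.insertNth (KaehlerDifferential.D ℝ (MvPolynomial (Fin d) ℝ) (X v))
          fun t : Fin n => KaehlerDifferential.D ℝ (MvPolynomial (Fin d) ℝ)
            (chainSlot d (n + 1) t.succ.castSucc α) := by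
      rw [Fin.eq_insertNth_iff]
      refine ⟨by rw [← hself], ?_⟩
      funext t
      simp only [Fin.removeNth]
      rw [← hother, hq]
      congr 2
      ext
      simp only [val_succAbove, Fin.val_succ, Fin.val_castSucc]
      split_ifs <;> omega
    rw [hX, connes_slotMap_cycIdx, connes_slotMap_cycIdx, h0, hlast, wedgeD, wedgeD, hw,
      AlternatingMap.map_insertNth, ExteriorAlgebra.ιMulti_succ_apply]
    simp only [Matrix.cons_val_zero, Matrix.vecTail, Function.comp_def, Matrix.cons_val_succ]
    rw [mul_smul_comm]
    rcases Nat.even_or_odd (i : ℕ) with h | h <;> simp [h.neg_one_pow]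
  simp only [LinearMap.comp_apply, AlgHom.toLinearMap_apply, LinearMap.smul_apply,
    LinearMap.mulLeft_apply]
  rw [insertVar_apply, map_sum, map_sum]
  simp only [map_smul, key, Finset.sum_const, Finset.card_univ, Fintype.card_fin]
  rw [← Nat.cast_smul_eq_nsmul ℝ]
  simp

lemma connes_rename_mul {d k : ℕ} (a : MvPolynomial (Fin d) ℝ) (z : HChain d k) :
    connes d k (rename (fun v => ((0 : Fin (k + 1)), v)) a * z) = a • connes d k z := by
  induction a using MvPolynomial.induction_on generalizing z with
  | C r =>
    rw [rename_C, ← smul_eq_C_mul, map_smul, ← algebraMap_eq, algebraMap_smul]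
  | add p q hp hq => rw [map_add, add_mul, map_add, hp, hq, add_smul]
  | mul_X p v hp =>
    rw [map_mul (rename fun v => ((0 : Fin (k + 1)), v)) p (X v), mul_assoc, hp, mul_smul,
      rename_X]
    congr 1
    suffices h : (connes d k).comp (LinearMap.mulLeft ℝ (X ((0 : Fin (k + 1)), v))) =
        (LinearMap.lsmul (MvPolynomial (Fin d) ℝ) (Forms d) (X v)).restrictScalars ℝ ∘ₗ
          connes d k from DFunLike.congr_fun h z
    refine hChain_hom_ext fun α => ?_
    simp only [LinearMap.comp_apply, LinearMap.mulLeft_apply, LinearMap.coe_restrictScalars,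
      LinearMap.lsmul_apply]
    rw [X, monomial_mul, one_mul, connes_monomial, connes_monomial, smul_smul]
    simp only [chainSlot_add, chainSlot_single, if_true, pow_one, (Fin.succ_ne_zero _).symm,
      if_false, one_mul]

lemma connes_zero {d : ℕ} (z : HChain d 0) :
    connes d 0 z = algebraMap (MvPolynomial (Fin d) ℝ) (Forms d) (rename Prod.snd z) := by
  suffices h : connes d 0 = ((Algebra.linearMap (MvPolynomial (Fin d) ℝ)
      (Forms d)).restrictScalars ℝ).comp (rename Prod.snd).toLinearMap from DFunLike.congr_fun h z
  refine hChain_hom_ext fun α => ?_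
  have hα : rename Prod.snd (monomial α (1 : ℝ)) = chainSlot d 0 0 α := by
    rw [rename_monomial, chainSlot]
    refine congrArg (fun e => monomial e (1 : ℝ)) (Finsupp.ext fun v => ?_)
    have hinj : Function.Injective (Prod.snd : Fin (0 + 1) × Fin d → Fin d) := fun a b h =>
      Prod.ext (Subsingleton.elim (α := Fin 1) _ _) h
    exact Finsupp.mapDomain_apply hinj α (0, v)
  simp only [LinearMap.comp_apply, AlgHom.toLinearMap_apply, LinearMap.coe_restrictScalars,
    Algebra.linearMap_apply, hα, connes_monomial, wedgeD, ExteriorAlgebra.ιMulti_zero_apply,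
    Algebra.algebraMap_eq_smul_one]

lemma connes_zero_injective (d : ℕ) : Function.Injective (connes d 0) := by
  intro x y h
  rw [connes_zero, connes_zero, ExteriorAlgebra.algebraMap_inj] at h
  exact rename_injective _ (fun a b h =>
      Prod.ext (Subsingleton.elim (α := Fin 1) _ _) h) h

/-- Contraction of forms with the coordinate vector field of the variable `v`. -/
noncomputable def contractVar {d : ℕ} (v : Fin d) :
    Forms d →ₗ[MvPolynomial (Fin d) ℝ] Forms d :=
  CliffordAlgebra.contractLeft ((KaehlerDifferential.mvPolynomialBasis ℝ (Fin d)).coord v)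

lemma contractVar_D_mul {d : ℕ} (u v : Fin d) (x : Forms d) :
    contractVar v (ExteriorAlgebra.ι (MvPolynomial (Fin d) ℝ)
        (KaehlerDifferential.D ℝ (MvPolynomial (Fin d) ℝ) (X u)) * x) =
      (if u = v then x else 0) - ExteriorAlgebra.ι (MvPolynomial (Fin d) ℝ)
        (KaehlerDifferential.D ℝ (MvPolynomial (Fin d) ℝ) (X u)) * contractVar v x := by
  refine (CliffordAlgebra.contractLeft_ι_mul _ _ _).trans ?_
  congr 1
  rw [← KaehlerDifferential.mvPolynomialBasis_apply, Module.Basis.coord_apply,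
    Module.Basis.repr_self, Finsupp.single_apply]
  split_ifs <;> simp

lemma contractVar_connes_of_mem_insertions {d : ℕ} {l : List (Fin d)} {v : Fin d} (hv : v ∉ l)
    {n : ℕ} {w : HChain d (n + 1)} (hw : w ∈ insertions l n) :
    contractVar v (connes d n (slotMap d cycIdx w)) = 0 := by
  induction l generalizing n with
  | nil =>
    rcases n with _ | n
    · rw [connes_zero]
      exact CliffordAlgebra.contractLeft_algebraMap _ _ _
    · rw [insertions, Submodule.mem_bot] at hw
      simp [hw]
  | cons u l ih =>
    rcases n with _ | n
    · rw [connes_zero]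
      exact CliffordAlgebra.contractLeft_algebraMap _ _ _
    · obtain ⟨w', hw', x, hx, rfl⟩ := mem_insertions_cons.mp hw
      rw [List.mem_cons, not_or] at hv
      rw [map_add, map_add, map_add, ih hv.2 hw', zero_add, connes_insertVar,
        LinearMap.map_smul_of_tower, contractVar_D_mul, ih hv.2 hx, if_neg (Ne.symm hv.1)]
      simp

lemma eq_zero_of_connes_eq_zero_of_mem_insertions {d : ℕ} {l : List (Fin d)} (hl : l.Nodup)
    {n : ℕ} {w : HChain d (n + 1)} (hw : w ∈ insertions l n)
    (h : connes d n (slotMap d cycIdx w) = 0) : slotMap d cycIdx w = 0 := by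
  induction l generalizing n with
  | nil =>
    rcases n with _ | n
    · exact connes_zero_injective d (h.trans (map_zero _).symm)
    · rw [insertions, Submodule.mem_bot] at hw
      simp [hw]
  | cons u l ih =>
    rcases n with _ | n
    · exact connes_zero_injective d (h.trans (map_zero _).symm)
    · obtain ⟨hu, hl'⟩ := List.nodup_cons.mp hl
      obtain ⟨w', hw', x, hx, rfl⟩ := mem_insertions_cons.mp hw
      rw [map_add, map_add, connes_insertVar] at h
      have h1 := congrArg (contractVar u) h
      rw [map_add, contractVar_connes_of_mem_insertions hu hw', zero_add,
        LinearMap.map_smul_of_tower, contractVar_D_mul,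
        contractVar_connes_of_mem_insertions hu hx, if_pos rfl, mul_zero, sub_zero, map_zero,
        smul_eq_zero] at h1
      have hx0 := h1.resolve_left (by positivity)
      rw [hx0, mul_zero, smul_zero, add_zero] at h
      rw [map_add, ih hl' hw' h, slotMap_cycIdx_insertVar_eq_zero u (ih hl' hx hx0), add_zero]

lemma hBoundary_rename_mul {d n : ℕ} (a : MvPolynomial (Fin d) ℝ) (z : HChain d (n + 1)) :
    hBoundary d n (rename (fun v => ((0 : Fin (n + 2)), v)) a * z) =
      rename (fun v => ((0 : Fin (n + 1)), v)) a * hBoundary d n z := by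
  have h : ∀ φ : Fin (n + 2) → Fin (n + 1), φ 0 = 0 →
      slotMap d φ (rename (fun v => ((0 : Fin (n + 2)), v)) a) =
        rename (fun v => ((0 : Fin (n + 1)), v)) a := by
    intro φ h0
    rw [slotMap, rename_rename]
    simp only [Function.comp_def, h0]
  rw [hBoundary_apply, hBoundary_apply, barBoundary_apply, barBoundary_apply, mul_add,
    Finset.mul_sum]
  simp only [map_mul, h _ (mergeIdx_zero _), h _ cycIdx_zero, mul_smul_comm]

/-- The forms represented by Hochschild cycles. -/
noncomputable def cycleForms (d k : ℕ) : Submodule (MvPolynomial (Fin d) ℝ) (Forms d) where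
  carrier := {ω | ∃ z : HChain d k, hBoundaryDown d k z = 0 ∧ connes d k z = ω}
  zero_mem' := ⟨0, map_zero _, map_zero _⟩
  add_mem' := by
    rintro _ _ ⟨x, hx, rfl⟩ ⟨y, hy, rfl⟩
    exact ⟨x + y, by rw [map_add, hx, hy, add_zero], map_add _ _ _⟩
  smul_mem' := by
    rintro a _ ⟨x, hx, rfl⟩
    refine ⟨rename (fun v => ((0 : Fin (k + 1)), v)) a * x, ?_, connes_rename_mul a x⟩
    rcases k with _ | k
    · rfl
    · exact (hBoundary_rename_mul a x).trans (by
        rw [show hBoundary d k x = 0 from hx, mul_zero])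

lemma D_X_mul_mem_cycleForms {d k : ℕ} (v : Fin d) {ω : Forms d} (hω : ω ∈ cycleForms d k) :
    ExteriorAlgebra.ι (MvPolynomial (Fin d) ℝ)
        (KaehlerDifferential.D ℝ (MvPolynomial (Fin d) ℝ) (X v)) * ω ∈ cycleForms d (k + 1) := by
  obtain ⟨z, hz, rfl⟩ := hω
  set f : HChain d (k + 1) := slotMap d Fin.castSucc z with hf
  have hfz : slotMap d cycIdx f = z := by
    rw [hf, slotMap_slotMap, slotMap_eq_self]
    exact cycIdx_castSucc
  have hlast : slotMap d cycIdx (insertVar v k (barBoundary d k f)) = 0 := by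
    rcases k with _ | k
    · rw [insertVar_zero, map_zero]
    · refine slotMap_cycIdx_insertVar_eq_zero v ?_
      rw [← hBoundary_slotMap_cycIdx, hfz]
      exact hz
  refine ⟨((k : ℝ) + 1)⁻¹ • slotMap d cycIdx (insertVar v (k + 1) f), ?_, ?_⟩
  · rw [map_smul]
    refine (congrArg _ ?_).trans (smul_zero _)
    refine (hBoundary_slotMap_cycIdx d k _).trans ?_
    rw [eq_sub_of_add_eq (barBoundary_insertVar v k f), map_sub, hlast, map_mul, map_sub,
      slotMap_X, slotMap_X, cycIdx_zero, cycIdx_last]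
    simp
  · rw [map_smul, connes_insertVar, hfz, inv_smul_smul₀ (by positivity)]

lemma exteriorPower_le_cycleForms (d k : ℕ) :
    (⋀[MvPolynomial (Fin d) ℝ]^k (KaehlerDifferential ℝ (MvPolynomial (Fin d) ℝ)) :
      Submodule (MvPolynomial (Fin d) ℝ) (Forms d)) ≤ cycleForms d k := by
  induction k with
  | zero =>
    rw [ExteriorAlgebra.exteriorPower, pow_zero, Submodule.one_le]
    refine ⟨1, rfl, ?_⟩
    rw [connes_zero, map_one, map_one]
  | succ k ih =>
    rw [ExteriorAlgebra.exteriorPower, pow_succ', Submodule.mul_le]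
    rintro _ ⟨m, rfl⟩ ω hω
    have hm : m ∈ Submodule.span (MvPolynomial (Fin d) ℝ)
        (Set.range (KaehlerDifferential.mvPolynomialBasis ℝ (Fin d))) := by
      rw [Module.Basis.span_eq]
      trivial
    induction hm using Submodule.span_induction with
    | mem x hx =>
      obtain ⟨v, rfl⟩ := hx
      rw [KaehlerDifferential.mvPolynomialBasis_apply]
      exact D_X_mul_mem_cycleForms v (ih hω)
    | zero => simp
    | add x y _ _ hx hy =>
      rw [map_add, add_mul]
      exact add_mem hx hy
    | smul a x _ hx =>
      rw [map_smul, smul_mul_assoc]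
      exact Submodule.smul_mem _ a hx

end HochschildPoly

/-- Hochschild–Kostant–Rosenberg / Teleman, algebraic case.
Let `A = ℝ[x₁,…,x_d]`.  For every `k ≥ 0` the Connes map `𝔠_k` induces an isomorphism of
`ℝ`-vector spaces from the `k`-th Hochschild homology `H_k(C_•, b)` onto the module
`Ω^k = Λ^k_A Ω¹_{A/ℝ}` of Kähler differential `k`-forms: it annihilates boundaries, every
differential form is the image of a cycle, and a cycle mapped to zero is a boundary. -/
theorem hkr_homology_iso_kaehler_forms (d k : ℕ) :
    (∀ w : HChain d (k + 1), connesPoly d k (hBoundary d k w) = 0) ∧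
    (∀ ω : (⋀[MvPolynomial (Fin d) ℝ]^k (KaehlerDifferential ℝ (MvPolynomial (Fin d) ℝ)) :
        Submodule (MvPolynomial (Fin d) ℝ) _),
      ∃ z : HChain d k, hBoundaryDown d k z = 0 ∧ connesPoly d k z = ω) ∧
    (∀ z : HChain d k, hBoundaryDown d k z = 0 → connesPoly d k z = 0 →
      ∃ w : HChain d (k + 1), hBoundary d k w = z) := by
  have hconnes : ∀ z : HChain d k, connesPoly d k z = 0 ↔ HochschildPoly.connes d k z = 0 := by
    intro z
    rw [← HochschildPoly.coe_connesPoly, ZeroMemClass.coe_eq_zero]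
  refine ⟨fun w => (hconnes _).mpr (HochschildPoly.connes_hBoundary d k w), fun ω => ?_,
    fun z hz hc => ?_⟩
  · obtain ⟨z, hz, hω⟩ := HochschildPoly.exteriorPower_le_cycleForms d k ω.2
    exact ⟨z, hz, Subtype.ext ((HochschildPoly.coe_connesPoly d k z).trans hω)⟩
  · have hl : ∀ v : Fin d, v ∈ List.finRange d := List.mem_finRange
    have hlift : HochschildPoly.slotMap d cycIdx
        (HochschildPoly.slotMap d Fin.castSucc z : HChain d (k + 1)) = z := by
      rw [HochschildPoly.slotMap_slotMap, HochschildPoly.slotMap_eq_self]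
      exact HochschildPoly.cycIdx_castSucc
    obtain ⟨w, hw, y, hy⟩ := HochschildPoly.exists_mem_insertions (List.nodup_finRange d)
      (HochschildPoly.slotMap d Fin.castSucc z : HChain d (k + 1)) (by
        intro hk
        obtain ⟨n, rfl⟩ := Nat.exists_eq_succ_of_ne_zero hk
        rw [HochschildPoly.endSubst_eq_zero_iff hl, ← HochschildPoly.hBoundary_slotMap_cycIdx,
          hlift]
        exact hz)
    rw [HochschildPoly.endSubst_eq_zero_iff hl, map_sub, map_sub, hlift,
      ← HochschildPoly.hBoundary_slotMap_cycIdx, sub_sub, sub_eq_zero] at hy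
    have hwc := (hconnes z).mp hc
    rw [hy, map_add, HochschildPoly.connes_hBoundary, add_zero] at hwc
    rw [HochschildPoly.eq_zero_of_connes_eq_zero_of_mem_insertions (List.nodup_finRange d) hw hwc,
      zero_add] at hy
    exact ⟨_, hy.symm⟩
end

section
/- (Vey's Hochschild–Kostant–Rosenberg theorem, algebraic case.) Let A = ℝ[x₁,…,x_d] be the real polynomial algebra in d variables. For every k ≥ −1, the Hochschild–Kostant–Rosenberg map V induces an isomorphism of ℝ-vector spaces from Λ^{k+1}_A Der(A) onto the k-th cohomology H^k(C^•(A), ∂) of the Hochschild cochain complex. -/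
open scoped BigOperators

set_option synthInstance.maxHeartbeats 1000000
set_option maxHeartbeats 1000000

/-- `Φ` (a raw cochain with `q` arguments, i.e. of degree `q - 1`) is a Hochschild
coboundary, i.e. lies in the image of `∂ = [μ, ·]_G`.  (For `q = 0`, i.e. degree `-1`,
there are no cochains of degree `-2`, so being a coboundary means being zero.) -/
noncomputable def IsHCoboundary {A : Type} [Ring A] [Algebra ℝ A] :
    (q : ℕ) → ((ℕ → A) → A) → Prop
  | 0, F => ∀ a : ℕ → A, F a = 0
  | (p + 1), F => ∃ Ψ : MultilinearMap ℝ (fun _ : Fin p => A) A,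
      ∀ a : ℕ → A, F a = gbrM 2 p (mulC A) (evalC Ψ) a

/-- The value of the Hochschild–Kostant–Rosenberg map on a decomposable polyvector field
`u 0 ∧ ⋯ ∧ u (m-1)` (with `m = k + 1`). -/
noncomputable def hkrDec (A : Type) [CommRing A] [Algebra ℝ A] (m : ℕ)
    (u : Fin m → Derivation ℝ A A) : MultilinearMap ℝ (fun _ : Fin m => A) A :=
  ((m.factorial : ℝ))⁻¹ •
    ∑ ε : Equiv.Perm (Fin m),
      ((Equiv.Perm.sign ε : ℤ)) •
        (MultilinearMap.mkPiAlgebra ℝ (Fin m) A).compLinearMap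
          (fun i => (u (ε i)).toLinearMap)

section Cochains

variable {k A M N : Type} [Field k] [CommRing A] [Algebra k A] [AddCommGroup M] [Module k M]
  [AddCommGroup N] [Module k N]

/-- Hochschild cochains with `m` arguments in `A` and values in `M`. -/
abbrev HCochain (k A M : Type) [Field k] [CommRing A] [Algebra k A] [AddCommGroup M] [Module k M]
    (m : ℕ) : Type :=
  MultilinearMap k (fun _ : Fin m => A) M

/-- Separating the first argument of a cochain. -/
def hcurry {m : ℕ} : HCochain k A M (m + 1) ≃ₗ[k] (A →ₗ[k] HCochain k A M m) :=
  multilinearCurryLeftEquiv k (fun _ : Fin (m + 1) => A) M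

/-- Pushforward of cochains along a linear map of the values. -/
def hmap (f : M →ₗ[k] N) (m : ℕ) : HCochain k A M m →ₗ[k] HCochain k A N m where
  toFun Φ := f.compMultilinearMap Φ
  map_add' Φ Ψ := by ext; simp
  map_smul' c Φ := by ext; simp

lemma hmap_apply (f : M →ₗ[k] N) {m : ℕ} (Φ : HCochain k A M m) (v : Fin m → A) :
    hmap f m Φ v = f (Φ v) := rfl

lemma hcurry_apply {m : ℕ} (Φ : HCochain k A M (m + 1)) (a : A) (v : Fin m → A) :
    hcurry Φ a v = Φ (Fin.cons a v) := rfl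

lemma hcurry_hmap (f : M →ₗ[k] N) {m : ℕ} (Φ : HCochain k A M (m + 1)) (a : A) :
    hcurry (hmap f (m + 1) Φ) a = hmap f m (hcurry Φ a) := rfl

lemma hcurry_ext {m : ℕ} {Φ Ψ : HCochain k A M (m + 1)} (h : ∀ a, hcurry Φ a = hcurry Ψ a) :
    Φ = Ψ :=
  hcurry.injective (LinearMap.ext h)

/-- The right action of `A` on cochains for which the Hochschild coboundary of `Φ` is the
commutator `a ↦ a Φ - Φ a`. -/
def rightAct (R : A →ₐ[k] Module.End k M) :
    (m : ℕ) → A →ₗ[k] HCochain k A M m →ₗ[k] HCochain k A M m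
  | 0 => LinearMap.mk₂ k (fun b Φ => hmap (R b) 0 Φ)
      (fun b c Φ => by ext; simp [hmap_apply]) (fun c b Φ => by ext; simp [hmap_apply])
      (fun b Φ Ψ => by simp) (fun c b Φ => by simp)
  | m + 1 => LinearMap.mk₂ k
      (fun b Φ => hcurry.symm (hcurry Φ ∘ₗ LinearMap.mulLeft k b -
        (rightAct R m).flip (hcurry Φ b)))
      (fun b c Φ => by
        rw [← map_add]; congr 1; ext1 x
        simp only [LinearMap.sub_apply, LinearMap.add_apply, LinearMap.comp_apply,
          LinearMap.mulLeft_apply, map_add, add_mul]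
        abel)
      (fun c b Φ => by
        rw [← map_smul]; congr 1; ext1 x
        simp only [LinearMap.sub_apply, LinearMap.smul_apply, LinearMap.comp_apply,
          LinearMap.mulLeft_apply, map_smul, smul_mul_assoc, smul_sub])
      (fun b Φ Ψ => by
        rw [← map_add]; congr 1; ext1 x
        simp only [LinearMap.sub_apply, LinearMap.add_apply, LinearMap.comp_apply,
          LinearMap.mulLeft_apply, map_add]
        abel)
      (fun c b Φ => by
        rw [← map_smul]; congr 1; ext1 x
        simp only [LinearMap.sub_apply, LinearMap.smul_apply, LinearMap.comp_apply,
          LinearMap.mulLeft_apply, map_smul, smul_sub])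

lemma rightAct_zero (R : A →ₐ[k] Module.End k M) (b : A) (Φ : HCochain k A M 0) :
    rightAct R 0 b Φ = hmap (R b) 0 Φ := rfl

lemma hcurry_rightAct (R : A →ₐ[k] Module.End k M) {m : ℕ} (b c : A)
    (Φ : HCochain k A M (m + 1)) :
    hcurry (rightAct R (m + 1) b Φ) c = hcurry Φ (b * c) - rightAct R m c (hcurry Φ b) := by
  simp [rightAct]

lemma rightAct_rightAct (R : A →ₐ[k] Module.End k M) {m : ℕ} (b c : A) (Φ : HCochain k A M m) :
    rightAct R m c (rightAct R m b Φ) = rightAct R m (b * c) Φ := by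
  induction m generalizing b c with
  | zero => ext; simp [rightAct_zero, hmap_apply, mul_comm b c]
  | succ m ih =>
    refine hcurry_ext fun x => ?_
    simp only [hcurry_rightAct, map_sub, ih, mul_assoc]
    abel

lemma rightAct_hmap {R : A →ₐ[k] Module.End k M} {R' : A →ₐ[k] Module.End k N}
    {f : M →ₗ[k] N} (hf : ∀ a x, f (R a x) = R' a (f x)) {m : ℕ} (a : A)
    (Φ : HCochain k A M m) :
    rightAct R' m a (hmap f m Φ) = hmap f m (rightAct R m a Φ) := by
  induction m generalizing a with
  | zero => ext; simp [rightAct_zero, hmap_apply, hf]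
  | succ m ih =>
    refine hcurry_ext fun x => ?_
    simp only [hcurry_rightAct, hcurry_hmap, map_sub, ih]

lemma hmap_hmap {P : Type} [AddCommGroup P] [Module k P] (g : N →ₗ[k] P) (f : M →ₗ[k] N) {m : ℕ}
    (Φ : HCochain k A M m) : hmap g m (hmap f m Φ) = hmap (g ∘ₗ f) m Φ := rfl

/-- The Hochschild coboundary with values in the bimodule given by the left action `L` and the
right action `R`. -/
def hd (L R : A →ₐ[k] Module.End k M) (m : ℕ) :
    HCochain k A M m →ₗ[k] HCochain k A M (m + 1) where
  toFun Φ := hcurry.symm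
    { toFun := fun a => hmap (L a) m Φ - rightAct R m a Φ
      map_add' := fun a b => by
        ext v
        simp only [_root_.sub_apply, _root_.add_apply, hmap_apply, map_add,
          LinearMap.add_apply]
        abel
      map_smul' := fun c a => by
        ext v
        simp only [_root_.sub_apply, _root_.smul_apply, hmap_apply, map_smul,
          LinearMap.smul_apply, RingHom.id_apply, smul_sub] }
  map_add' Φ Ψ := by
    rw [← map_add]; congr 1; ext1 a
    simp only [LinearMap.add_apply, LinearMap.coe_mk, AddHom.coe_mk, map_add]
    abel
  map_smul' c Φ := by
    rw [RingHom.id_apply, ← map_smul]; congr 1; ext1 a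
    simp only [LinearMap.smul_apply, LinearMap.coe_mk, AddHom.coe_mk, map_smul, smul_sub]

lemma hcurry_hd (L R : A →ₐ[k] Module.End k M) {m : ℕ} (Φ : HCochain k A M m) (a : A) :
    hcurry (hd L R m Φ) a = hmap (L a) m Φ - rightAct R m a Φ := by
  simp [hd]

lemma hd_hmap {L R : A →ₐ[k] Module.End k M} {L' R' : A →ₐ[k] Module.End k N}
    {f : M →ₗ[k] N} (hL : ∀ a x, f (L a x) = L' a (f x)) (hR : ∀ a x, f (R a x) = R' a (f x))
    {m : ℕ} (Φ : HCochain k A M m) :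
    hd L' R' m (hmap f m Φ) = hmap f (m + 1) (hd L R m Φ) := by
  refine hcurry_ext fun x => ?_
  rw [hcurry_hd, hcurry_hmap, hcurry_hd, rightAct_hmap hR, map_sub]
  congr 1
  ext v
  simp [hmap_apply, hL]

lemma hd_hd {L R : A →ₐ[k] Module.End k M} (hLR : ∀ a b x, L a (R b x) = R b (L a x)) {m : ℕ}
    (Φ : HCochain k A M m) : hd L R (m + 1) (hd L R m Φ) = 0 := by
  refine hcurry_ext fun a => hcurry_ext fun b => ?_
  rw [hcurry_hd, map_sub, LinearMap.sub_apply, hcurry_hmap, hcurry_rightAct]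
  simp only [hcurry_hd, map_sub, hmap_hmap, rightAct_rightAct,
    rightAct_hmap (fun b x => hLR a b x), map_mul]
  simp [Module.End.mul_eq_comp]

/-- Signed sum over all ways of inserting `t` as an argument. -/
def insertArg (t : A) : (m : ℕ) → HCochain k A M (m + 1) →ₗ[k] HCochain k A M m
  | 0 => LinearMap.applyₗ t ∘ₗ hcurry.toLinearMap
  | m + 1 => LinearMap.applyₗ t ∘ₗ hcurry.toLinearMap -
      hcurry.symm.toLinearMap ∘ₗ LinearMap.llcomp k A _ _ (insertArg t m) ∘ₗ hcurry.toLinearMap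

lemma insertArg_zero (t : A) (Φ : HCochain k A M 1) : insertArg t 0 Φ = hcurry Φ t := rfl

lemma hcurry_insertArg (t : A) {m : ℕ} (Φ : HCochain k A M (m + 2)) (a : A) :
    hcurry (insertArg t (m + 1) Φ) a =
      hcurry (hcurry Φ t) a - insertArg t m (hcurry Φ a) := by
  simp [insertArg]

lemma insertArg_hmap (f : M →ₗ[k] N) (t : A) {m : ℕ} (Φ : HCochain k A M (m + 1)) :
    insertArg t m (hmap f (m + 1) Φ) = hmap f m (insertArg t m Φ) := by
  induction m with
  | zero => rfl
  | succ m ih =>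
    refine hcurry_ext fun x => ?_
    simp only [hcurry_insertArg, hcurry_hmap, map_sub, ih]

lemma rightAct_insertArg_sub (R : A →ₐ[k] Module.End k M) (t a : A) {m : ℕ}
    (Φ : HCochain k A M (m + 1)) :
    rightAct R m a (insertArg t m Φ) - insertArg t m (rightAct R (m + 1) a Φ) =
      hmap (R t) m (hcurry Φ a) - hcurry (rightAct R (m + 1) t Φ) a := by
  induction m generalizing a with
  | zero =>
    simp only [insertArg_zero, hcurry_rightAct, rightAct_zero, mul_comm a t]
    abel
  | succ m ih =>
    refine hcurry_ext fun c => ?_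
    have h := ih c (Φ := hcurry Φ a)
    simp only [map_sub, LinearMap.sub_apply, hcurry_rightAct, hcurry_insertArg, hcurry_hmap,
      mul_comm a t]
    simp only [hcurry_rightAct] at h ⊢
    rw [← sub_eq_zero] at h ⊢
    rw [← h]
    abel

lemma insertArg_hd_zero (L R : A →ₐ[k] Module.End k M) (t : A) (Φ : HCochain k A M 0) :
    insertArg t 0 (hd L R 0 Φ) = hmap (L t - R t) 0 Φ := by
  rw [insertArg_zero, hcurry_hd]; rfl

lemma insertArg_hd_succ (L R : A →ₐ[k] Module.End k M) (t : A) {m : ℕ}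
    (Φ : HCochain k A M (m + 1)) :
    insertArg t (m + 1) (hd L R (m + 1) Φ) =
      hmap (L t - R t) (m + 1) Φ - hd L R m (insertArg t m Φ) := by
  refine hcurry_ext fun a => ?_
  have h := rightAct_insertArg_sub R t a Φ
  rw [map_sub, LinearMap.sub_apply, hcurry_hmap]
  simp only [hcurry_insertArg, hcurry_hd, map_sub, hcurry_hmap, insertArg_hmap,
    LinearMap.sub_apply]
  have h2 : hmap (L t - R t) m (hcurry Φ a) =
    hmap (L t) m (hcurry Φ a) - hmap (R t) m (hcurry Φ a) := rfl
  rw [h2]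
  rw [← sub_eq_zero] at h ⊢
  rw [← neg_eq_zero, ← h]
  abel

end Cochains

section Koszul

variable {k A M N ι : Type} [Field k] [CommRing A] [Algebra k A] [AddCommGroup M] [Module k M]
  [AddCommGroup N] [Module k N]

/-- The Koszul differential of a family of endomorphisms, on functions of lists of indices. -/
def koszulD (D : ι → Module.End k M) : (List ι → M) → List ι → M
  | _, [] => 0
  | f, j :: l => D j (f l) - koszulD D (fun l' => f (j :: l')) l

lemma koszulD_zero (D : ι → Module.End k M) (l : List ι) : koszulD D (fun _ => 0) l = 0 := by
  induction l with
  | nil => rfl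
  | cons j l ih => simp [koszulD, ih]

lemma koszulD_of_eq_zero {D : ι → Module.End k M} (hD : ∀ i, D i = 0) (f : List ι → M)
    (l : List ι) : koszulD D f l = 0 := by
  induction l generalizing f with
  | nil => rfl
  | cons j l ih => simp [koszulD, ih, hD]

lemma koszulD_sub (D : ι → Module.End k M) (f g : List ι → M) (l : List ι) :
    koszulD D (fun l => f l - g l) l = koszulD D f l - koszulD D g l := by
  induction l generalizing f g with
  | nil => simp [koszulD]
  | cons j l ih => simp only [koszulD, ih, map_sub]; abel

lemma koszulD_map {D : ι → Module.End k M} {D' : ι → Module.End k N} {e : M →ₗ[k] N}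
    (he : ∀ i x, e (D i x) = D' i (e x)) (f : List ι → M) (l : List ι) :
    koszulD D' (fun l => e (f l)) l = e (koszulD D f l) := by
  induction l generalizing f with
  | nil => simp [koszulD]
  | cons j l ih => simp only [koszulD, ih, map_sub, he]

lemma koszulD_congr (D : ι → Module.End k M) {f g : List ι → M} {l : List ι}
    (h : ∀ l', l'.Sublist l → f l' = g l') : koszulD D f l = koszulD D g l := by
  induction l generalizing f g with
  | nil => rfl
  | cons j l ih =>
    rw [koszulD, koszulD, h l (List.sublist_cons_self j l),
      ih fun l' hl' => h _ (hl'.cons_cons j)]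

/-- Exactness of the Koszul complex in positive degrees, for families of endomorphisms each of
which is surjective on the joint kernels of the others. -/
lemma exists_koszulD_eq [LinearOrder ι] {D : ι → Module.End k M}
    (hcomm : ∀ i j x, D i (D j x) = D j (D i x))
    (hsurj : ∀ (s : Finset ι) (j : ι), j ∉ s → ∀ z, (∀ i ∈ s, D i z = 0) →
      ∃ w, (∀ i ∈ s, D i w = 0) ∧ D j w = z)
    (s : Finset ι) (f : List ι → M)
    (hf : ∀ l : List ι, l.Pairwise (· < ·) → (∀ i ∈ l, i ∈ s) → koszulD D f l = 0) :
    ∃ g : List ι → M, ∀ l : List ι, l ≠ [] → l.Pairwise (· < ·) → (∀ i ∈ l, i ∈ s) →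
      f l = koszulD D g l := by
  induction s using Finset.induction_on_min generalizing f with
  | empty =>
    refine ⟨f, fun l hl _ hs => ?_⟩
    obtain ⟨i, hi⟩ := List.exists_mem_of_ne_nil l hl
    simpa using hs i hi
  | insert j s hjs ih =>
    have hj : j ∉ s := fun h => lt_irrefl _ (hjs j h)
    have mem_cons {l : List ι} (hl : ∀ i ∈ l, i ∈ s) : ∀ i ∈ j :: l, i ∈ insert j s := by
      simpa using fun i hi => Or.inr (hl i hi)
    have pw_cons {l : List ι} (hp : l.Pairwise (· < ·)) (hl : ∀ i ∈ l, i ∈ s) :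
        (j :: l).Pairwise (· < ·) :=
      List.pairwise_cons.2 ⟨fun i hi => hjs i (hl i hi), hp⟩
    obtain ⟨g₀, hg₀⟩ := ih f fun l hp hl => hf l hp fun i hi => Finset.mem_insert_of_mem (hl i hi)
    let h : List ι → M := fun l => D j (g₀ l) - f (j :: l)
    have hh (l : List ι) (hp : l.Pairwise (· < ·)) (hl : ∀ i ∈ l, i ∈ s) :
        koszulD D h l = 0 := by
      rcases eq_or_ne l [] with rfl | hne
      · rfl
      · rw [koszulD_sub, koszulD_map (fun i x => (hcomm i j x).symm), ← hg₀ l hne hp hl]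
        exact hf (j :: l) (pw_cons hp hl) (mem_cons hl)
    obtain ⟨g₁, hg₁⟩ := ih h hh
    obtain ⟨w, hw, hwj⟩ := hsurj s j hj (h []) fun i hi => by
      have := hh [i] (List.pairwise_singleton _ _) (by simpa using hi)
      simpa [koszulD] using this
    let g₂ : List ι → M := fun l => g₀ l - if l = [] then w else 0
    have hg₂ (l : List ι) (hl : ∀ i ∈ l, i ∈ s) : koszulD D g₂ l = koszulD D g₀ l := by
      rw [koszulD_sub, sub_eq_self]
      cases l with
      | nil => rfl
      | cons i l =>
        have : D i w = 0 := hw i (hl i List.mem_cons_self)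
        simp only [koszulD, reduceCtorEq, if_false, koszulD_zero]
        split_ifs <;> simp [this]
    let g : List ι → M := fun l => match l with
      | [] => g₂ []
      | i :: l => if i = j then g₁ l else g₂ (i :: l)
    have hg (l : List ι) (hl : ∀ i ∈ l, i ∈ s) : g l = g₂ l := by
      cases l with
      | nil => rfl
      | cons i l => exact if_neg fun hij : i = j => hj (hij ▸ hl i List.mem_cons_self)
    have hgj (l : List ι) : g (j :: l) = g₁ l := if_pos rfl
    refine ⟨g, fun l hne hp hl => ?_⟩
    by_cases hjl : ∀ i ∈ l, i ∈ s
    · rw [koszulD_congr D fun l' hl' => hg l' fun i hi => hjl i (hl'.subset hi), hg₂ l hjl,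
        hg₀ l hne hp hjl]
    · obtain ⟨l, rfl⟩ : ∃ l', l = j :: l' := by
        cases l with
        | nil => exact absurd rfl hne
        | cons i l =>
          refine ⟨l, ?_⟩
          rw [List.pairwise_cons] at hp
          by_contra hij
          have hi : i ∈ s := by
            have := hl i List.mem_cons_self
            rw [Finset.mem_insert] at this
            exact this.resolve_left fun e => hij (by rw [e])
          refine hjl fun i' hi' => ?_
          rcases List.mem_cons.1 hi' with rfl | h'
          · exact hi
          · refine (Finset.mem_insert.1 (hl i' hi')).resolve_left fun e => ?_
            exact lt_asymm (hjs i hi) (e ▸ hp.1 i' h')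
      rw [List.pairwise_cons] at hp
      have hls : ∀ i ∈ l, i ∈ s := fun i hi =>
        (Finset.mem_insert.1 (hl i (List.mem_cons_of_mem _ hi))).resolve_left (hp.1 i hi).ne'
      rw [koszulD, hg l hls]
      simp only [hgj]
      rcases eq_or_ne l [] with rfl | hne'
      · simp [g₂, koszulD, hwj, h]
      · rw [← hg₁ l hne' hp.2 hls]
        simp [g₂, h, hne']

/-- The antisymmetrised values of a cochain on the elements `x i`. -/
def hsymbol (x : ι → A) : (m : ℕ) → HCochain k A M m → List ι → M
  | 0, Φ, [] => Φ Fin.elim0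
  | 0, _, _ :: _ => 0
  | _ + 1, _, [] => 0
  | m + 1, Φ, j :: l => hsymbol x m (insertArg (x j) m Φ) l

lemma hsymbol_hmap (x : ι → A) (f : M →ₗ[k] N) {m : ℕ} (Φ : HCochain k A M m) (l : List ι) :
    hsymbol x m (hmap f m Φ) l = f (hsymbol x m Φ l) := by
  induction l generalizing m with
  | nil => cases m <;> simp [hsymbol, hmap_apply]
  | cons j l ih => cases m <;> simp [hsymbol, insertArg_hmap, ih]

lemma hsymbol_sub (x : ι → A) {m : ℕ} (Φ Ψ : HCochain k A M m) (l : List ι) :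
    hsymbol x m (Φ - Ψ) l = hsymbol x m Φ l - hsymbol x m Ψ l := by
  induction l generalizing m with
  | nil => cases m <;> simp [hsymbol]
  | cons j l ih => cases m <;> simp [hsymbol, ih]

lemma hsymbol_hd (L R : A →ₐ[k] Module.End k M) (x : ι → A) {m : ℕ} (Φ : HCochain k A M m)
    (l : List ι) :
    hsymbol x (m + 1) (hd L R m Φ) l =
      koszulD (fun i => L (x i) - R (x i)) (hsymbol x m Φ) l := by
  induction l generalizing m with
  | nil => rfl
  | cons j l ih =>
    cases m with
    | zero =>
      simp only [hsymbol, koszulD, insertArg_hd_zero, hsymbol_hmap, koszulD_zero, sub_zero]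
    | succ m =>
      simp only [hsymbol, koszulD, insertArg_hd_succ, hsymbol_sub, hsymbol_hmap, ih]

end Koszul

section Coinduced

variable {k A M : Type} [Field k] [CommRing A] [Algebra k A] [AddCommGroup M] [Module k M]

/-- The left action on the coinduced bimodule `A →ₗ[k] M`. -/
def coindLeft (k A M : Type) [Field k] [CommRing A] [Algebra k A] [AddCommGroup M] [Module k M] :
    A →ₐ[k] Module.End k (A →ₗ[k] M) where
  toFun a := LinearMap.lcomp k M (LinearMap.mulLeft k a)
  map_one' := by ext; simp
  map_mul' a b := by ext φ c; simp [mul_left_comm]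
  map_zero' := by ext; simp
  map_add' a b := by ext; simp [add_mul]
  commutes' c := by
    ext φ x
    simp [Algebra.algebraMap_eq_smul_one]

/-- The right action on the coinduced bimodule `A →ₗ[k] M`. -/
def coindRight (R : A →ₐ[k] Module.End k M) : A →ₐ[k] Module.End k (A →ₗ[k] M) where
  toFun a := LinearMap.llcomp k A M M (R a)
  map_one' := by ext; simp
  map_mul' a b := by ext; simp
  map_zero' := by ext; simp
  map_add' a b := by ext; simp
  commutes' c := by ext; simp [Algebra.algebraMap_eq_smul_one]

lemma coindLeft_apply (a c : A) (φ : A →ₗ[k] M) : coindLeft k A M a φ c = φ (a * c) := rfl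

lemma coindRight_apply (R : A →ₐ[k] Module.End k M) (a c : A) (φ : A →ₗ[k] M) :
    coindRight R a φ c = R a (φ c) := rfl

/-- The embedding of a bimodule in the coinduced one. -/
def toCoind (L : A →ₐ[k] Module.End k M) : M →ₗ[k] (A →ₗ[k] M) := L.toLinearMap.flip

lemma toCoind_apply (L : A →ₐ[k] Module.End k M) (x : M) (c : A) : toCoind L x c = L c x := rfl

/-- A cochain with `m + 1` arguments, as a cochain with `m` arguments and values in the
coinduced bimodule. -/
def hflip {m : ℕ} (Φ : HCochain k A M (m + 1)) : HCochain k A (A →ₗ[k] M) m where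
  toFun v :=
    { toFun := fun c => hcurry Φ c v
      map_add' := by simp
      map_smul' := by simp }
  map_update_add' v i x y := by ext; simp
  map_update_smul' v i c x := by ext; simp

lemma hmap_hflip {m : ℕ} (Φ : HCochain k A M (m + 1)) (c : A) :
    hmap (LinearMap.applyₗ c) m (hflip Φ) = hcurry Φ c := rfl

lemma hmap_applyₗ_ext {m : ℕ} {Φ Ψ : HCochain k A (A →ₗ[k] M) m}
    (h : ∀ c, hmap (LinearMap.applyₗ c) m Φ = hmap (LinearMap.applyₗ c) m Ψ) : Φ = Ψ := by
  ext v c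
  exact DFunLike.congr_fun (h c) v

lemma hd_hflip {L R : A →ₐ[k] Module.End k M} {m : ℕ} {Φ : HCochain k A M (m + 1)}
    (hΦ : hd L R (m + 1) Φ = 0) :
    hd (coindLeft k A M) (coindRight R) m (hflip Φ) = hmap (toCoind L) (m + 1) Φ := by
  refine hcurry_ext fun a => hmap_applyₗ_ext fun c => ?_
  have h : hcurry (hcurry (hd L R (m + 1) Φ) c) a = 0 := by simp [hΦ]
  rw [hcurry_hd, map_sub, LinearMap.sub_apply, hcurry_rightAct, hcurry_hmap, sub_eq_zero] at h
  rw [hcurry_hd, map_sub, ← rightAct_hmap (R' := R) (fun _ _ => rfl), hcurry_hmap, hmap_hflip,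
    hmap_hmap, hmap_hmap]
  have h1 : (LinearMap.applyₗ c : (A →ₗ[k] M) →ₗ[k] M) ∘ₗ toCoind L = L c := rfl
  have h2 : (LinearMap.applyₗ c : (A →ₗ[k] M) →ₗ[k] M) ∘ₗ coindLeft k A M a =
      LinearMap.applyₗ (a * c) := rfl
  rw [h1, h2, hmap_hflip, h, mul_comm]

/-- The action induced on a quotient by an invariant subspace. -/
def quotAct (T : A →ₐ[k] Module.End k M) (S : Submodule k M) (hS : ∀ a, S ≤ S.comap (T a)) :
    A →ₐ[k] Module.End k (M ⧸ S) where
  toFun a := S.mapQ S (T a) (hS a)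
  map_one' := by ext; simp
  map_mul' a b := by ext; simp
  map_zero' := by ext; simp
  map_add' a b := by ext; simp
  commutes' c := by ext; simp [Algebra.algebraMap_eq_smul_one]

lemma quotAct_mk (T : A →ₐ[k] Module.End k M) (S : Submodule k M) (hS : ∀ a, S ≤ S.comap (T a))
    (a : A) (x : M) : quotAct T S hS a (S.mkQ x) = S.mkQ (T a x) := rfl

end Coinduced

section Polynomial

variable {k σ M : Type} [Field k] [AddCommGroup M] [Module k M]

open MvPolynomial

/-- A primitive of `z` for the difference of the two actions of `X j` on the coinduced
bimodule. -/
noncomputable def coindPrimitive (R : MvPolynomial σ k →ₐ[k] Module.End k M) (j : σ)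
    (z : MvPolynomial σ k →ₗ[k] M) : MvPolynomial σ k →ₗ[k] M :=
  (basisMonomials σ k).constr k fun n =>
    ∑ s ∈ Finset.range (n j), R (X j ^ (n j - 1 - s)) (z (monomial (n.update j s) 1))

lemma coindPrimitive_monomial (R : MvPolynomial σ k →ₐ[k] Module.End k M) (j : σ)
    (z : MvPolynomial σ k →ₗ[k] M) (n : σ →₀ ℕ) :
    coindPrimitive R j z (monomial n 1) =
      ∑ s ∈ Finset.range (n j), R (X j ^ (n j - 1 - s)) (z (monomial (n.update j s) 1)) := by
  have h := (basisMonomials σ k).constr_basis k (fun n : σ →₀ ℕ =>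
    ∑ s ∈ Finset.range (n j), R (X j ^ (n j - 1 - s)) (z (monomial (n.update j s) 1))) n
  rwa [coe_basisMonomials] at h

lemma coind_sub_apply_monomial (R : MvPolynomial σ k →ₐ[k] Module.End k M) (i : σ)
    (φ : MvPolynomial σ k →ₗ[k] M) (n : σ →₀ ℕ) :
    (coindLeft k (MvPolynomial σ k) M (X i) - coindRight R (X i)) φ (monomial n 1) =
      φ (monomial (n + Finsupp.single i 1) 1) - R (X i) (φ (monomial n 1)) := by
  rw [LinearMap.sub_apply, LinearMap.sub_apply, coindLeft_apply, coindRight_apply, X,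
    monomial_mul, one_mul, add_comm]

lemma exists_coind_primitive (R : MvPolynomial σ k →ₐ[k] Module.End k M) (s : Finset σ) {j : σ}
    (hj : j ∉ s) (z : MvPolynomial σ k →ₗ[k] M)
    (hz : ∀ i ∈ s, (coindLeft k (MvPolynomial σ k) M (X i) - coindRight R (X i)) z = 0) :
    ∃ w, (∀ i ∈ s, (coindLeft k (MvPolynomial σ k) M (X i) - coindRight R (X i)) w = 0) ∧
      (coindLeft k (MvPolynomial σ k) M (X j) - coindRight R (X j)) w = z := by
  classical
  refine ⟨coindPrimitive R j z, fun i hi => ?_, ?_⟩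
  · refine (basisMonomials σ k).ext fun n => ?_
    have hij : i ≠ j := fun h => hj (h ▸ hi)
    have hz' (n' : σ →₀ ℕ) : z (monomial (n' + Finsupp.single i 1) 1) =
        R (X i) (z (monomial n' 1)) := by
      rw [← sub_eq_zero, ← coind_sub_apply_monomial, hz i hi, LinearMap.zero_apply]
    have hn : (n + Finsupp.single i 1 : σ →₀ ℕ) j = n j := by simp [hij]
    have hu (t : ℕ) : (n + Finsupp.single i 1 : σ →₀ ℕ).update j t =
        n.update j t + Finsupp.single i 1 := by
      ext x
      rcases eq_or_ne x j with rfl | hx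
      · simp [hij]
      · simp [Finsupp.update, Function.update, hx]
    rw [coe_basisMonomials, coind_sub_apply_monomial, coindPrimitive_monomial,
      coindPrimitive_monomial, hn, map_sum, LinearMap.zero_apply, sub_eq_zero]
    refine Finset.sum_congr rfl fun t _ => ?_
    rw [hu, hz', ← Module.End.mul_apply, ← Module.End.mul_apply, ← map_mul, ← map_mul, mul_comm]
  · refine (basisMonomials σ k).ext fun n => ?_
    have hn : (n + Finsupp.single j 1 : σ →₀ ℕ) j = n j + 1 := by simp
    have hu (t : ℕ) : (n + Finsupp.single j 1 : σ →₀ ℕ).update j t = n.update j t := by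
      ext x
      rcases eq_or_ne x j with rfl | hx
      · simp
      · simp [Finsupp.update, Function.update, hx]
    rw [coe_basisMonomials, coind_sub_apply_monomial, coindPrimitive_monomial,
      coindPrimitive_monomial, hn, map_sum, Finset.sum_range_succ]
    simp only [hu]
    rw [Finsupp.update_self, Nat.add_sub_cancel, Nat.sub_self, pow_zero, map_one,
      Module.End.one_apply, add_sub_right_comm, add_eq_right, sub_eq_zero]
    refine Finset.sum_congr rfl fun t ht => ?_
    rw [← Module.End.mul_apply, ← map_mul, ← pow_succ']
    congr 4
    have := Finset.mem_range.1 ht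
    omega

lemma eq_zero_of_hd_eq_zero {L R : MvPolynomial σ k →ₐ[k] Module.End k M}
    {Φ : HCochain k (MvPolynomial σ k) M 1} (hΦ : hd L R 1 Φ = 0)
    (hX : ∀ i, hcurry Φ (X i) = 0) : Φ = 0 := by
  have hder (a b : MvPolynomial σ k) : hcurry Φ (a * b) =
      hmap (L a) 0 (hcurry Φ b) + hmap (R b) 0 (hcurry Φ a) := by
    have h : hcurry (hcurry (hd L R 1 Φ) a) b = 0 := by simp [hΦ]
    rw [hcurry_hd, map_sub, LinearMap.sub_apply, hcurry_rightAct, hcurry_hmap, rightAct_zero] at h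
    rw [← sub_eq_zero, ← neg_eq_zero, ← h]
    abel
  have h1 : hcurry Φ 1 = 0 := by
    have h := hder 1 1
    have e (Ψ : HCochain k (MvPolynomial σ k) M 0) : hmap 1 0 Ψ = Ψ := rfl
    rw [mul_one, map_one L, map_one R, e] at h
    simpa using h
  refine hcurry_ext fun p => ?_
  rw [map_zero, LinearMap.zero_apply]
  induction p using MvPolynomial.induction_on with
  | C a => rw [← mul_one (C a), ← smul_eq_C_mul, map_smul, h1, smul_zero]
  | add p q hp hq => rw [map_add, hp, hq, add_zero]
  | mul_X p i hp => rw [hder, hp, hX, map_zero, map_zero, add_zero]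

/-- A Hochschild cocycle whose symbol is a Koszul coboundary is a coboundary. -/
theorem exists_eq_hd [Fintype σ] [LinearOrder σ] (m : ℕ) :
    ∀ (M : Type) [AddCommGroup M] [Module k M] (L R : MvPolynomial σ k →ₐ[k] Module.End k M),
      (∀ a b x, L a (R b x) = R b (L a x)) → ∀ Φ : HCochain k (MvPolynomial σ k) M (m + 1),
      hd L R (m + 1) Φ = 0 → ∀ κ : List σ → M,
      (∀ l : List σ, l.Pairwise (· < ·) →
        hsymbol X (m + 1) Φ l = koszulD (fun i => L (X i) - R (X i)) κ l) →
      ∃ Ψ, Φ = hd L R m Ψ := by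
  induction m with
  | zero =>
    intro M _ _ L R hLR Φ hΦ κ hκ
    let Ψ : HCochain k (MvPolynomial σ k) M 0 := MultilinearMap.constOfIsEmpty k _ (κ [])
    refine ⟨Ψ, sub_eq_zero.1 <| eq_zero_of_hd_eq_zero (L := L) (R := R) ?_ fun i => ?_⟩
    · rw [map_sub, hΦ, hd_hd hLR, sub_zero]
    · have h := hκ [i] (List.pairwise_singleton _ _)
      ext v
      rw [Subsingleton.elim v Fin.elim0, map_sub, LinearMap.sub_apply, hcurry_hd, rightAct_zero]
      simp only [hsymbol, koszulD, insertArg_zero, sub_zero] at h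
      rw [_root_.sub_apply, h]
      simp [Ψ, hmap_apply]
  | succ m ih =>
    intro M _ _ L R hLR Φ hΦ κ hκ
    set i := toCoind L
    set LE := coindLeft k (MvPolynomial σ k) M
    set RE := coindRight R
    have hLRE (a b x) : LE a (RE b x) = RE b (LE a x) := rfl
    have hLL (a b x) : LE a (LE b x) = LE b (LE a x) := by
      rw [← Module.End.mul_apply, ← map_mul, mul_comm, map_mul, Module.End.mul_apply]
    have hRR (a b x) : RE a (RE b x) = RE b (RE a x) := by
      rw [← Module.End.mul_apply, ← map_mul, mul_comm, map_mul, Module.End.mul_apply]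
    have hiL (a x) : i (L a x) = LE a (i x) := by
      refine LinearMap.ext fun c => ?_
      simp [i, LE, toCoind_apply, coindLeft_apply, mul_comm a c]
    have hiR (a x) : i (R a x) = RE a (i x) := by
      refine LinearMap.ext fun c => ?_
      simp [i, RE, toCoind_apply, coindRight_apply, hLR]
    let ρ : (MvPolynomial σ k →ₗ[k] M) →ₗ[k] M := LinearMap.applyₗ 1
    have hρ (x) : ρ (i x) = x := by simp [ρ, i, toCoind_apply]
    let S := LinearMap.range i
    let π := S.mkQ
    have hSL (a) : S ≤ S.comap (LE a) := by rintro _ ⟨x, rfl⟩; exact ⟨L a x, hiL a x⟩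
    have hSR (a) : S ≤ S.comap (RE a) := by rintro _ ⟨x, rfl⟩; exact ⟨R a x, hiR a x⟩
    let LQ := quotAct LE S hSL
    let RQ := quotAct RE S hSR
    have hLRQ (a b x) : LQ a (RQ b x) = RQ b (LQ a x) := by
      obtain ⟨x, rfl⟩ := S.mkQ_surjective x
      rw [quotAct_mk, quotAct_mk, quotAct_mk, quotAct_mk, hLRE]
    have hπi (x) : π (i x) = 0 := (Submodule.Quotient.mk_eq_zero S).2 ⟨x, rfl⟩
    have hπi' (n : ℕ) (Θ : HCochain k (MvPolynomial σ k) M n) : hmap π n (hmap i n Θ) = 0 := by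
      ext v
      exact hπi _
    let Ψ := hflip Φ
    have hΨ : hd LE RE (m + 1) Ψ = hmap i (m + 2) Φ := hd_hflip hΦ
    obtain ⟨g, hg⟩ := exists_koszulD_eq (D := fun j => LE (X j) - RE (X j))
      (fun a b x => by
        simp only [LinearMap.sub_apply, map_sub, hLRE]
        rw [hLL (X a), hRR (X a)]
        abel)
      (fun s j hj z hz => exists_coind_primitive R s hj z hz) Finset.univ
      (fun l => hsymbol X (m + 1) Ψ l - i (κ l)) fun l hl _ => by
        rw [koszulD_sub, ← hsymbol_hd, hΨ, hsymbol_hmap, hκ l hl, sub_eq_zero]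
        exact (koszulD_map (fun j x => by simp [hiL, hiR]) κ l).symm
    obtain ⟨χ, hχ⟩ := ih _ LQ RQ hLRQ (hmap π (m + 1) Ψ)
      (by rw [hd_hmap (fun _ _ => (quotAct_mk _ _ _ _ _).symm)
            (fun _ _ => (quotAct_mk _ _ _ _ _).symm), hΨ, hπi'])
      (fun l => π (g l)) fun l hl => by
        rw [hsymbol_hmap, koszulD_map (D := fun j => LE (X j) - RE (X j)) (fun j x => rfl)]
        rcases eq_or_ne l [] with rfl | hne
        · simp [hsymbol, koszulD]
        · rw [← hg l hne hl fun _ _ => Finset.mem_univ _, map_sub, hπi, sub_zero]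
    obtain ⟨s, hs⟩ :=
      π.exists_rightInverse_of_surjective (LinearMap.range_eq_top.2 S.mkQ_surjective)
    let χ' := hmap s m χ
    have hχ' : hmap π m χ' = χ := by
      ext v
      exact LinearMap.congr_fun hs _
    let Ω := Ψ - hd LE RE m χ'
    have hΩ : hmap π (m + 1) Ω = 0 := by
      rw [map_sub, ← hd_hmap (L' := LQ) (R' := RQ) (fun _ _ => (quotAct_mk _ _ _ _ _).symm)
        (fun _ _ => (quotAct_mk _ _ _ _ _).symm), hχ', hχ, sub_self]
    let ω := hmap ρ (m + 1) Ω
    have hω : hmap i (m + 1) ω = Ω := by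
      ext1 v
      have hv : π (Ω v) = 0 := DFunLike.congr_fun hΩ v
      obtain ⟨x, hx⟩ := (Submodule.Quotient.mk_eq_zero S).1 hv
      simp only [ω, hmap_apply, ← hx, hρ]
    refine ⟨ω, ?_⟩
    have key : hmap i (m + 2) Φ = hmap i (m + 2) (hd L R (m + 1) ω) := by
      rw [← hd_hmap hiL hiR, hω, map_sub, hd_hd hLRE, sub_zero, hΨ]
    ext v
    have := congrArg ρ (DFunLike.congr_fun key v)
    simpa only [hmap_apply, hρ] using this

end Polynomial

section Bridge

variable {A : Type} [CommRing A] [Algebra ℝ A]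

/-- The Hochschild coboundary for cochains with values in `A` itself. -/
noncomputable def hdSelf (A : Type) [CommRing A] [Algebra ℝ A] (m : ℕ) :
    HCochain ℝ A A m →ₗ[ℝ] HCochain ℝ A A (m + 1) :=
  hd (Algebra.lmul ℝ A) (Algebra.lmul ℝ A) m

lemma evalC_succ {m : ℕ} (Φ : HCochain ℝ A A (m + 1)) (a : ℕ → A) :
    evalC Φ a = evalC (hcurry Φ (a 0)) fun t => a (t + 1) := by
  rw [evalC, evalC, hcurry_apply]
  congr 1
  ext j
  refine Fin.cases ?_ (fun j => ?_) j <;> simp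

lemma evalC_sub {m : ℕ} (Φ Ψ : HCochain ℝ A A m) (a : ℕ → A) :
    evalC (Φ - Ψ) a = evalC Φ a - evalC Ψ a := rfl

lemma evalC_ext {m : ℕ} {Φ Ψ : HCochain ℝ A A m} (h : ∀ a, evalC Φ a = evalC Ψ a) : Φ = Ψ := by
  ext v
  convert h fun j => if hj : j < m then v ⟨j, hj⟩ else 0 using 1 <;> simp [evalC]

lemma evalC_rightAct {m : ℕ} (Φ : HCochain ℝ A A m) (a : ℕ → A) :
    evalC (rightAct (Algebra.lmul ℝ A) m (a 0) Φ) (fun t => a (t + 1)) =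
      (∑ i ∈ Finset.range m, (-1 : ℝ) ^ i • evalC Φ fun j =>
        if j < i then a j else if j = i then a i * a (i + 1) else a (j + 1)) +
      (-1 : ℝ) ^ m • (evalC Φ a * a m) := by
  induction m generalizing a with
  | zero =>
    rw [Finset.range_zero, Finset.sum_empty, zero_add, pow_zero, one_smul, mul_comm,
      rightAct_zero]
    refine congrArg (fun v => a 0 * Φ v) (Subsingleton.elim _ _)
  | succ m ih =>
    rw [evalC_succ, hcurry_rightAct, evalC_sub, ih (hcurry Φ (a 0)) fun t => a (t + 1),
      Finset.sum_range_succ', evalC_succ Φ a]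
    have h0 : (evalC Φ fun j => if j < 0 then a j else if j = 0 then a 0 * a (0 + 1)
        else a (j + 1)) = evalC (hcurry Φ (a 0 * a (0 + 1))) fun t => a (t + 1 + 1) := by
      rw [evalC_succ]; simp
    have h1 (i : ℕ) : (evalC Φ fun j => if j < i + 1 then a j else if j = i + 1 then
        a (i + 1) * a (i + 1 + 1) else a (j + 1)) = evalC (hcurry Φ (a 0)) fun j =>
        if j < i then a (j + 1) else if j = i then a (i + 1) * a (i + 1 + 1)
          else a (j + 1 + 1) := by
      rw [evalC_succ]; simp
    simp only [h0, h1, pow_succ, mul_neg, mul_one, neg_smul, Finset.sum_neg_distrib, pow_zero,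
      one_smul]
    abel

lemma gbrM_mulC_s9 {m : ℕ} (Φ : HCochain ℝ A A m) (a : ℕ → A) :
    gbrM 2 m (mulC A) (evalC Φ) a = -(-1 : ℝ) ^ m • evalC (hdSelf A m Φ) a := by
  have hs : (-1 : ℝ) ^ ((m : ℤ) - 1) = -(-1 : ℝ) ^ m := by
    rw [zpow_sub_one₀ (by norm_num), zpow_natCast]; norm_num
  have hsq : (-1 : ℝ) ^ m * (-1 : ℝ) ^ m = 1 := by
    rw [← mul_pow]; norm_num
  have h1 : ((2 : ℕ) : ℤ) - 1 = 1 := by norm_num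
  rw [evalC_succ, hdSelf, hcurry_hd, evalC_sub, evalC_rightAct]
  have hL : evalC (hmap (Algebra.lmul ℝ A (a 0)) m Φ) (fun t => a (t + 1)) =
    a 0 * evalC Φ fun t => a (t + 1) := rfl
  rw [hL, gbrM, gcompM, gcompM]
  simp only [h1, one_mul, mul_one, zpow_natCast, Finset.sum_range_succ, Finset.range_zero,
    Finset.sum_empty, zero_add, Nat.cast_zero, zero_mul, zpow_zero, one_smul, Nat.cast_one, hs, mulC]
  simp only [lt_irrefl, if_false, if_true, zero_lt_one, one_ne_zero, not_lt_zero,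
    add_zero, Nat.add_sub_cancel_left, show ∀ j, j + 2 - 1 = j + 1 from fun _ => rfl]
  simp only [smul_sub, smul_add, neg_smul, smul_smul, neg_mul, hsq, one_smul, add_comm 1]
  abel

lemma gbrM_mulC_eq_zero_iff {m : ℕ} (Φ : HCochain ℝ A A m) :
    (∀ a, gbrM 2 m (mulC A) (evalC Φ) a = 0) ↔ hdSelf A m Φ = 0 := by
  refine ⟨fun h => evalC_ext fun a => ?_, fun h a => ?_⟩
  · have := h a
    rw [gbrM_mulC_s9, smul_eq_zero] at this
    exact this.resolve_left (neg_ne_zero.2 (pow_ne_zero _ (by norm_num)))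
  · rw [gbrM_mulC_s9, h]
    exact smul_zero _

lemma isHCoboundary_zero_iff (Φ : HCochain ℝ A A 0) : IsHCoboundary 0 (evalC Φ) ↔ Φ = 0 :=
  ⟨fun h => evalC_ext h, fun h _ => by rw [h]; rfl⟩

lemma isHCoboundary_succ_iff {m : ℕ} (Φ : HCochain ℝ A A (m + 1)) :
    IsHCoboundary (m + 1) (evalC Φ) ↔ ∃ Ψ, Φ = hdSelf A m Ψ := by
  constructor
  · rintro ⟨Ψ, h⟩
    refine ⟨-(-1 : ℝ) ^ m • Ψ, evalC_ext fun a => ?_⟩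
    rw [h, gbrM_mulC_s9, map_smul]
    rfl
  · rintro ⟨Ψ, rfl⟩
    refine ⟨-(-1 : ℝ) ^ m • Ψ, fun a => ?_⟩
    rw [gbrM_mulC_s9, map_smul]
    have h : (-(-1 : ℝ) ^ m) * (-(-1 : ℝ) ^ m) = 1 := by
      rw [neg_mul_neg, ← mul_pow]; norm_num
    change _ = -(-1 : ℝ) ^ m • (-(-1 : ℝ) ^ m • evalC (hdSelf A m Ψ) a)
    rw [smul_smul, h, one_smul]

end Bridge

section Derivations

variable {A : Type} [CommRing A] [Algebra ℝ A]

/-- The cochain `(a₀, …) ↦ u₀(a₀) u₁(a₁) ⋯`. -/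
noncomputable def derivProd (m : ℕ) (u : Fin m → Derivation ℝ A A) : HCochain ℝ A A m :=
  (MultilinearMap.mkPiAlgebra ℝ (Fin m) A).compLinearMap fun i => (u i).toLinearMap

lemma derivProd_apply {m : ℕ} (u : Fin m → Derivation ℝ A A) (v : Fin m → A) :
    derivProd m u v = ∏ i, u i (v i) := rfl

lemma hcurry_derivProd {m : ℕ} (u : Fin (m + 1) → Derivation ℝ A A) (a : A) :
    hcurry (derivProd (m + 1) u) a =
      hmap (Algebra.lmul ℝ A (u 0 a)) m (derivProd m (Fin.tail u)) := by
  ext v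
  rw [hcurry_apply, derivProd_apply, Fin.prod_univ_succ]
  rfl

lemma rightAct_derivProd {m : ℕ} (u : Fin m → Derivation ℝ A A) (b : A) :
    rightAct (Algebra.lmul ℝ A) m b (derivProd m u) =
      hmap (Algebra.lmul ℝ A b) m (derivProd m u) := by
  induction m generalizing b with
  | zero => rfl
  | succ m ih =>
    refine hcurry_ext fun c => ?_
    rw [hcurry_rightAct, hcurry_hmap, hcurry_derivProd, hcurry_derivProd, hcurry_derivProd,
      rightAct_hmap (R := Algebra.lmul ℝ A) fun a x => mul_left_comm _ _ _, ih]
    ext v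
    simp only [_root_.sub_apply, hmap_apply, Derivation.leibniz, Algebra.coe_lmul_eq_mul,
      LinearMap.mul_apply', smul_eq_mul]
    ring

lemma hdSelf_derivProd {m : ℕ} (u : Fin m → Derivation ℝ A A) :
    hdSelf A m (derivProd m u) = 0 := by
  refine hcurry_ext fun a => ?_
  rw [hdSelf, hcurry_hd, rightAct_derivProd, sub_self, map_zero, LinearMap.zero_apply]

lemma hdSelf_smul {m : ℕ} (a : A) (Φ : HCochain ℝ A A m) :
    hdSelf A m (a • Φ) = a • hdSelf A m Φ :=
  hd_hmap (f := Algebra.lmul ℝ A a) (fun _ _ => mul_left_comm _ _ _)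
    (fun _ _ => mul_left_comm _ _ _) Φ

lemma hkrDec_eq (m : ℕ) (u : Fin m → Derivation ℝ A A) :
    hkrDec A m u = (m.factorial : ℝ)⁻¹ •
      ∑ ε : Equiv.Perm (Fin m), ((Equiv.Perm.sign ε : ℤ)) • derivProd m fun i => u (ε i) := rfl

lemma hdSelf_hkrDec {m : ℕ} (u : Fin m → Derivation ℝ A A) : hdSelf A m (hkrDec A m u) = 0 := by
  rw [hkrDec_eq, map_smul, map_sum]
  simp only [map_zsmul, hdSelf_derivProd, smul_zero, Finset.sum_const_zero]

lemma hkrDec_apply {m : ℕ} (u : Fin m → Derivation ℝ A A) (v : Fin m → A) :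
    hkrDec A m u v = (m.factorial : ℝ)⁻¹ • (Matrix.of fun i j => u i (v j)).det := by
  rw [hkrDec_eq, Matrix.det_apply, _root_.smul_apply, _root_.sum_apply]
  simp only [_root_.smul_apply, derivProd_apply, Matrix.of_apply, Units.smul_def]

lemma exteriorPower_induction {R E : Type} [CommRing R] [AddCommGroup E] [Module R E] {m : ℕ}
    {P : (⋀[R]^m E : Submodule R (ExteriorAlgebra R E)) → Prop}
    (hdec : ∀ u, P (wedgeDec R E m u)) (h0 : P 0) (hadd : ∀ x y, P x → P y → P (x + y))
    (hsmul : ∀ (r : R) x, P x → P (r • x)) (x) : P x := by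
  have hx : x ∈ Submodule.span R (Set.range (exteriorPower.ιMulti R m (M := E))) := by
    rw [exteriorPower.ιMulti_span]
    trivial
  induction hx using Submodule.span_induction with
  | mem x h =>
    obtain ⟨u, rfl⟩ := h
    exact hdec u
  | zero => exact h0
  | add x y _ _ hx hy => exact hadd x y hx hy
  | smul r x _ hx => exact hsmul r x hx

end Derivations

section Alternating

variable {k A M ι : Type} [Field k] [CommRing A] [Algebra k A] [AddCommGroup M] [Module k M]

lemma hcurry_alternating {m : ℕ} (f : A [⋀^Fin (m + 1)]→ₗ[k] M) (a : A) :
    hcurry f.toMultilinearMap a = (f.curryLeft a).toMultilinearMap := rfl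

lemma curryLeft_curryLeft_swap {m : ℕ} (f : A [⋀^Fin (m + 2)]→ₗ[k] M) (a b : A) :
    (f.curryLeft a).curryLeft b = -(f.curryLeft b).curryLeft a := by
  have h := f.curryLeft_same (a + b)
  simp only [map_add, AlternatingMap.curryLeft_add, LinearMap.add_apply,
    AlternatingMap.curryLeft_same, zero_add, add_zero] at h
  exact eq_neg_of_add_eq_zero_right h

lemma insertArg_alternating {m : ℕ} (f : A [⋀^Fin (m + 1)]→ₗ[k] M) (t : A) :
    insertArg t m f.toMultilinearMap = (m + 1) • (f.curryLeft t).toMultilinearMap := by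
  induction m with
  | zero => exact (one_smul ℕ _).symm
  | succ m ih =>
    refine hcurry_ext fun a => ?_
    rw [hcurry_insertArg, hcurry_alternating, hcurry_alternating, hcurry_alternating, ih, map_nsmul,
      LinearMap.smul_apply, hcurry_alternating, curryLeft_curryLeft_swap f a t]
    have h : (-(f.curryLeft t).curryLeft a).toMultilinearMap =
      -((f.curryLeft t).curryLeft a).toMultilinearMap := rfl
    rw [h, smul_neg, sub_neg_eq_add, succ_nsmul' _ (m + 1)]

lemma hsymbol_nsmul (x : ι → A) {m : ℕ} (n : ℕ) (Φ : HCochain k A M m) (l : List ι) :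
    hsymbol x m (n • Φ) l = n • hsymbol x m Φ l :=
  hsymbol_hmap x (n • LinearMap.id) Φ l

lemma hsymbol_alternating (x : ι → A) {m : ℕ} (f : A [⋀^Fin m]→ₗ[k] M) (v : Fin m → ι) :
    hsymbol x m f.toMultilinearMap (List.ofFn v) = m.factorial • f (x ∘ v) := by
  induction m with
  | zero =>
    rw [List.ofFn_zero, hsymbol, Nat.factorial_zero, one_smul]
    exact congrArg f (Subsingleton.elim _ _)
  | succ m ih =>
    rw [List.ofFn_succ, hsymbol, insertArg_alternating, hsymbol_nsmul, ih, smul_smul,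
      ← Nat.factorial_succ, AlternatingMap.curryLeft_apply_apply]
    congr 2
    ext j
    refine Fin.cases rfl (fun j => rfl) j

lemma hsymbol_of_length_ne (x : ι → A) {m : ℕ} (Φ : HCochain k A M m) {l : List ι}
    (hl : l.length ≠ m) : hsymbol x m Φ l = 0 := by
  induction l generalizing m with
  | nil =>
    cases m with
    | zero => exact absurd rfl hl
    | succ m => rfl
  | cons j l ih =>
    cases m with
    | zero => rfl
    | succ m => exact ih _ fun h => hl (congrArg (· + 1) h)

end Alternating

section PolynomialDerivations

open MvPolynomial

/-- The basis of the module of derivations of a polynomial ring dual to the variables. -/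
noncomputable def derivBasis (d : ℕ) : Module.Basis (Fin d) (MvPolynomial (Fin d) ℝ)
    (Derivation ℝ (MvPolynomial (Fin d) ℝ) (MvPolynomial (Fin d) ℝ)) :=
  Module.Basis.ofEquivFun
    { toFun := fun D i => D (X i)
      map_add' := fun _ _ => rfl
      map_smul' := fun _ _ => rfl
      invFun := mkDerivation ℝ
      left_inv := fun _ => derivation_ext fun i => mkDerivation_X ℝ _ i
      right_inv := fun f => funext fun i => mkDerivation_X ℝ f i }

end PolynomialDerivations

section HKR

open MvPolynomial Set

/-- The algebra of real polynomials in `d` variables. -/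
abbrev RealPoly (d : ℕ) : Type := MvPolynomial (Fin d) ℝ

/-- The module of polynomial polyvector fields of degree `m`. -/
noncomputable abbrev PolyVector (d m : ℕ) : Submodule (RealPoly d)
    (ExteriorAlgebra (RealPoly d) (Derivation ℝ (RealPoly d) (RealPoly d))) :=
  ⋀[RealPoly d]^m (Derivation ℝ (RealPoly d) (RealPoly d))

lemma hsymbol_eq_zero {d m : ℕ} {Φ : HCochain ℝ (RealPoly d) (RealPoly d) m}
    (h : ∀ J : powersetCard (Fin d) m,
      hsymbol X m Φ (List.ofFn (powersetCard.ofFinEmbEquiv.symm J)) = 0)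
    {l : List (Fin d)} (hl : l.Pairwise (· < ·)) : hsymbol X m Φ l = 0 := by
  by_cases hm : l.length = m
  · subst hm
    have := h (powersetCard.ofFinEmbEquiv
      (OrderEmbedding.ofStrictMono l.get hl.sortedLT.strictMono_get))
    rw [Equiv.symm_apply_apply] at this
    rwa [OrderEmbedding.coe_ofStrictMono, List.ofFn_get] at this
  · exact hsymbol_of_length_ne X Φ hm

variable {d m : ℕ}
  {V : PolyVector d m →ₗ[RealPoly d] HCochain ℝ (RealPoly d) (RealPoly d) m}

lemma hdSelf_hkr (hV : ∀ u, V (wedgeDec (RealPoly d) _ m u) = hkrDec (RealPoly d) m u)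
    (γ : PolyVector d m) : hdSelf (RealPoly d) m (V γ) = 0 := by
  induction γ using exteriorPower_induction with
  | hdec u => rw [hV, hdSelf_hkrDec]
  | h0 => rw [map_zero, map_zero]
  | hadd x y hx hy => rw [map_add, map_add, hx, hy, add_zero]
  | hsmul r x hx => rw [map_smul, hdSelf_smul, hx, smul_zero]

lemma hkr_eq_zero_of_eq (hV : ∀ u, V (wedgeDec (RealPoly d) _ m u) = hkrDec (RealPoly d) m u)
    (γ : PolyVector d m) (v : Fin m → RealPoly d) (i j : Fin m) (hv : v i = v j) (hij : i ≠ j) :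
    V γ v = 0 := by
  induction γ using exteriorPower_induction with
  | hdec u =>
    rw [hV, hkrDec_apply, Matrix.det_zero_of_column_eq hij fun l => ?_, smul_zero]
    simp only [Matrix.of_apply, hv]
  | h0 => rw [map_zero, _root_.zero_apply]
  | hadd x y hx hy => rw [map_add, _root_.add_apply, hx, hy, add_zero]
  | hsmul r x hx => rw [map_smul, _root_.smul_apply, hx, smul_zero]

lemma factorial_smul_hkr_apply
    (hV : ∀ u, V (wedgeDec (RealPoly d) _ m u) = hkrDec (RealPoly d) m u)
    (γ : PolyVector d m) (J : powersetCard (Fin d) m) :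
    m.factorial • V γ (X ∘ powersetCard.ofFinEmbEquiv.symm J) =
      ((derivBasis d).exteriorPower m).repr γ J := by
  rw [exteriorPower.basis_repr_apply]
  induction γ using exteriorPower_induction with
  | hdec u =>
    have hu : wedgeDec (RealPoly d) _ m u = exteriorPower.ιMulti (RealPoly d) m u := rfl
    rw [hV, hkrDec_apply, hu, exteriorPower.ιMultiDual_apply_ιMulti,
      ← Nat.cast_smul_eq_nsmul ℝ, smul_smul,
      mul_inv_cancel₀ (Nat.cast_ne_zero.2 m.factorial_ne_zero), one_smul]
    rfl
  | h0 => rw [map_zero, map_zero, _root_.zero_apply, smul_zero]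
  | hadd x y hx hy => rw [map_add, map_add, _root_.add_apply, smul_add, hx, hy]
  | hsmul r x hx => rw [map_smul, map_smul, _root_.smul_apply, smul_comm, hx]

lemma hsymbol_hkr (hV : ∀ u, V (wedgeDec (RealPoly d) _ m u) = hkrDec (RealPoly d) m u)
    (γ : PolyVector d m) (J : powersetCard (Fin d) m) :
    hsymbol X m (V γ) (List.ofFn (powersetCard.ofFinEmbEquiv.symm J)) =
      ((derivBasis d).exteriorPower m).repr γ J := by
  let f : RealPoly d [⋀^Fin m]→ₗ[ℝ] RealPoly d :=
    { V γ with map_eq_zero_of_eq' := hkr_eq_zero_of_eq hV γ }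
  exact (hsymbol_alternating X f _).trans (factorial_smul_hkr_apply hV γ J)

lemma exists_hkr_isHCoboundary
    (hV : ∀ u, V (wedgeDec (RealPoly d) _ m u) = hkrDec (RealPoly d) m u)
    (Φ : HCochain ℝ (RealPoly d) (RealPoly d) m) (hΦ : hdSelf (RealPoly d) m Φ = 0) :
    ∃ γ, IsHCoboundary m (evalC (Φ - V γ)) := by
  let B := (derivBasis d).exteriorPower m
  let γ := B.equivFun.symm fun J =>
    hsymbol X m Φ (List.ofFn (powersetCard.ofFinEmbEquiv.symm J))
  have hsymb {l : List (Fin d)} (hl : l.Pairwise (· < ·)) : hsymbol X m (Φ - V γ) l = 0 := by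
    refine hsymbol_eq_zero (fun J => ?_) hl
    rw [hsymbol_sub, hsymbol_hkr hV, ← Module.Basis.equivFun_apply, LinearEquiv.apply_symm_apply,
      sub_self]
  have hcoc : hdSelf (RealPoly d) m (Φ - V γ) = 0 := by
    rw [map_sub, hΦ, hdSelf_hkr hV, sub_zero]
  refine ⟨γ, ?_⟩
  cases m with
  | zero =>
    rw [isHCoboundary_zero_iff]
    ext1 v
    rw [Subsingleton.elim v Fin.elim0]
    exact hsymb List.Pairwise.nil
  | succ m =>
    rw [isHCoboundary_succ_iff]
    refine exists_eq_hd m _ _ _ (fun _ _ _ => mul_left_comm _ _ _) _ hcoc (fun _ => 0)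
      fun l hl => ?_
    rw [hsymb hl, koszulD_zero]

lemma eq_zero_of_isHCoboundary_hkr
    (hV : ∀ u, V (wedgeDec (RealPoly d) _ m u) = hkrDec (RealPoly d) m u)
    (γ : PolyVector d m) (h : IsHCoboundary m (evalC (V γ))) : γ = 0 := by
  refine ((derivBasis d).exteriorPower m).ext_elem fun J => ?_
  rw [← hsymbol_hkr hV, map_zero, Finsupp.zero_apply]
  cases m with
  | zero =>
    rw [isHCoboundary_zero_iff] at h
    rw [h]
    rfl
  | succ m =>
    obtain ⟨Ψ, hΨ⟩ := (isHCoboundary_succ_iff _).1 h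
    rw [hΨ, hdSelf, hsymbol_hd, koszulD_of_eq_zero fun i => sub_self _]

end HKR

/-- Vey's Hochschild–Kostant–Rosenberg theorem, algebraic case.
Let `A = ℝ[x₁,…,x_d]`.  For every `k ≥ -1` (encoded by `m = k + 1 ≥ 0`), the
Hochschild–Kostant–Rosenberg map `V` induces an isomorphism of `ℝ`-vector spaces from
`Λ^{k+1}_A Der(A)` onto the `k`-th cohomology `H^k(C^•(A), ∂)` of the Hochschild cochain
complex: the image of `V` consists of cocycles, every cocycle is cohomologous to some
`V(γ)`, and `V(γ)` is a coboundary only for `γ = 0`. -/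
theorem vey_hkr_cohomology_iso (d m : ℕ)
    (V : (⋀[MvPolynomial (Fin d) ℝ]^m (Derivation ℝ (MvPolynomial (Fin d) ℝ)
          (MvPolynomial (Fin d) ℝ)) :
        Submodule (MvPolynomial (Fin d) ℝ) _) →ₗ[MvPolynomial (Fin d) ℝ]
      MultilinearMap ℝ (fun _ : Fin m => MvPolynomial (Fin d) ℝ) (MvPolynomial (Fin d) ℝ))
    (hV : ∀ u : Fin m → Derivation ℝ (MvPolynomial (Fin d) ℝ) (MvPolynomial (Fin d) ℝ),
      V (wedgeDec (MvPolynomial (Fin d) ℝ) _ m u) = hkrDec (MvPolynomial (Fin d) ℝ) m u) :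
    (∀ γ, ∀ a, gbrM 2 m (mulC (MvPolynomial (Fin d) ℝ)) (evalC (V γ)) a = 0) ∧
    (∀ Φ : MultilinearMap ℝ (fun _ : Fin m => MvPolynomial (Fin d) ℝ)
        (MvPolynomial (Fin d) ℝ),
      (∀ a, gbrM 2 m (mulC (MvPolynomial (Fin d) ℝ)) (evalC Φ) a = 0) →
      ∃ γ, IsHCoboundary m (fun a => evalC Φ a - evalC (V γ) a)) ∧
    (∀ γ, IsHCoboundary m (evalC (V γ)) → γ = 0) :=
  ⟨fun γ => (gbrM_mulC_eq_zero_iff _).2 (hdSelf_hkr hV γ),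
    fun Φ hΦ => exists_hkr_isHCoboundary hV Φ ((gbrM_mulC_eq_zero_iff Φ).1 hΦ),
    eq_zero_of_isHCoboundary_hkr hV⟩
end

section
/- With C, δ and h as defined in the context, for every element a ∈ C of exterior degree q ≥ 1 one has δ(h(a)) + h(δ(a)) = a. Consequently the complex (C, δ) of formal fiberwise Hochschild chains has vanishing cohomology in every positive exterior degree. -/
open scoped BigOperators

set_option synthInstance.maxHeartbeats 1000000
set_option maxHeartbeats 1000000

namespace FedosovChainHomotopy

variable (d k : ℕ)

/-- The real exterior algebra `Λ(ξ¹,…,ξ^d)`. -/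
abbrev XiAlg (d : ℕ) := ExteriorAlgebra ℝ (Fin d → ℝ)

/-- The space `C = ℝ[[y₀,…,y_k]] ⊗ Λ(ξ¹,…,ξ^d)` of formal power series in the `k+1`
groups of `d` commuting variables `y_j = (y_j¹,…,y_j^d)` with coefficients in
`Λ(ξ¹,…,ξ^d)`, encoded by its coefficient function on monomials. -/
abbrev ChainF (d k : ℕ) := (Fin (k + 1) → Fin d → ℕ) → XiAlg d

/-- The generator `ξ^i`. -/
noncomputable def xi (i : Fin d) : XiAlg d :=
  ExteriorAlgebra.ι ℝ (Pi.single i (1 : ℝ))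

/-- Projection onto the exterior-degree-`q` component of an element of `Λ(ξ)`. -/
noncomputable def xiComp (q : ℕ) (x : XiAlg d) : XiAlg d :=
  ↑(DirectSum.decompose (fun n : ℕ => ⋀[ℝ]^n (Fin d → ℝ)) x q)

/-- The odd antiderivation `ι_{ξ^i}` of contraction with the generator `ξ^i`. -/
noncomputable def xiContract (i : Fin d) : XiAlg d →ₗ[ℝ] XiAlg d :=
  CliffordAlgebra.contractLeft (LinearMap.proj i)

/-- The differential `δ(a) = ∑_{j=0}^{k} ∑_{i=1}^{d} ξ^i ∧ ∂a/∂y_j^i`,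
written on coefficients. -/
noncomputable def deltaC (a : ChainF d k) : ChainF d k := fun μ =>
  ∑ j : Fin (k + 1), ∑ i : Fin d,
    (μ j i + 1) •
      (xi d i * a (Function.update μ j (Function.update (μ j) i (μ j i + 1))))

/-- The elementary coefficientwise integral `∫₀¹ p(t) dt/t` of a polynomial in `t`
(whose constant term vanishes in all the cases where it is used): the coefficient of
`t^m` contributes `1/m` (the junk summand `m = 0` contributes `0` since `(0 : ℝ)⁻¹ = 0`). -/
noncomputable def intDtOverT (p : Polynomial (XiAlg d)) : XiAlg d :=
  ∑ m ∈ Finset.range (p.natDegree + 1), ((m : ℝ))⁻¹ • p.coeff m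

/-- The monomial of the source term contributing to the substituted series
`a(tξ, t y₀, y₁ + (t-1) y₀, …, y_k + (t-1) y₀)` at a given target monomial `μ`,
for a given splitting `β` (with `β 0 = 0`): row `0` carries
`μ 0 i - ∑_j β j i`, and row `j ≥ 1` carries `μ j i + β j i`. -/
def srcMono (μ β : Fin (k + 1) → Fin d → ℕ) : Fin (k + 1) → Fin d → ℕ := fun j i =>
  if j = 0 then μ 0 i - (∑ j' : Fin (k + 1), β j' i) else μ j i + β j i

/-- The coefficient at the monomial `μ` of the substituted series
`a(tξ, t y₀, y₁ + (t-1) y₀, …, y_k + (t-1) y₀)`, as a polynomial in `t`: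
`∑_q ∑_β (∏ binomial coefficients) (t-1)^{|β|} t^{q + |α₀|} ·
(degree-q component of the coefficient of `a` at the source monomial α)`. -/
noncomputable def substCoeff (a : ChainF d k) (μ : Fin (k + 1) → Fin d → ℕ) :
    Polynomial (XiAlg d) :=
  ∑ q ∈ Finset.range (d + 1),
    ∑ β ∈ Fintype.piFinset (fun j : Fin (k + 1) =>
        Fintype.piFinset (fun i : Fin d =>
          Finset.range (if j = 0 then 1 else μ 0 i + 1))),
      if ∀ i : Fin d, (∑ j : Fin (k + 1), β j i) ≤ μ 0 i then
        (∏ j : Fin (k + 1), ∏ i : Fin d,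
            Nat.choose (srcMono d k μ β j i) (β j i)) •
          ((Polynomial.X - 1) ^ (∑ j : Fin (k + 1), ∑ i : Fin d, β j i) *
            Polynomial.X ^ (q + ∑ i : Fin d, srcMono d k μ β 0 i) *
            Polynomial.C (xiComp d q (a (srcMono d k μ β))))
      else 0

/-- The homotopy operator
`h a = ∑_i y₀^i ι_{ξ^i} ∫₀¹ a(tξ, t y₀, y₁+(t-1)y₀, …, y_k+(t-1)y₀) dt/t`
(which vanishes on exterior degree `0`, the contraction killing those components),
written on coefficients. -/
noncomputable def hOp (a : ChainF d k) : ChainF d k := fun μ =>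
  ∑ i : Fin d,
    if μ 0 i = 0 then 0
    else
      xiContract d i
        (intDtOverT d
          (substCoeff d k a
            (Function.update μ 0 (Function.update (μ 0) i (μ 0 i - 1)))))

section ExteriorAlgebraLemmas

lemma xi_mem (i : Fin d) : xi d i ∈ ⋀[ℝ]^1 (Fin d → ℝ) := by
  simp [xi]

lemma xi_mul_mem {q : ℕ} (i : Fin d) {x : XiAlg d} (hx : x ∈ ⋀[ℝ]^q (Fin d → ℝ)) :
    xi d i * x ∈ ⋀[ℝ]^(q + 1) (Fin d → ℝ) := by
  rw [add_comm]
  exact SetLike.GradedMul.mul_mem (A := fun n : ℕ => ⋀[ℝ]^n (Fin d → ℝ)) (xi_mem d i) hx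

lemma xiComp_of_mem {p : ℕ} {x : XiAlg d} (hx : x ∈ ⋀[ℝ]^p (Fin d → ℝ)) (q : ℕ) :
    xiComp d q x = if p = q then x else 0 := by
  split_ifs with h
  · subst h
    exact DirectSum.decompose_of_mem_same (fun n : ℕ => ⋀[ℝ]^n (Fin d → ℝ)) hx
  · exact DirectSum.decompose_of_mem_ne (fun n : ℕ => ⋀[ℝ]^n (Fin d → ℝ)) hx h

lemma eq_zero_of_mem_exteriorPower {p : ℕ} (hp : d < p) {x : XiAlg d}
    (hx : x ∈ ⋀[ℝ]^p (Fin d → ℝ)) : x = 0 := by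
  have h : Module.finrank ℝ (⋀[ℝ]^p (Fin d → ℝ)) = 0 := by
    rw [exteriorPower.finrank_eq, Module.finrank_fin_fun, Nat.choose_eq_zero_of_lt hp]
  have := Module.finrank_zero_iff.mp h
  exact congrArg Subtype.val (Subsingleton.elim (⟨x, hx⟩ : ⋀[ℝ]^p (Fin d → ℝ)) 0)

lemma xiContract_ι_mul (i : Fin d) (v : Fin d → ℝ) (x : XiAlg d) :
    xiContract d i (ExteriorAlgebra.ι ℝ v * x) =
      v i • x - ExteriorAlgebra.ι ℝ v * xiContract d i x := by
  have h := CliffordAlgebra.contractLeft_ι_mul (Q := (0 : QuadraticForm ℝ (Fin d → ℝ)))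
    (LinearMap.proj (R := ℝ) (φ := fun _ => ℝ) i) v x
  rw [LinearMap.proj_apply] at h
  rw [xiContract, ExteriorAlgebra.ι]
  exact h

lemma xiContract_xi_mul (i l : Fin d) (x : XiAlg d) :
    xiContract d i (xi d l * x) = (if i = l then x else 0) - xi d l * xiContract d i x := by
  rw [xi, xiContract_ι_mul, Pi.single_apply]
  split_ifs <;> simp

lemma ι_eq_sum_xi (v : Fin d → ℝ) : ExteriorAlgebra.ι ℝ v = ∑ i, v i • xi d i := by
  conv_lhs => rw [pi_eq_sum_univ' v]
  simp [xi, map_sum, Pi.single]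

lemma ι_mul_xi (v : Fin d → ℝ) (i : Fin d) :
    ExteriorAlgebra.ι ℝ v * xi d i = -(xi d i * ExteriorAlgebra.ι ℝ v) := by
  rw [eq_neg_iff_add_eq_zero]
  exact ExteriorAlgebra.ι_add_mul_swap _ _

/-- Euler's identity: `∑ ξ^i ι_{ξ^i}` is the exterior degree operator. -/
lemma sum_xi_mul_xiContract {q : ℕ} {x : XiAlg d} (hx : x ∈ ⋀[ℝ]^q (Fin d → ℝ)) :
    ∑ i, xi d i * xiContract d i x = (q : ℝ) • x := by
  induction hx using Submodule.pow_induction_on_left' with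
  | algebraMap r => simp [xiContract, CliffordAlgebra.contractLeft_algebraMap]
  | add x y i hx hy ihx ihy => simp [mul_add, Finset.sum_add_distrib, ihx, ihy]
  | mem_mul m hm i x hx ih =>
    obtain ⟨v, rfl⟩ := hm
    simp only [xiContract_ι_mul, mul_sub, Finset.sum_sub_distrib, ← mul_assoc]
    have h : ∀ i, xi d i * ExteriorAlgebra.ι ℝ v = -(ExteriorAlgebra.ι ℝ v * xi d i) := by
      intro i; rw [ι_mul_xi, neg_neg]
    simp only [h, neg_mul, Finset.sum_neg_distrib, mul_assoc, ← Finset.mul_sum, ih]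
    simp only [mul_smul_comm, ← smul_mul_assoc, ← Finset.sum_mul, ← ι_eq_sum_xi]
    push_cast
    simp only [smul_mul_assoc]
    module

end ExteriorAlgebraLemmas

section RadialIntegral

open Polynomial

variable {A : Type*} [Ring A] [Algebra ℝ A]

/-- The coefficientwise integral `∫₀¹ t^q p(t) dt/t`. -/
noncomputable def radialInt (A : Type*) [Ring A] [Algebra ℝ A] (q : ℕ) : A[X] →ₗ[ℝ] A :=
  Polynomial.lsum fun m => ((m + q : ℕ) : ℝ)⁻¹ • LinearMap.id

lemma radialInt_monomial (q m : ℕ) (x : A) :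
    radialInt A q (monomial m x) = ((m + q : ℕ) : ℝ)⁻¹ • x := by
  simp [radialInt, Polynomial.lsum_apply, Polynomial.sum_monomial_index]

lemma radialInt_X_pow_mul (q r : ℕ) (p : A[X]) :
    radialInt A q (X ^ r * p) = radialInt A (q + r) p := by
  induction p using Polynomial.induction_on' with
  | add p p' hp hp' => simp [mul_add, hp, hp']
  | monomial m x =>
    rw [X_pow_mul_monomial, radialInt_monomial, radialInt_monomial, add_assoc, add_comm q r]

lemma radialInt_C_mul (q : ℕ) (x : A) (p : A[X]) :
    radialInt A q (C x * p) = x * radialInt A q p := by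
  induction p using Polynomial.induction_on' with
  | add p p' hp hp' => simp [mul_add, hp, hp']
  | monomial m y => simp [C_mul_monomial, radialInt_monomial]

lemma radialInt_map_mul_C (q : ℕ) (f : ℝ[X]) (x : A) :
    radialInt A q (f.map (algebraMap ℝ A) * C x) = radialInt ℝ q f • x := by
  induction f using Polynomial.induction_on' with
  | add p p' hp hp' => simp [add_mul, add_smul, hp, hp']
  | monomial m y =>
    simp [monomial_mul_C, radialInt_monomial, Algebra.smul_def, mul_assoc]

lemma radialInt_euler {q : ℕ} (hq : 1 ≤ q) (p : A[X]) :
    (q : ℝ) • radialInt A q p + radialInt A q (X * derivative p) = p.eval 1 := by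
  induction p using Polynomial.induction_on' with
  | add p p' hp hp' =>
    simp only [map_add, mul_add, eval_add, smul_add, ← hp, ← hp']
    abel
  | monomial m y =>
    have : ((m + q : ℕ) : ℝ) ≠ 0 := by positivity
    have e : X * derivative (monomial m y) = (m : ℝ) • monomial m y := by
      cases m with
      | zero => simp
      | succ m =>
        rw [derivative_monomial, X_mul_monomial, smul_monomial]
        congr 1
        simpa [Algebra.smul_def] using (Nat.cast_commute (m + 1) y).eq.symm
    rw [e, map_smul, ← add_smul, radialInt_monomial, smul_smul, eval_monomial]
    rw [show ((q : ℝ) + m) * ((m + q : ℕ) : ℝ)⁻¹ = 1 by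
      rw [← Nat.cast_add, add_comm q m]; exact mul_inv_cancel₀ this]
    simp

lemma intDtOverT_eq_radialInt (p : (XiAlg d)[X]) : intDtOverT d p = radialInt (XiAlg d) 0 p := by
  rw [intDtOverT, radialInt, Polynomial.lsum_apply, Polynomial.sum_over_range _ (by simp)]
  simp

end RadialIntegral

section DualSide

open MvPolynomial

/-- The index set of the scalar variables `y_j^i`. -/
abbrev Idx (d k : ℕ) := Fin (k + 1) × Fin d

/-- The polynomial ring dual to the formal power series in the `y_j^i`. -/
abbrev DualPoly (d k : ℕ) := MvPolynomial (Idx d k) ℝ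

/-- The element `∑_j x_j^i`, dual to the operator `∑_j ∂/∂y_j^i`. -/
noncomputable def diagSum (i : Fin d) : DualPoly d k := ∑ j, X (j, i)

/-- The transpose of the substitution `y₀ ↦ t y₀`, `y_j ↦ y_j + (t - 1) y₀`. -/
noncomputable def dualSubst : DualPoly d k →ₐ[ℝ] Polynomial (DualPoly d k) :=
  aeval fun p => if p.1 = 0 then
      ∑ j, (if j = 0 then Polynomial.X else Polynomial.X - 1) * Polynomial.C (X (j, p.2))
    else Polynomial.C (X p)

lemma dualSubst_X_zero (i : Fin d) :
    dualSubst d k (X (0, i)) =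
      ∑ j, (if j = 0 then Polynomial.X else Polynomial.X - 1) * Polynomial.C (X (j, i)) := by
  simp [dualSubst]

lemma dualSubst_X_of_ne {p : Idx d k} (hp : p.1 ≠ 0) :
    dualSubst d k (X p) = Polynomial.C (X p) := by
  simp [dualSubst, hp]

lemma dualSubst_X_succ (j : Fin k) (i : Fin d) :
    dualSubst d k (X (j.succ, i)) = Polynomial.C (X (j.succ, i)) :=
  dualSubst_X_of_ne d k (Fin.succ_ne_zero j)

lemma dualSubst_diagSum (i : Fin d) :
    dualSubst d k (diagSum d k i) = Polynomial.X * Polynomial.C (diagSum d k i) := by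
  rw [diagSum, map_sum, Fin.sum_univ_succ, dualSubst_X_zero, Fin.sum_univ_succ, map_sum,
    Fin.sum_univ_succ, mul_add, Finset.mul_sum, add_assoc, ← Finset.sum_add_distrib, if_pos rfl]
  refine congrArg _ (Finset.sum_congr rfl fun j _ => ?_)
  rw [dualSubst_X_succ, if_neg (Fin.succ_ne_zero j)]
  ring

lemma dualSubst_eval_one (p : DualPoly d k) : (dualSubst d k p).eval 1 = p := by
  have h : ((Polynomial.aeval (R := DualPoly d k) 1).restrictScalars ℝ).comp (dualSubst d k) =
      AlgHom.id ℝ (DualPoly d k) := by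
    ext1 ⟨j, i⟩
    by_cases hj : j = 0
    · subst hj
      simp [dualSubst_X_zero, Fin.sum_univ_succ, Fin.succ_ne_zero, Polynomial.eval_finsetSum]
    · simp [dualSubst_X_of_ne d k (p := (j, i)) hj]
  simpa [Polynomial.aeval_def] using DFunLike.congr_fun h p

lemma derivative_dualSubst (p : DualPoly d k) :
    Polynomial.derivative (dualSubst d k p) =
      ∑ i, Polynomial.C (diagSum d k i) * dualSubst d k (pderiv (0, i) p) := by
  induction p using MvPolynomial.induction_on with
  | C r =>
    rw [← algebraMap_eq, AlgHom.commutes]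
    simp [IsScalarTower.algebraMap_apply ℝ (DualPoly d k) (Polynomial (DualPoly d k))]
  | add p p' hp hp' => simp [mul_add, Finset.sum_add_distrib, hp, hp']
  | mul_X p n hp =>
    have hX : Polynomial.derivative (dualSubst d k (X n)) =
        ∑ i, Polynomial.C (diagSum d k i) * dualSubst d k (pderiv (0, i) (X n)) := by
      obtain ⟨j, l⟩ := n
      by_cases hj : j = 0
      · subst hj
        simp only [dualSubst_X_zero, pderiv_X, Fin.sum_univ_succ, Fin.succ_ne_zero, if_false]
        simp [Pi.single_apply, diagSum, Fin.sum_univ_succ]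
      · rw [dualSubst_X_of_ne d k (p := (j, l)) hj]
        simp [pderiv_X, hj]
    rw [map_mul, Polynomial.derivative_mul, hp, hX, Finset.sum_mul, Finset.mul_sum,
      ← Finset.sum_add_distrib]
    refine Finset.sum_congr rfl fun i _ => ?_
    rw [Derivation.leibniz, smul_eq_mul, smul_eq_mul, map_add, map_mul, map_mul]
    ring

/-- The transpose of `a ↦ ∫₀¹ t^q a(t y₀, y_j + (t - 1) y₀) dt/t`. -/
noncomputable def dualRadial (q : ℕ) : DualPoly d k →ₗ[ℝ] DualPoly d k :=
  radialInt (DualPoly d k) q ∘ₗ (dualSubst d k).toLinearMap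

lemma dualRadial_diagSum_mul (q : ℕ) (i : Fin d) (p : DualPoly d k) :
    dualRadial d k q (diagSum d k i * p) = diagSum d k i * dualRadial d k (q + 1) p := by
  have h := radialInt_X_pow_mul (A := DualPoly d k) q 1
    (Polynomial.C (diagSum d k i) * dualSubst d k p)
  rw [pow_one, radialInt_C_mul] at h
  simp only [dualRadial, LinearMap.comp_apply, AlgHom.toLinearMap_apply]
  rw [map_mul, dualSubst_diagSum, mul_assoc]
  exact h

lemma dualRadial_euler {q : ℕ} (hq : 1 ≤ q) (p : DualPoly d k) :
    (q : ℝ) • dualRadial d k q p + ∑ i, diagSum d k i * dualRadial d k (q + 1) (pderiv (0, i) p) =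
      p := by
  have h := radialInt_euler hq (dualSubst d k p)
  rw [dualSubst_eval_one, derivative_dualSubst, ← pow_one Polynomial.X, radialInt_X_pow_mul,
    map_sum] at h
  simpa [radialInt_C_mul, dualRadial] using h

end DualSide

section Pairing

open MvPolynomial Nat

variable {d k}

/-- The exponent vector `μ` with its `(j, i)` entry replaced by `n`. -/
def setExp (μ : Fin (k + 1) → Fin d → ℕ) (j : Fin (k + 1)) (i : Fin d) (n : ℕ) :
    Fin (k + 1) → Fin d → ℕ :=
  Function.update μ j (Function.update (μ j) i n)

lemma setExp_apply (μ : Fin (k + 1) → Fin d → ℕ) (j j' : Fin (k + 1)) (i i' : Fin d) (n : ℕ) :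
    setExp μ j i n j' i' = if j' = j ∧ i' = i then n else μ j' i' := by
  unfold setExp
  by_cases hj : j' = j
  · subst hj
    by_cases hi : i' = i <;> simp [hi]
  · simp [hj]

/-- The exponent vector `μ` as a finitely supported function. -/
noncomputable def expFinsupp (μ : Fin (k + 1) → Fin d → ℕ) : Idx d k →₀ ℕ :=
  Finsupp.equivFunOnFinite.symm fun p => μ p.1 p.2

@[simp] lemma expFinsupp_apply (μ : Fin (k + 1) → Fin d → ℕ) (p : Idx d k) :
    expFinsupp μ p = μ p.1 p.2 := rfl

lemma expFinsupp_setExp_succ (μ : Fin (k + 1) → Fin d → ℕ) (j : Fin (k + 1)) (i : Fin d) :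
    expFinsupp (setExp μ j i (μ j i + 1)) = Finsupp.single (j, i) 1 + expFinsupp μ := by
  ext ⟨j', i'⟩
  simp only [expFinsupp_apply, setExp_apply, Finsupp.add_apply, Finsupp.single_apply, Prod.mk.injEq]
  split_ifs with h h' h'
  · rw [h.1, h.2, add_comm]
  · exact absurd ⟨h.1.symm, h.2.symm⟩ h'
  · exact absurd ⟨h'.1.symm, h'.2.symm⟩ h
  · rw [zero_add]

lemma expFinsupp_setExp_pred (μ : Fin (k + 1) → Fin d → ℕ) (j : Fin (k + 1)) (i : Fin d) :
    expFinsupp (setExp μ j i (μ j i - 1)) = expFinsupp μ - Finsupp.single (j, i) 1 := by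
  ext ⟨j', i'⟩
  simp only [expFinsupp_apply, setExp_apply, Finsupp.tsub_apply, Finsupp.single_apply,
    Prod.mk.injEq]
  split_ifs with h h' h'
  · rw [h.1, h.2]
  · exact absurd ⟨h.1.symm, h.2.symm⟩ h'
  · exact absurd ⟨h'.1.symm, h'.2.symm⟩ h
  · rw [Nat.sub_zero]

/-- The monomial with exponent vector `μ`. -/
noncomputable def dualMono (μ : Fin (k + 1) → Fin d → ℕ) : DualPoly d k :=
  monomial (expFinsupp μ) 1

lemma dualMono_eq_prod (μ : Fin (k + 1) → Fin d → ℕ) :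
    dualMono μ = ∏ j, ∏ i, X (j, i) ^ μ j i := by
  rw [dualMono, monomial_eq, Finsupp.prod_fintype _ _ (by simp), Fintype.prod_prod_type]
  simp

lemma linearMap_ext_dualMono {M : Type*} [AddCommMonoid M] [Module ℝ M]
    {f g : DualPoly d k →ₗ[ℝ] M} (h : ∀ μ, f (dualMono μ) = g (dualMono μ)) : f = g := by
  refine (basisMonomials (Idx d k) ℝ).ext fun m => ?_
  have hm : expFinsupp (fun j i => m (j, i)) = m := by ext; rfl
  simpa [dualMono, hm] using h fun j i => m (j, i)

lemma diagSum_mul_dualMono (i : Fin d) (μ : Fin (k + 1) → Fin d → ℕ) :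
    diagSum d k i * dualMono μ = ∑ j, dualMono (setExp μ j i (μ j i + 1)) := by
  rw [diagSum, Finset.sum_mul]
  refine Finset.sum_congr rfl fun j _ => ?_
  rw [dualMono, dualMono, expFinsupp_setExp_succ, X, monomial_mul, one_mul]

lemma pderiv_dualMono (j : Fin (k + 1)) (i : Fin d) (μ : Fin (k + 1) → Fin d → ℕ) :
    pderiv (j, i) (dualMono μ) = (μ j i : ℝ) • dualMono (setExp μ j i (μ j i - 1)) := by
  rw [dualMono, dualMono, expFinsupp_setExp_pred, pderiv_monomial, smul_monomial]
  simp

/-- The product `μ!` of the factorials of the exponents. -/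
def expFactorial (μ : Fin (k + 1) → Fin d → ℕ) : ℕ := ∏ j, ∏ i, (μ j i)!

lemma expFactorial_eq (μ : Fin (k + 1) → Fin d → ℕ) (j : Fin (k + 1)) (i : Fin d) :
    expFactorial μ = (μ j i)! * ∏ p ∈ Finset.univ.erase (j, i), (μ p.1 p.2)! := by
  rw [expFactorial, ← Fintype.prod_prod_type' fun j i => (μ j i)!]
  exact (Finset.mul_prod_erase _ (fun p : Idx d k => (μ p.1 p.2)!) (Finset.mem_univ (j, i))).symm

lemma expFactorial_setExp (μ : Fin (k + 1) → Fin d → ℕ) (j : Fin (k + 1)) (i : Fin d) (n : ℕ) :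
    expFactorial (setExp μ j i n) = n ! * ∏ p ∈ Finset.univ.erase (j, i), (μ p.1 p.2)! := by
  rw [expFactorial_eq _ j i, setExp_apply, if_pos ⟨rfl, rfl⟩]
  refine congrArg _ (Finset.prod_congr rfl fun p hp => ?_)
  rw [setExp_apply, if_neg fun h => Finset.ne_of_mem_erase hp (Prod.ext h.1 h.2)]

lemma expFactorial_setExp_succ (μ : Fin (k + 1) → Fin d → ℕ) (j : Fin (k + 1)) (i : Fin d) :
    expFactorial (setExp μ j i (μ j i + 1)) = expFactorial μ * (μ j i + 1) := by
  rw [expFactorial_setExp, expFactorial_eq μ j i, Nat.factorial_succ]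
  ring

lemma expFactorial_setExp_pred (μ : Fin (k + 1) → Fin d → ℕ) (j : Fin (k + 1)) (i : Fin d)
    (h : μ j i ≠ 0) :
    μ j i * expFactorial (setExp μ j i (μ j i - 1)) = expFactorial μ := by
  rw [expFactorial_setExp, expFactorial_eq μ j i, ← Nat.mul_factorial_pred h]
  ring

/-- The pairing of a series `a` with polynomials, for which `y^μ` is dual to `x^μ / μ!`. -/
noncomputable def pairing (a : ChainF d k) : DualPoly d k →ₗ[ℝ] XiAlg d :=
  (basisMonomials (Idx d k) ℝ).constr ℝ fun m =>
    (expFactorial (fun j i => m (j, i)) : ℝ) • a fun j i => m (j, i)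

lemma pairing_dualMono (a : ChainF d k) (μ : Fin (k + 1) → Fin d → ℕ) :
    pairing a (dualMono μ) = (expFactorial μ : ℝ) • a μ := by
  have h := (basisMonomials (Idx d k) ℝ).constr_basis ℝ (fun m =>
    (expFactorial (fun j i => m (j, i)) : ℝ) • a fun j i => m (j, i)) (expFinsupp μ)
  rwa [coe_basisMonomials] at h

lemma eq_of_pairing_eq {a b : ChainF d k} (h : pairing a = pairing b) : a = b := by
  funext μ
  have h' := DFunLike.congr_fun h (dualMono μ)
  rw [pairing_dualMono, pairing_dualMono] at h'
  refine smul_right_injective _ (?_ : (expFactorial μ : ℝ) ≠ 0) h'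
  exact_mod_cast Finset.prod_ne_zero_iff.mpr fun j _ =>
    Finset.prod_ne_zero_iff.mpr fun i _ => Nat.factorial_ne_zero _

lemma pairing_add (a b : ChainF d k) : pairing (a + b) = pairing a + pairing b :=
  linearMap_ext_dualMono fun μ => by simp [pairing_dualMono]

lemma pairing_mem {q : ℕ} {a : ChainF d k} (ha : ∀ μ, a μ ∈ ⋀[ℝ]^q (Fin d → ℝ))
    (p : DualPoly d k) : pairing a p ∈ ⋀[ℝ]^q (Fin d → ℝ) := by
  rw [pairing, Module.Basis.constr_apply]
  exact Submodule.finsuppSum_mem _ _ _ _ fun m _ =>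
    Submodule.smul_mem _ _ (Submodule.smul_mem _ _ (ha _))

lemma pairing_deltaC (a : ChainF d k) (p : DualPoly d k) :
    pairing (deltaC d k a) p = ∑ i, xi d i * pairing a (diagSum d k i * p) := by
  have h : pairing (deltaC d k a) = ∑ i, LinearMap.mulLeft ℝ (xi d i) ∘ₗ pairing a ∘ₗ
      LinearMap.mulLeft ℝ (diagSum d k i) := by
    refine linearMap_ext_dualMono fun μ => ?_
    simp only [pairing_dualMono, LinearMap.sum_apply, LinearMap.comp_apply,
      LinearMap.mulLeft_apply, diagSum_mul_dualMono, map_sum, expFactorial_setExp_succ, deltaC,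
      Finset.smul_sum]
    rw [Finset.sum_comm]
    refine Finset.sum_congr rfl fun i _ => Finset.sum_congr rfl fun j _ => ?_
    rw [mul_smul_comm, Nat.cast_mul, mul_smul, Nat.cast_smul_eq_nsmul ℝ (μ j i + 1)]
    rfl
  simpa using DFunLike.congr_fun h p

/-- The exponent vector whose row `0` is `i ↦ κ i 0` and whose row `j ≥ 1` is `μ j + κ · j`. -/
def shiftExp (μ : Fin (k + 1) → Fin d → ℕ) (κ : Fin d → Fin (k + 1) → ℕ) :
    Fin (k + 1) → Fin d → ℕ :=
  fun j i => if j = 0 then κ i 0 else μ j i + κ i j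

lemma dualSubst_dualMono (μ : Fin (k + 1) → Fin d → ℕ) :
    dualSubst d k (dualMono μ) =
      ∑ κ ∈ Fintype.piFinset fun i => Finset.piAntidiag Finset.univ (μ 0 i),
        Polynomial.map (algebraMap ℝ (DualPoly d k))
            ((∏ i, (Nat.multinomial Finset.univ (κ i) : Polynomial ℝ)) *
              ∏ i, ∏ j, (if j = 0 then Polynomial.X else Polynomial.X - 1) ^ κ i j) *
          Polynomial.C (dualMono (shiftExp μ κ)) := by
  rw [dualMono_eq_prod, Fin.prod_univ_succ, map_mul, map_prod, map_prod]
  simp_rw [map_prod, map_pow, dualSubst_X_zero, dualSubst_X_succ,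
    Finset.sum_pow_eq_sum_piAntidiag]
  rw [Finset.prod_univ_sum, Finset.sum_mul]
  refine Finset.sum_congr rfl fun κ _ => ?_
  have hc : ∀ j : Fin (k + 1), Polynomial.map (algebraMap ℝ (DualPoly d k))
      (if j = 0 then Polynomial.X else Polynomial.X - 1) =
        if j = 0 then Polynomial.X else Polynomial.X - 1 := by
    intro j; split_ifs <;> simp
  rw [dualMono_eq_prod]
  simp only [Polynomial.map_mul, Polynomial.map_prod, Polynomial.map_pow, Polynomial.map_natCast,
    hc, mul_pow, Finset.prod_mul_distrib, mul_assoc, map_prod, map_pow]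
  congr 2
  rw [Finset.prod_comm (γ := Fin d), Fin.prod_univ_succ, Fin.prod_univ_succ, mul_assoc,
    ← Finset.prod_mul_distrib]
  congr 1
  refine Finset.prod_congr rfl fun j _ => ?_
  rw [← Finset.prod_mul_distrib]
  refine Finset.prod_congr rfl fun i _ => ?_
  rw [shiftExp, if_neg (Fin.succ_ne_zero j), pow_add, mul_comm]

/-- The distribution `κ` of the `y₀`-exponents corresponding to a splitting `β`. -/
def splitDist (μ β : Fin (k + 1) → Fin d → ℕ) : Fin d → Fin (k + 1) → ℕ :=
  fun i j => if j = 0 then μ 0 i - ∑ j', β j' i else β j i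

lemma prod_factorial_mul_prod_choose (n b : Fin (k + 1) → ℕ) (hb0 : b 0 = 0)
    (hb : ∑ j, b j ≤ n 0) :
    (∏ j, (n j)!) * ∏ j, Nat.choose (if j = 0 then n 0 - ∑ j', b j' else n j + b j) (b j) =
      Nat.multinomial Finset.univ (fun j => if j = 0 then n 0 - ∑ j', b j' else b j) *
        ∏ j, (if j = 0 then n 0 - ∑ j', b j' else n j + b j)! := by
  have hs := Nat.multinomial_spec (Finset.univ : Finset (Fin (k + 1)))
    (fun j => if j = 0 then n 0 - ∑ j', b j' else b j)
  have hsum : ∑ j, (if j = 0 then n 0 - ∑ j', b j' else b j) = n 0 := by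
    rw [Fin.sum_univ_succ] at hb ⊢
    simp only [Fin.succ_ne_zero, if_true, if_false, Fin.sum_univ_succ]
    omega
  rw [hsum] at hs
  have hpos : 0 < ∏ j, (if j = 0 then n 0 - ∑ j', b j' else b j)! :=
    Finset.prod_pos fun j _ => Nat.factorial_pos _
  refine Nat.eq_of_mul_eq_mul_left hpos ?_
  rw [← mul_assoc _ (Nat.multinomial _ _), hs]
  have hc : ∀ j : Fin k, (n j.succ + b j.succ).choose (b j.succ) * (b j.succ)! * (n j.succ)! =
      (n j.succ + b j.succ)! := by
    intro j
    rw [← Nat.add_choose_mul_factorial_mul_factorial]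
    ring
  simp only [Fin.prod_univ_succ (n := k), Fin.succ_ne_zero, if_true, if_false, hb0,
    Nat.choose_zero_right, ← hc, Finset.prod_mul_distrib]
  ring

lemma expFactorial_mul_prod_choose (μ β : Fin (k + 1) → Fin d → ℕ) (hβ0 : ∀ i, β 0 i = 0)
    (hβ : ∀ i, ∑ j, β j i ≤ μ 0 i) :
    expFactorial μ * ∏ j, ∏ i, Nat.choose (srcMono d k μ β j i) (β j i) =
      (∏ i, Nat.multinomial Finset.univ (splitDist μ β i)) * expFactorial (srcMono d k μ β) := by
  unfold expFactorial
  rw [Finset.prod_comm, Finset.prod_comm (s := (Finset.univ : Finset (Fin (k + 1)))),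
    Finset.prod_comm (s := (Finset.univ : Finset (Fin (k + 1)))), ← Finset.prod_mul_distrib,
    ← Finset.prod_mul_distrib]
  exact Finset.prod_congr rfl fun i _ =>
    prod_factorial_mul_prod_choose (fun j => μ j i) (fun j => β j i) (hβ0 i) (hβ i)

lemma srcMono_eq_shiftExp (μ β : Fin (k + 1) → Fin d → ℕ) :
    srcMono d k μ β = shiftExp μ (splitDist μ β) := by
  funext j i
  simp only [srcMono, shiftExp, splitDist]
  split_ifs <;> simp

/-- The splittings `β` occurring in the expansion at the exponent vector `μ`. -/
def splittings (μ : Fin (k + 1) → Fin d → ℕ) : Finset (Fin (k + 1) → Fin d → ℕ) :=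
  (Fintype.piFinset fun j : Fin (k + 1) => Fintype.piFinset fun i : Fin d =>
    Finset.range (if j = 0 then 1 else μ 0 i + 1)).filter fun β => ∀ i, ∑ j, β j i ≤ μ 0 i

lemma mem_splittings {μ β : Fin (k + 1) → Fin d → ℕ} :
    β ∈ splittings μ ↔ (∀ i, β 0 i = 0) ∧ ∀ i, ∑ j, β j i ≤ μ 0 i := by
  simp only [splittings, Finset.mem_filter, Fintype.mem_piFinset, Finset.mem_range]
  refine ⟨fun h => ⟨fun i => by simpa using h.1 0 i, h.2⟩, fun h => ⟨fun j i => ?_, h.2⟩⟩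
  split_ifs with hj
  · simp [hj, h.1]
  · exact Nat.lt_succ_of_le ((Finset.single_le_sum (f := fun j => β j i)
      (fun _ _ => Nat.zero_le _) (Finset.mem_univ j)).trans (h.2 i))

lemma sum_splittings {M : Type*} [AddCommMonoid M] (μ : Fin (k + 1) → Fin d → ℕ)
    (F : (Fin d → Fin (k + 1) → ℕ) → M) :
    ∑ β ∈ splittings μ, F (splitDist μ β) =
      ∑ κ ∈ Fintype.piFinset fun i => Finset.piAntidiag Finset.univ (μ 0 i), F κ := by
  refine Finset.sum_nbij' (splitDist μ) (fun κ j i => if j = 0 then 0 else κ i j) ?_ ?_ ?_ ?_ ?_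
  · intro β hβ
    rw [mem_splittings] at hβ
    simp only [Fintype.mem_piFinset, Finset.mem_piAntidiag]
    refine fun i => ⟨?_, fun _ _ => Finset.mem_univ _⟩
    have := hβ.2 i
    have h0 := hβ.1 i
    rw [Fin.sum_univ_succ] at this ⊢
    simp only [splitDist, Fin.succ_ne_zero, if_true, if_false, Fin.sum_univ_succ]
    omega
  · intro κ hκ
    simp only [Fintype.mem_piFinset, Finset.mem_piAntidiag] at hκ
    refine mem_splittings.mpr ⟨fun i => if_pos rfl, fun i => ?_⟩
    rw [← (hκ i).1]
    exact Finset.sum_le_sum fun j _ => by split_ifs <;> simp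
  · intro β hβ
    rw [mem_splittings] at hβ
    funext j i
    by_cases hj : j = 0
    · simp [hj, hβ.1]
    · simp [hj, splitDist]
  · intro κ hκ
    simp only [Fintype.mem_piFinset, Finset.mem_piAntidiag] at hκ
    funext i j
    by_cases hj : j = 0
    · have h := (hκ i).1
      rw [Fin.sum_univ_succ] at h
      simp only [splitDist, hj, Fin.sum_univ_succ, Fin.succ_ne_zero, if_true, if_false]
      omega
    · simp [hj, splitDist]
  · exact fun _ _ => rfl

lemma substCoeff_of_mem {q : ℕ} {a : ChainF d k} (ha : ∀ μ, a μ ∈ ⋀[ℝ]^q (Fin d → ℝ))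
    (μ : Fin (k + 1) → Fin d → ℕ) :
    substCoeff d k a μ = ∑ β ∈ splittings μ,
      (∏ j, ∏ i, Nat.choose (srcMono d k μ β j i) (β j i)) •
        ((Polynomial.X - 1) ^ (∑ j, ∑ i, β j i) *
          Polynomial.X ^ (q + ∑ i, srcMono d k μ β 0 i) *
            Polynomial.C (a (srcMono d k μ β))) := by
  unfold substCoeff splittings
  simp only [← Finset.sum_filter]
  rw [Finset.sum_comm]
  refine Finset.sum_congr rfl fun β _ => ?_
  simp only [xiComp_of_mem d (ha _)]
  by_cases hq : q < d + 1
  · rw [Finset.sum_eq_single_of_mem q (Finset.mem_range.mpr hq)]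
    · rw [if_pos rfl]
    · intro p _ hp
      rw [if_neg hp.symm]
      simp
  · rw [eq_zero_of_mem_exteriorPower d (by omega) (ha _)]
    simp

lemma pairing_dualRadial_dualMono {q : ℕ} {a : ChainF d k}
    (ha : ∀ μ, a μ ∈ ⋀[ℝ]^q (Fin d → ℝ)) (μ : Fin (k + 1) → Fin d → ℕ) :
    pairing a (dualRadial d k q (dualMono μ)) =
      (expFactorial μ : ℝ) • intDtOverT d (substCoeff d k a μ) := by
  rw [dualRadial, LinearMap.comp_apply, AlgHom.toLinearMap_apply, dualSubst_dualMono, map_sum,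
    map_sum, ← sum_splittings, intDtOverT_eq_radialInt, substCoeff_of_mem ha, map_sum,
    Finset.smul_sum]
  refine Finset.sum_congr rfl fun β hβ => ?_
  rw [mem_splittings] at hβ
  have hpoly : (∏ i, ∏ j, (if j = 0 then Polynomial.X else Polynomial.X - 1 : Polynomial ℝ) ^
      splitDist μ β i j) =
        Polynomial.X ^ (∑ i, srcMono d k μ β 0 i) * (Polynomial.X - 1) ^ (∑ j, ∑ i, β j i) := by
    rw [Finset.sum_comm (γ := Fin (k + 1)), ← Finset.prod_pow_eq_pow_sum,
      ← Finset.prod_pow_eq_pow_sum, ← Finset.prod_mul_distrib]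
    refine Finset.prod_congr rfl fun i _ => ?_
    rw [← Finset.prod_pow_eq_pow_sum, Fin.prod_univ_succ, Fin.prod_univ_succ, hβ.1 i]
    simp [splitDist, srcMono, Fin.succ_ne_zero]
  have hnum := expFactorial_mul_prod_choose μ β hβ.1 hβ.2
  set P : Polynomial ℝ := Polynomial.X ^ (∑ i, srcMono d k μ β 0 i) *
    (Polynomial.X - 1) ^ (∑ j, ∑ i, β j i) with hP
  have hX : (Polynomial.X - 1) ^ (∑ j, ∑ i, β j i) *
      Polynomial.X ^ (q + ∑ i, srcMono d k μ β 0 i) * Polynomial.C (a (srcMono d k μ β)) =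
        Polynomial.X ^ q * (P.map (algebraMap ℝ (XiAlg d)) *
          Polynomial.C (a (srcMono d k μ β))) := by
    rw [hP, ← mul_assoc]
    congr 1
    simp only [Polynomial.map_mul, Polynomial.map_pow, Polynomial.map_sub, Polynomial.map_X,
      Polynomial.map_one]
    rw [← Polynomial.X_pow_mul, pow_add, mul_assoc]
  rw [radialInt_map_mul_C, map_smul, ← srcMono_eq_shiftExp, pairing_dualMono, hpoly, hX,
    map_nsmul, radialInt_X_pow_mul, zero_add, radialInt_map_mul_C,
    ← Nat.cast_prod, ← Polynomial.C_eq_natCast, radialInt_C_mul, ← Nat.cast_smul_eq_nsmul ℝ]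
  simp only [smul_smul]
  congr 1
  have hnum' := congrArg (Nat.cast (R := ℝ)) hnum
  rw [Nat.cast_mul, Nat.cast_mul] at hnum'
  rw [← mul_assoc, hnum']
  ring

lemma pairing_hOp {q : ℕ} {a : ChainF d k} (ha : ∀ μ, a μ ∈ ⋀[ℝ]^q (Fin d → ℝ))
    (p : DualPoly d k) :
    pairing (hOp d k a) p =
      ∑ i, xiContract d i (pairing a (dualRadial d k q (pderiv (0, i) p))) := by
  have h : pairing (hOp d k a) = ∑ i, xiContract d i ∘ₗ pairing a ∘ₗ dualRadial d k q ∘ₗ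
      (pderiv (R := ℝ) ((0, i) : Idx d k)).toLinearMap := by
    refine linearMap_ext_dualMono fun μ => ?_
    simp only [pairing_dualMono, LinearMap.sum_apply, LinearMap.comp_apply,
      Derivation.coeFn_coe, pderiv_dualMono, map_smul,
      pairing_dualRadial_dualMono ha, hOp, Finset.smul_sum]
    refine Finset.sum_congr rfl fun i _ => ?_
    split_ifs with hi
    · simp [hi]
    · rw [smul_smul, ← Nat.cast_mul, expFactorial_setExp_pred μ 0 i hi]
      rfl
  simpa using DFunLike.congr_fun h p

lemma deltaC_mem {q : ℕ} {a : ChainF d k} (ha : ∀ μ, a μ ∈ ⋀[ℝ]^q (Fin d → ℝ))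
    (μ : Fin (k + 1) → Fin d → ℕ) : deltaC d k a μ ∈ ⋀[ℝ]^(q + 1) (Fin d → ℝ) :=
  Submodule.sum_mem _ fun _ _ => Submodule.sum_mem _ fun i _ =>
    nsmul_mem (xi_mul_mem d i (ha _)) _

lemma pderiv_diagSum_mul (i l : Fin d) (p : DualPoly d k) :
    pderiv (0, i) (diagSum d k l * p) =
      (if i = l then p else 0) + diagSum d k l * pderiv (0, i) p := by
  have h : pderiv (0, i) (diagSum d k l) = if i = l then 1 else 0 := by
    rw [diagSum, map_sum, Finset.sum_eq_single_of_mem 0 (Finset.mem_univ _)]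
    · simp [pderiv_X, Pi.single_apply, eq_comm]
    · intro j _ hj
      simp [pderiv_X, hj]
  rw [Derivation.leibniz, h, smul_eq_mul, smul_eq_mul]
  split_ifs <;> simp [add_comm]

lemma deltaC_hOp_add_hOp_deltaC {q : ℕ} (hq : 1 ≤ q) {a : ChainF d k}
    (ha : ∀ μ, a μ ∈ ⋀[ℝ]^q (Fin d → ℝ)) :
    deltaC d k (hOp d k a) + hOp d k (deltaC d k a) = a := by
  refine eq_of_pairing_eq (LinearMap.ext fun p => ?_)
  have h₁ : ∀ i l, xi d i * xiContract d l (pairing a (dualRadial d k q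
      (pderiv (0, l) (diagSum d k i * p)))) =
        (if l = i then xi d i * xiContract d l (pairing a (dualRadial d k q p)) else 0) +
          xi d i * xiContract d l (pairing a (diagSum d k i *
            dualRadial d k (q + 1) (pderiv (0, l) p))) := by
    intro i l
    rw [pderiv_diagSum_mul, map_add, dualRadial_diagSum_mul, map_add, map_add, mul_add]
    split_ifs <;> simp
  rw [pairing_add, LinearMap.add_apply, pairing_deltaC, pairing_hOp (deltaC_mem ha)]
  simp_rw [pairing_hOp ha, pairing_deltaC, map_sum, Finset.mul_sum, xiContract_xi_mul, h₁,
    Finset.sum_add_distrib, Finset.sum_sub_distrib, Finset.sum_ite_eq', Finset.sum_ite_eq,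
    Finset.mem_univ, if_true]
  rw [sum_xi_mul_xiContract d (pairing_mem ha _), Finset.sum_comm, add_assoc, add_sub_cancel,
    ← map_sum, ← map_smul, ← map_add, dualRadial_euler d k hq]

end Pairing

/-- For every element `a ∈ C = ℝ[[y₀,…,y_k]] ⊗ Λ(ξ¹,…,ξ^d)` of pure
exterior degree `q ≥ 1` one has `δ(h(a)) + h(δ(a)) = a`.  Consequently the complex
`(C, δ)` of formal fiberwise Hochschild chains has vanishing cohomology in every
positive exterior degree. -/
theorem homotopy_identity (q : ℕ) (hq : 1 ≤ q) (a : ChainF d k)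
    (ha : ∀ μ, a μ ∈ ⋀[ℝ]^q (Fin d → ℝ)) :
    (∀ μ, deltaC d k (hOp d k a) μ + hOp d k (deltaC d k a) μ = a μ) ∧
    (deltaC d k a = 0 → ∃ b : ChainF d k, deltaC d k b = a) := by
  have h := deltaC_hOp_add_hOp_deltaC hq ha
  refine ⟨fun μ => congrFun h μ, fun h0 => ⟨hOp d k a, ?_⟩⟩
  have h0' : hOp d k (0 : ChainF d k) = 0 := by
    refine eq_of_pairing_eq (LinearMap.ext fun p => ?_)
    have hp : pairing (0 : ChainF d k) = 0 :=
      linearMap_ext_dualMono fun μ => by simp [pairing_dualMono]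
    rw [pairing_hOp (q := q) (a := (0 : ChainF d k)) (fun _ => Submodule.zero_mem _), hp]
    simp
  rwa [h0, h0', add_zero] at h

end FedosovChainHomotopy
end
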